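/- Let Z ⊂ P^5 be a smooth complete intersection of two quadrics with d ≥ 8, X ∈ |O_Z(d)| a smooth surface, and φ : X ⇢ P^2 a dominant rational map of degree at most 2d whose general fibers lie on smooth conics contained in a fixed quadric Q_t ∈ |I_Z(2)|, giving an induced rational map f : P^2 ⇢ B ⊂ P^3 to the closure B of the image of P^2 in a family P^3 of 2-planes in Q_t. Then f is birational; in particular B is a surface. -/

import Mathlib

open MvPolynomial

noncomputable section

/-- Points of the complex projective space whose homogeneous coordinates are
indexed by `ι` (so for `ι = Fin (N+1)` this is `ℙ^N`). -/
abbrev PPt (ι : Type) : Type := Projectivization ℂ (ι → ℂ)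

/-- A polynomial vanishes at a projective point if it vanishes at every
representative vector of the point. -/
def PVanish {ι : Type} (f : MvPolynomial ι ℂ) (x : PPt ι) : Prop :=
  ∀ (v : ι → ℂ) (hv : v ≠ 0), Projectivization.mk ℂ v hv = x → eval v f = 0

/-- The zero locus of a polynomial in projective space. -/
def ZeroSet {ι : Type} (f : MvPolynomial ι ℂ) : Set (PPt ι) :=
  {x | PVanish f x}

/-- Zariski-closed subsets of projective space: common zero loci of families of
homogeneous polynomials. -/
def IsZClosed {ι : Type} (Y : Set (PPt ι)) : Prop :=
  ∃ fs : Set (MvPolynomial ι ℂ),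
    (∀ f ∈ fs, ∃ e, f.IsHomogeneous e) ∧ Y = {x | ∀ f ∈ fs, PVanish f x}

/-- `U` contains a dense (Zariski-)open subset of `X`: there is a Zariski-closed
set `Y` not containing `X` with `X \ Y ⊆ U`.  Taking `X = Set.univ` this is the
notion of a set containing "the general point" of the ambient projective space. -/
def ContainsDenseOpenOf {ι : Type} (X U : Set (PPt ι)) : Prop :=
  ∃ Y : Set (PPt ι), IsZClosed Y ∧ ¬ X ⊆ Y ∧ X \ Y ⊆ U

/-- The set of projective points lying in (the projectivization of) a linear
subspace `W`. -/
def LinSet {ι : Type} (W : Submodule ℂ (ι → ℂ)) : Set (PPt ι) :=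
  {x | x.submodule ≤ W}

/-- A line in projective space: the projectivization of a 2-dimensional
linear subspace. -/
def IsLine {ι : Type} (L : Set (PPt ι)) : Prop :=
  ∃ W : Submodule ℂ (ι → ℂ), Module.finrank ℂ W = 2 ∧ L = LinSet W

/-- A smooth plane conic with supporting plane `P(W)`: the zero locus, inside the
projective plane `P(W)`, of a quadric which does not vanish identically on `W`
and whose restriction to `W` has no singular points. -/
def IsConicIn {ι : Type} [Fintype ι] (W : Submodule ℂ (ι → ℂ))
    (C : Set (PPt ι)) : Prop :=
  Module.finrank ℂ W = 3 ∧
  ∃ f : MvPolynomial ι ℂ, f.IsHomogeneous 2 ∧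
    C = {x | x.submodule ≤ W ∧ PVanish f x} ∧
    (∃ v ∈ W, eval v f ≠ 0) ∧
    (∀ v ∈ W, v ≠ 0 → eval v f = 0 →
      ∃ w ∈ W, (∑ i, eval v (pderiv i f) * w i) ≠ 0)

/-- A smooth plane conic in projective space. -/
def IsSmoothConic {ι : Type} [Fintype ι] (C : Set (PPt ι)) : Prop :=
  ∃ W, IsConicIn W C

/-- The Cayley–Bacharach condition `CB(m)`: every degree-`m` hypersurface
containing all points of `S` but one contains all of `S`. -/
def SatisfiesCB {ι : Type} (m : ℕ) (S : Finset (PPt ι)) : Prop :=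
  ∀ f : MvPolynomial ι ℂ, f.IsHomogeneous m →
    ∀ p ∈ S, (∀ q ∈ S, q ≠ p → PVanish f q) → PVanish f p

/-- A smooth projective hypersurface of degree `e`: the partial derivatives of
its (homogeneous) equation have no common nontrivial zero. -/
def IsSmoothHyp {ι : Type} [Fintype ι] (f : MvPolynomial ι ℂ) (e : ℕ) : Prop :=
  f.IsHomogeneous e ∧ f ≠ 0 ∧
    ∀ v : ι → ℂ, v ≠ 0 → ¬ (∀ i, eval v (pderiv i f) = 0)

/-- `{f = g = 0}` is a smooth complete intersection: at every common nontrivial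
zero the two gradients are linearly independent. -/
def IsSmoothCI2 {ι : Type} [Fintype ι] (f g : MvPolynomial ι ℂ) : Prop :=
  ∀ v : ι → ℂ, v ≠ 0 → eval v f = 0 → eval v g = 0 →
    ∀ a b : ℂ, (∀ i, a * eval v (pderiv i f) + b * eval v (pderiv i g) = 0) →
      a = 0 ∧ b = 0

/-- `{f = g = h = 0}` is a smooth complete intersection: at every common
nontrivial zero the three gradients are linearly independent. -/
def IsSmoothCI3 {ι : Type} [Fintype ι] (f g h : MvPolynomial ι ℂ) : Prop :=
  ∀ v : ι → ℂ, v ≠ 0 → eval v f = 0 → eval v g = 0 → eval v h = 0 →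
    ∀ a b c : ℂ,
      (∀ i, a * eval v (pderiv i f) + b * eval v (pderiv i g)
        + c * eval v (pderiv i h) = 0) →
      a = 0 ∧ b = 0 ∧ c = 0

/-- A rational map from (a subvariety of) the projective space with coordinates
`ι` to `ℙ^n`, given by an `(n+1)`-tuple of homogeneous polynomials of a common
degree `e`. -/
structure RatMapTo (ι : Type) (n : ℕ) where
  F : Fin (n + 1) → MvPolynomial ι ℂ
  e : ℕ
  homog : ∀ j, (F j).IsHomogeneous e

namespace RatMapTo

variable {ι : Type} {n : ℕ}

def evalVec (φ : RatMapTo ι n) (v : ι → ℂ) : Fin (n + 1) → ℂ :=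
  fun j => eval v (φ.F j)

/-- `φ` is defined at `x` and sends `x` to `y`. -/
def mapsTo (φ : RatMapTo ι n) (x : PPt ι) (y : PPt (Fin (n + 1))) : Prop :=
  ∀ (v : ι → ℂ) (hv : v ≠ 0), Projectivization.mk ℂ v hv = x →
    ∃ hw : φ.evalVec v ≠ 0, Projectivization.mk ℂ (φ.evalVec v) hw = y

/-- The fiber over `y` of the restriction of `φ` to `X`. -/
def fiber (φ : RatMapTo ι n) (X : Set (PPt ι)) (y : PPt (Fin (n + 1))) :
    Set (PPt ι) :=
  {x ∈ X | φ.mapsTo x y}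

/-- The restriction of `φ` to `X` is a dominant rational map of degree `δ`:
the fiber over a general point of `ℙ^n` consists of exactly `δ` points. -/
def DominantOfDegree (φ : RatMapTo ι n) (X : Set (PPt ι)) (δ : ℕ) : Prop :=
  0 < δ ∧
  ∃ V : Set (PPt (Fin (n + 1))), ContainsDenseOpenOf Set.univ V ∧
    ∀ y ∈ V, (φ.fiber X y).Finite ∧ (φ.fiber X y).ncard = δ

end RatMapTo

/-- The degree of irrationality of `X`: the minimal degree of a dominant
rational map `X ⇢ ℙ^n`. -/
def irr {ι : Type} (n : ℕ) (X : Set (PPt ι)) : ℕ :=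
  sInf {δ : ℕ | ∃ φ : RatMapTo ι n, φ.DominantOfDegree X δ}

/-- `ψ` is the linear projection away from the linear subspace `P(W)`:
it is given by linear forms whose common kernel is exactly `W`. -/
def IsLinearProjectionFrom {ι : Type} {n : ℕ} (ψ : RatMapTo ι n)
    (W : Submodule ℂ (ι → ℂ)) : Prop :=
  ψ.e = 1 ∧ ∀ v : ι → ℂ, ψ.evalVec v = 0 ↔ v ∈ W

/-- The rational maps `φ` and `ψ` on `X` are birationally equivalent: they
differ by composition with a birational automorphism `τ` of the target `ℙ^n`. -/
def BirEquivTo {ι : Type} {n : ℕ} (X : Set (PPt ι)) (φ ψ : RatMapTo ι n) : Prop :=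
  ∃ τ : RatMapTo (Fin (n + 1)) n, τ.DominantOfDegree Set.univ 1 ∧
    ∃ U : Set (PPt ι), ContainsDenseOpenOf X U ∧
      ∀ x ∈ U, ∃ y z, φ.mapsTo x y ∧ ψ.mapsTo x z ∧ τ.mapsTo z y

/-- `A` is contained in a proper Zariski-closed subset of the (projective) space
of degree-`d` forms: it is cut out by a polynomial in the coefficients which is
not identically zero on degree-`d` forms. -/
def CoeffPolyProperClosed {ι : Type} (d : ℕ) (A : Set (MvPolynomial ι ℂ)) : Prop :=
  ∃ (κ : ℕ) (mons : Fin κ → (ι →₀ ℕ)) (Q : MvPolynomial (Fin κ) ℂ),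
    (∀ g ∈ A, eval (fun j => coeff (mons j) g) Q = 0) ∧
    (∃ g : MvPolynomial ι ℂ, g.IsHomogeneous d ∧
      eval (fun j => coeff (mons j) g) Q ≠ 0)

end

open MeasureTheory Complex Metric Filter Topology Set in
theorem circ_mean (f : ℂ → ℂ) (z : ℂ) (R r : ℝ) (hr : 0 < r) (hrR : r < R)
    (hf : DifferentiableOn ℂ f (ball z R)) :
    ENNReal.ofReal (2 * Real.pi * ‖f z‖^2) ≤
      ∫⁻ θ in Ioo (-Real.pi) Real.pi, ENNReal.ofReal (‖f (z + Complex.polarCoord.symm (r, θ))‖^2) := by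
  have hsub : closedBall z r ⊆ ball z R := closedBall_subset_ball hrR
  have h1 : Real.circleAverage (fun w => f w ^ 2) z r = f z ^ 2 := by
    apply circleAverage_of_differentiable_on_off_countable countable_empty
    · rw [abs_of_pos hr]
      exact ((hf.continuousOn).pow 2).mono hsub
    · intro w hw
      rw [abs_of_pos hr] at hw
      exact ((hf w (hsub (ball_subset_closedBall hw.1))).differentiableAt
        (isOpen_ball.mem_nhds (hsub (ball_subset_closedBall hw.1)))).pow 2
  rw [Real.circleAverage_def] at h1
  have hper : Function.Periodic (fun θ : ℝ => f (circleMap z r θ) ^ 2) (2 * Real.pi) := by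
    intro θ; simp [periodic_circleMap z r θ]
  have h2 : ∫ θ in (0:ℝ)..2 * Real.pi, f (circleMap z r θ) ^ 2
      = ∫ θ in (-Real.pi)..Real.pi, f (circleMap z r θ) ^ 2 := by
    have := hper.intervalIntegral_add_eq 0 (-Real.pi)
    simp only [zero_add] at this
    rw [this]; congr 1; ring
  rw [h2, intervalIntegral.integral_of_le (by linarith [Real.pi_pos]), integral_Ioc_eq_integral_Ioo] at h1
  have h3 : ∫ θ in Ioo (-Real.pi) Real.pi, f (circleMap z r θ) ^ 2 = (2 * Real.pi) • (f z)^2 := by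
    rw [← h1, smul_smul, mul_inv_cancel₀ (by positivity), one_smul]
  have h4 := enorm_integral_le_lintegral_enorm (μ := volume.restrict (Ioo (-Real.pi) Real.pi))
    (fun θ => f (circleMap z r θ) ^ 2)
  rw [h3] at h4
  calc ENNReal.ofReal (2 * Real.pi * ‖f z‖^2) = ‖(2 * Real.pi) • (f z)^2‖ₑ := by
        rw [← ofReal_norm, norm_smul, norm_pow, Real.norm_of_nonneg (by positivity)]
    _ ≤ _ := h4
    _ = _ := by
        congr 1; ext θ
        rw [← ofReal_norm, norm_pow, circleMap]
        simp only [Complex.polarCoord_symm_apply]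
        rw [Complex.exp_mul_I]
        simp
open MeasureTheory Complex Metric Filter Topology Set in
theorem submean (f : ℂ → ℂ) (z : ℂ) (R : ℝ) (hR : 0 < R) (hf : DifferentiableOn ℂ f (ball z R)) :
    ENNReal.ofReal (Real.pi * R^2 * ‖f z‖^2) ≤ ∫⁻ w in ball z R, ENNReal.ofReal (‖f w‖^2) := by
  set F : ℂ → ENNReal := fun w => ENNReal.ofReal (‖f w‖^2) with hF
  have e1 : ∫⁻ w in ball z R, F w = ∫⁻ w, (ball z R).indicator F (z + w) := by
    rw [lintegral_add_left_eq_self (μ := volume) ((ball z R).indicator F) z,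
      lintegral_indicator measurableSet_ball]
  rw [e1, ← Complex.lintegral_comp_polarCoord_symm]
  have hsub : (Ioo 0 R ×ˢ Ioo (-Real.pi) Real.pi) ⊆ polarCoord.target := by
    rw [polarCoord_target]
    exact prod_mono Ioo_subset_Ioi_self le_rfl
  refine le_trans ?_ (lintegral_mono_set hsub)
  have hmem : ∀ p ∈ (Ioo 0 R ×ˢ Ioo (-Real.pi) Real.pi), z + Complex.polarCoord.symm p ∈ ball z R := by
    intro p hp
    rw [mem_ball, dist_eq_norm, add_sub_cancel_left, norm_polarCoord_symm, abs_of_pos hp.1.1]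
    exact hp.1.2
  have e2 : ∫⁻ p in (Ioo 0 R ×ˢ Ioo (-Real.pi) Real.pi),
      ENNReal.ofReal p.1 • (ball z R).indicator F (z + Complex.polarCoord.symm p)
      = ∫⁻ p in (Ioo 0 R ×ˢ Ioo (-Real.pi) Real.pi),
      ENNReal.ofReal p.1 * F (z + Complex.polarCoord.symm p) := by
    apply setLIntegral_congr_fun (measurableSet_Ioo.prod measurableSet_Ioo)
    intro p hp
    simp only [smul_eq_mul]
    rw [indicator_of_mem (hmem p hp)]
  rw [e2, Measure.volume_eq_prod, ← Measure.prod_restrict, lintegral_prod]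
  · calc ENNReal.ofReal (Real.pi * R^2 * ‖f z‖^2)
        = ∫⁻ r in Ioo 0 R, ENNReal.ofReal (r * (2 * Real.pi * ‖f z‖^2)) := by
          rw [← ofReal_integral_eq_lintegral_ofReal]
          · congr 1
            rw [integral_mul_const, ← integral_Ioc_eq_integral_Ioo, ← intervalIntegral.integral_of_le hR.le, integral_id]
            ring
          · refine (Continuous.integrableOn_Icc (by fun_prop)).mono_set Ioo_subset_Icc_self
          · filter_upwards [ae_restrict_mem measurableSet_Ioo] with r hr
            have := hr.1
            simp only [Pi.zero_apply]; positivity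
      _ ≤ _ := by
          apply setLIntegral_mono' measurableSet_Ioo
          intro r hr
          rw [ENNReal.ofReal_mul hr.1.le]
          refine le_trans ?_ (lintegral_const_mul_le (ENNReal.ofReal r) (fun θ => F (z + Complex.polarCoord.symm (r, θ))))
          gcongr
          exact circ_mean f z R r hr.1 hr.2 hf
  · rw [Measure.prod_restrict]
    apply ContinuousOn.aemeasurable _ (measurableSet_Ioo.prod measurableSet_Ioo)
    have c1 : Continuous fun p : ℝ × ℝ => z + Complex.polarCoord.symm p := by
      simp only [Complex.polarCoord_symm_apply]; fun_prop
    have c2 : ContinuousOn (fun p : ℝ × ℝ => f (z + Complex.polarCoord.symm p))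
        (Ioo 0 R ×ˢ Ioo (-Real.pi) Real.pi) := hf.continuousOn.comp c1.continuousOn hmem
    have c3 : ContinuousOn (fun p : ℝ × ℝ => ENNReal.ofReal (p.1 * ‖f (z + Complex.polarCoord.symm p)‖^2))
        (Ioo 0 R ×ˢ Ioo (-Real.pi) Real.pi) :=
      ENNReal.continuous_ofReal.comp_continuousOn (continuous_fst.continuousOn.mul (c2.norm.pow 2))
    refine c3.congr ?_
    intro p hp
    exact (ENNReal.ofReal_mul hp.1.1.le).symm
open MeasureTheory Complex Metric Filter Topology Set in
theorem l2_entire (f : ℂ → ℂ) (hf : Differentiable ℂ f)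
    (hI : ∫⁻ w, ENNReal.ofReal (‖f w‖^2) < ⊤) (z : ℂ) : f z = 0 := by
  by_contra hne
  have key : ∀ R : ℝ, 0 < R → Real.pi * R^2 * ‖f z‖^2 ≤ (∫⁻ w, ENNReal.ofReal (‖f w‖^2)).toReal := by
    intro R hR
    have h1 := (submean f z R hR hf.differentiableOn).trans
      (setLIntegral_le_lintegral _ _)
    rwa [ENNReal.ofReal_le_iff_le_toReal hI.ne] at h1
  set I := (∫⁻ w, ENNReal.ofReal (‖f w‖^2)).toReal with hIdef
  have hpos : 0 < ‖f z‖ := norm_pos_iff.mpr hne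
  have hI0 : 0 ≤ I := ENNReal.toReal_nonneg
  have h := key ((I+1)/‖f z‖ + 1) (by positivity)
  have h2 : ((I+1)/‖f z‖ + 1)^2 * ‖f z‖^2 = (I + 1 + ‖f z‖)^2 := by field_simp
  have h3 : Real.pi * (I + 1 + ‖f z‖)^2 ≤ I := by rw [← h2]; linarith
  nlinarith [Real.pi_gt_three, sq_nonneg (I + 1 + ‖f z‖), sq_nonneg I]
open MeasureTheory Complex Metric Filter Topology Set in
theorem l2_littleO (f : ℂ → ℂ) (c : ℂ) (U : Set ℂ) (hU : U ∈ 𝓝 c) (hd : DifferentiableOn ℂ f (U \ {c}))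
    (hI : ∫⁻ w, ENNReal.ofReal (‖f w‖^2) < ⊤) :
    (fun z => f z - f c) =o[𝓝[≠] c] fun z => (z - c)⁻¹ := by
  have hconst : (fun _ : ℂ => f c) =o[𝓝[≠] c] fun z => (z - c)⁻¹ := by
    rw [Asymptotics.isLittleO_const_left]
    right
    have : Tendsto (fun z : ℂ => z - c) (𝓝[≠] c) (𝓝[≠] 0) := by
      rw [tendsto_nhdsWithin_iff]
      refine ⟨?_, ?_⟩
      · have : Tendsto (fun z : ℂ => z - c) (𝓝 c) (𝓝 (c - c)) := by
          exact (continuous_id.sub continuous_const).tendsto c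
        rw [sub_self] at this
        exact this.mono_left nhdsWithin_le_nhds
      · filter_upwards [self_mem_nhdsWithin] with z hz
        simpa [sub_eq_zero] using hz
    exact (tendsto_norm_inv_nhdsNE_zero_atTop).comp this
  refine Asymptotics.IsLittleO.sub ?_ hconst
  rw [Asymptotics.isLittleO_iff]
  intro ε hε
  obtain ⟨R0, hR0, hball⟩ := Metric.mem_nhds_iff.mp hU
  -- absolute continuity
  have hac : Tendsto (fun r : ℝ => ∫⁻ w in ball c r, ENNReal.ofReal (‖f w‖^2)) (𝓝[>] 0) (𝓝 0) := by
    apply tendsto_setLIntegral_zero hI.ne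
    have h0 : Tendsto (fun r : ℝ => volume (closedBall c r)) (𝓝[>] 0) (𝓝 0) := by
      have : Tendsto (fun r : ℝ => ENNReal.ofReal r ^ 2 * NNReal.pi) (𝓝[>] 0) (𝓝 (ENNReal.ofReal 0 ^ 2 * NNReal.pi)) := by
        refine Tendsto.mono_left ?_ nhdsWithin_le_nhds
        refine ENNReal.Tendsto.mul_const ?_ (by simp)
        exact ((ENNReal.continuous_pow 2).comp ENNReal.continuous_ofReal).tendsto 0
      simp only [ENNReal.ofReal_zero, ne_eq, OfNat.ofNat_ne_zero, not_false_eq_true, zero_pow, zero_mul] at this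
      simpa [Complex.volume_closedBall] using this
    exact tendsto_of_tendsto_of_tendsto_of_le_of_le tendsto_const_nhds h0 (fun _ => zero_le)
      (fun r => measure_mono ball_subset_closedBall)
  have hev : ∀ᶠ r : ℝ in 𝓝[>] 0, ∫⁻ w in ball c r, ENNReal.ofReal (‖f w‖^2) < ENNReal.ofReal (ε^2) :=
    hac.eventually_lt_const (by positivity)
  rw [eventually_nhdsWithin_iff, Metric.eventually_nhds_iff] at hev
  obtain ⟨r1, hr1, hev⟩ := hev
  rw [eventually_nhdsWithin_iff, Metric.eventually_nhds_iff]
  refine ⟨min (r1/2) (R0/2), by positivity, ?_⟩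
  intro z hz hzc
  have hzc' : z ≠ c := hzc
  have hpos : 0 < dist z c := dist_pos.mpr hzc'
  set R := dist z c with hR
  have hz1 : R < r1/2 := lt_of_lt_of_le hz (min_le_left _ _)
  have hz2 : R < R0/2 := lt_of_lt_of_le hz (min_le_right _ _)
  have hs1 : ball z R ⊆ ball c (2 * R) := by
    intro w hw
    rw [mem_ball] at hw ⊢
    linarith [dist_triangle w z c]
  have hs2 : ball z R ⊆ U \ {c} := by
    intro w hw
    refine ⟨hball ?_, ?_⟩
    · have := hs1 hw
      rw [mem_ball] at this ⊢; linarith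
    · rintro rfl
      rw [mem_ball, dist_comm] at hw; exact lt_irrefl _ hw
  have h1 := submean f z R hpos (hd.mono hs2)
  have h2 := (h1.trans (lintegral_mono_set hs1)).trans_lt
    (hev (y := 2 * R) (by rw [Real.dist_eq, sub_zero, abs_of_pos (by positivity)]; linarith) (by simpa using hpos))
  rw [ENNReal.ofReal_lt_ofReal_iff (by positivity)] at h2
  have h3 : (R * ‖f z‖)^2 ≤ ε^2 := by
    have : 0 ≤ (R * ‖f z‖)^2 := by positivity
    nlinarith [Real.pi_gt_three]
  have h4 : R * ‖f z‖ ≤ ε := by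
    exact (pow_le_pow_iff_left₀ (by positivity) hε.le two_ne_zero).mp h3
  rw [norm_inv, ← dist_eq_norm, ← hR, ← div_eq_mul_inv, le_div_iff₀ hpos]
  linarith
open MeasureTheory Complex Metric Filter Topology Set in
theorem l2_remove (S : Finset ℂ) : ∀ (f : ℂ → ℂ) (_ : DifferentiableOn ℂ f (↑S)ᶜ)
    (_ : ∫⁻ w, ENNReal.ofReal (‖f w‖^2) < ⊤), ∀ z ∉ S, f z = 0 := by
  classical
  induction S using Finset.induction_on with
  | empty =>
    intro f hf hI z _
    exact l2_entire f (by simpa [differentiableOn_univ] using hf) hI z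
  | insert c S hc ih =>
    intro f hf hI z hz
    have hopen : IsOpen ((↑S : Set ℂ)ᶜ) := S.finite_toSet.isClosed.isOpen_compl
    have hmem : ((↑S : Set ℂ)ᶜ) ∈ 𝓝 c := hopen.mem_nhds (by simpa using hc)
    have hd : DifferentiableOn ℂ f ((↑S : Set ℂ)ᶜ \ {c}) := by
      refine hf.mono ?_
      intro x hx
      simp only [Finset.coe_insert, mem_compl_iff, mem_insert_iff, not_or]
      exact ⟨by simpa using hx.2, hx.1⟩
    have hlo : (fun z => f z - f c) =o[𝓝[≠] c] fun z => (z - c)⁻¹ := by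
      exact l2_littleO f c _ hmem hd hI
    have hd2 := differentiableOn_update_limUnder_of_isLittleO hmem hd hlo
    have := ih _ hd2 (by
      rw [lintegral_congr_ae (g := fun w => ENNReal.ofReal (‖f w‖^2))]
      · exact hI
      · have : ∀ᵐ w : ℂ, w ≠ c := by simp [ae_iff]
        filter_upwards [this] with w hw
        simp [Function.update_of_ne hw]) z (by simp at hz; exact hz.2)
    rwa [Function.update_of_ne (by simp at hz; exact hz.1)] at this

theorem elim_image {n m : ℕ} (Ps : Set (MvPolynomial (Fin n) ℂ)) (F : Fin m → MvPolynomial (Fin n) ℂ) :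
    (∃ D : MvPolynomial (Fin m) ℂ, D ≠ 0 ∧ ∀ x : Fin n → ℂ, (∀ p ∈ Ps, eval x p = 0) →
      eval (fun i => eval x (F i)) D = 0) ∨
    (∃ r : MvPolynomial (Fin m) ℂ, r ≠ 0 ∧ ∀ y : Fin m → ℂ, eval y r ≠ 0 →
      ∃ x : Fin n → ℂ, (∀ p ∈ Ps, eval x p = 0) ∧ (fun i => eval x (F i)) = y) := by
  classical
  set I := Ideal.span Ps with hI
  let ψ : MvPolynomial (Fin m) ℂ →ₐ[ℂ] (MvPolynomial (Fin n) ℂ ⧸ I) :=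
    (Ideal.Quotient.mkₐ ℂ I).comp (aeval F)
  have hvan : ∀ x : Fin n → ℂ, (∀ p ∈ Ps, eval x p = 0) → ∀ p ∈ I, eval x p = 0 := by
    intro x hx p hp
    have : I ≤ RingHom.ker (eval x) := by
      rw [hI, Ideal.span_le]; intro q hq; exact hx q hq
    exact this hp
  have hcomp : ∀ (x : Fin n → ℂ) (D : MvPolynomial (Fin m) ℂ),
      eval x (aeval F D) = eval (fun i => eval x (F i)) D := by
    intro x D
    induction D using MvPolynomial.induction_on with
    | C a => simp
    | add p q hp hq => simp only [map_add, hp, hq]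
    | mul_X p i hp => simp only [map_mul, hp, aeval_X, eval_X]
  by_cases hinj : Function.Injective ψ
  · right
    have hfp : ψ.toRingHom.FinitePresentation := by
      apply RingHom.FinitePresentation.of_finiteType.mp
      have h1 : (algebraMap ℂ (MvPolynomial (Fin n) ℂ ⧸ I)).FiniteType := by
        rw [RingHom.finiteType_algebraMap]; infer_instance
      have h2 : ψ.toRingHom.comp (algebraMap ℂ (MvPolynomial (Fin m) ℂ)) =
        algebraMap ℂ (MvPolynomial (Fin n) ℂ ⧸ I) := ψ.comp_algebraMap
      rw [← h2] at h1
      exact RingHom.FiniteType.of_comp_finiteType h1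
    have hc := PrimeSpectrum.isConstructible_range_comap hfp
    obtain ⟨S, hS⟩ := PrimeSpectrum.exists_constructibleSetData_iff.mpr hc
    have hbot : (⟨⊥, Ideal.isPrime_bot⟩ : PrimeSpectrum (MvPolynomial (Fin m) ℂ)) ∈ S.toSet := by
      rw [hS]
      obtain ⟨p, hp, hpc⟩ := Ideal.exists_comap_eq_of_mem_minimalPrimes_of_injective
        (f := ψ.toRingHom) hinj ⊥ (by rw [IsDomain.minimalPrimes_eq_singleton_bot]; rfl)
      exact ⟨⟨p, hp⟩, PrimeSpectrum.ext hpc⟩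
    simp only [PrimeSpectrum.ConstructibleSetData.toSet, Set.mem_iUnion] at hbot
    obtain ⟨C, hC, hbot⟩ := hbot
    refine ⟨C.f, ?_, ?_⟩
    · rintro h0
      apply hbot.2
      simp [h0]
    · intro y hy
      have hker : (RingHom.ker (eval y)).IsMaximal :=
        RingHom.ker_isMaximal_of_surjective _ (fun c => ⟨MvPolynomial.C c, by simp⟩)
      have hmem : (⟨RingHom.ker (eval y), hker.isPrime⟩ : PrimeSpectrum (MvPolynomial (Fin m) ℂ)) ∈ S.toSet := by
        simp only [PrimeSpectrum.ConstructibleSetData.toSet, Set.mem_iUnion]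
        refine ⟨C, hC, ?_, ?_⟩
        · have h1 := hbot.1
          intro g hg
          have := h1 hg
          simp at this
          simp [this]
        · intro h
          apply hy
          simpa using h
      rw [hS] at hmem
      obtain ⟨Q, hQ⟩ := hmem
      obtain ⟨M, hM, hQM⟩ := Ideal.exists_le_maximal Q.asIdeal Q.isPrime.ne_top
      have hM' : (M.comap (Ideal.Quotient.mk I)).IsMaximal :=
        Ideal.comap_isMaximal_of_surjective _ Ideal.Quotient.mk_surjective
      obtain ⟨x, hx⟩ := MvPolynomial.isMaximal_iff_eq_vanishingIdeal_singleton.mp hM'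
      refine ⟨x, ?_, ?_⟩
      · intro p hp
        have : p ∈ M.comap (Ideal.Quotient.mk I) := by
          rw [Ideal.mem_comap, Ideal.Quotient.eq_zero_iff_mem.mpr (Ideal.subset_span hp)]
          exact M.zero_mem
        rw [hx] at this
        simpa using this
      · ext i
        have h1 : (X i - MvPolynomial.C (y i) : MvPolynomial (Fin m) ℂ) ∈ RingHom.ker (eval y) := by simp [RingHom.mem_ker]
        have h2 : (X i - MvPolynomial.C (y i) : MvPolynomial (Fin m) ℂ) ∈ (PrimeSpectrum.comap ψ.toRingHom Q).asIdeal := by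
          rw [hQ]; exact h1
        have h3 : F i - MvPolynomial.C (y i) ∈ M.comap (Ideal.Quotient.mk I) := by
          rw [Ideal.mem_comap]
          apply hQM
          simpa [ψ] using h2
        rw [hx] at h3
        have h4 : eval x (F i - MvPolynomial.C (y i)) = 0 := by simpa using h3
        simpa [sub_eq_zero] using h4
  · left
    rw [injective_iff_map_eq_zero] at hinj
    push Not at hinj
    obtain ⟨D, hD, hD0⟩ := hinj
    refine ⟨D, hD0, fun x hx => ?_⟩
    rw [← hcomp]
    apply hvan x hx
    rw [← Ideal.Quotient.eq_zero_iff_mem]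
    exact hD

/-- the gradient covector of a polynomial -/
noncomputable def gradL {n : ℕ} (p : MvPolynomial (Fin n) ℂ) (v : Fin n → ℂ) : (Fin n → ℂ) →L[ℂ] ℂ :=
  ∑ i, eval v (pderiv i p) • ContinuousLinearMap.proj (R := ℂ) (φ := fun _ : Fin n => ℂ) i

theorem gradL_apply {n : ℕ} (p : MvPolynomial (Fin n) ℂ) (v x : Fin n → ℂ) :
    gradL p v x = ∑ i, eval v (pderiv i p) * x i := by
  simp [gradL]

theorem gradL_single {n : ℕ} (p : MvPolynomial (Fin n) ℂ) (v : Fin n → ℂ) (j : Fin n) :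
    gradL p v (Pi.single j 1) = eval v (pderiv j p) := by
  simp [gradL_apply, Pi.single_apply]

theorem eval_hasStrict {n : ℕ} (p : MvPolynomial (Fin n) ℂ) (v : Fin n → ℂ) :
    HasStrictFDerivAt (fun x : Fin n → ℂ => eval x p) (gradL p v) v := by
  induction p using MvPolynomial.induction_on with
  | C a =>
    have : gradL (MvPolynomial.C a) v = 0 := by ext; simp [gradL]
    rw [this]; simpa using hasStrictFDerivAt_const a v
  | add p q hp hq =>
    have : gradL (p + q) v = gradL p v + gradL q v := by
      ext x; simp [gradL_apply, Finset.sum_add_distrib, add_mul]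
    rw [this]
    have h3 := hp.add hq
    refine h3.congr_of_eventuallyEq (Filter.Eventually.of_forall fun x => ?_)
    simp
  | mul_X p i hp =>
    have : gradL (p * X i) v = eval v p • ContinuousLinearMap.proj (R := ℂ) (φ := fun _ : Fin n => ℂ) i + v i • gradL p v := by
      ext x
      simp only [gradL_apply, Derivation.leibniz, pderiv_X, smul_eq_mul, map_add, map_mul, eval_X, add_mul,
        Finset.sum_add_distrib, add_apply, smul_apply,
        ContinuousLinearMap.proj_apply, Finset.mul_sum]
      congr 1
      · rw [Finset.sum_eq_single i]
        · simp
        · intro j _ hj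
          simp [Pi.single_apply, hj.symm]
        · simp
      · exact Finset.sum_congr rfl fun j _ => by ring
    rw [this]
    have h2 : HasStrictFDerivAt (fun x : Fin n → ℂ => x i) (ContinuousLinearMap.proj (R := ℂ) (φ := fun _ : Fin n => ℂ) i) v :=
      (ContinuousLinearMap.proj (R := ℂ) (φ := fun _ : Fin n => ℂ) i).hasStrictFDerivAt
    have h3 := hp.mul h2
    refine h3.congr_of_eventuallyEq (Filter.Eventually.of_forall fun x => ?_)
    simp

theorem eval_continuous {n : ℕ} (p : MvPolynomial (Fin n) ℂ) :
    Continuous (fun x : Fin n → ℂ => eval x p) := MvPolynomial.continuous_eval p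

theorem eval_hom {n k : ℕ} {p : MvPolynomial (Fin n) ℂ} (hp : p.IsHomogeneous k) (c : ℂ) (v : Fin n → ℂ) :
    eval (c • v) p = c ^ k * eval v p := by
  rw [eval_eq, eval_eq, Finset.mul_sum]
  refine Finset.sum_congr rfl fun m hm => ?_
  have h1 : m.degree = k := by
    have := hp (mem_support_iff.mp hm)
    rwa [Finsupp.degree_eq_weight_one]
  simp only [Pi.smul_apply, smul_eq_mul, mul_pow]
  rw [Finset.prod_mul_distrib, Finset.prod_pow_eq_pow_sum]
  rw [← h1, Finsupp.degree_eq_sum]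
  rw [Finset.sum_subset (Finset.subset_univ m.support)]
  · ring
  · intro x _ hx; simpa using hx

theorem pderiv_hom {n k : ℕ} {p : MvPolynomial (Fin n) ℂ} (hp : p.IsHomogeneous k) (i : Fin n) :
    (pderiv i p).IsHomogeneous (k - 1) := hp.pderiv

theorem gradL_hom {n k : ℕ} {p : MvPolynomial (Fin n) ℂ} (hp : p.IsHomogeneous k) (c : ℂ) (v : Fin n → ℂ) :
    gradL p (c • v) = c ^ (k - 1) • gradL p v := by
  ext x
  simp [gradL_apply, fun j => eval_hom (pderiv_hom hp j), Finset.mul_sum, mul_assoc]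

theorem euler_gradL {n k : ℕ} {p : MvPolynomial (Fin n) ℂ} (hp : p.IsHomogeneous k) (v : Fin n → ℂ) :
    gradL p v v = k * eval v p := by
  have := congrArg (eval v) hp.sum_X_mul_pderiv
  simp only [map_sum, map_mul, eval_X, nsmul_eq_mul, map_natCast] at this
  rw [gradL_apply, ← this]
  exact Finset.sum_congr rfl fun i _ => mul_comm _ _

/-- evaluation of a polynomial system -/
noncomputable def sysMap {n : ℕ} (P : Fin n → MvPolynomial (Fin n) ℂ) (v : Fin n → ℂ) : Fin n → ℂ :=
  fun i => eval v (P i)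

/-- Jacobian matrix -/
noncomputable def Jac {n : ℕ} (P : Fin n → MvPolynomial (Fin n) ℂ) (v : Fin n → ℂ) : Matrix (Fin n) (Fin n) ℂ :=
  Matrix.of fun i j => eval v (pderiv j (P i))

theorem Jac_mulVec {n : ℕ} (P : Fin n → MvPolynomial (Fin n) ℂ) (v x : Fin n → ℂ) (i : Fin n) :
    (Jac P v).mulVec x i = gradL (P i) v x := by
  simp [Jac, Matrix.mulVec, dotProduct, gradL_apply]

/-- derivative of the system -/
noncomputable def sysD {n : ℕ} (P : Fin n → MvPolynomial (Fin n) ℂ) (v : Fin n → ℂ) : (Fin n → ℂ) →L[ℂ] (Fin n → ℂ) :=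
  ContinuousLinearMap.pi fun i => gradL (P i) v

theorem sysMap_hasStrict {n : ℕ} (P : Fin n → MvPolynomial (Fin n) ℂ) (v : Fin n → ℂ) :
    HasStrictFDerivAt (sysMap P) (sysD P v) v :=
  hasStrictFDerivAt_pi.mpr fun i => eval_hasStrict (P i) v

theorem sysD_eq {n : ℕ} (P : Fin n → MvPolynomial (Fin n) ℂ) (v x : Fin n → ℂ) :
    sysD P v x = (Jac P v).mulVec x := by
  ext i; simp [sysD, Jac_mulVec]

theorem det_Jac_continuous {n : ℕ} (P : Fin n → MvPolynomial (Fin n) ℂ) :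
    Continuous fun v => (Jac P v).det := by
  apply Continuous.matrix_det
  exact continuous_matrix fun i j => eval_continuous _

/-- inverse function theorem for polynomial systems -/
theorem sys_ift {n : ℕ} (P : Fin n → MvPolynomial (Fin n) ℂ) (v₀ : Fin n → ℂ) (h : (Jac P v₀).det ≠ 0) :
    ∃ (e : OpenPartialHomeomorph (Fin n → ℂ) (Fin n → ℂ)), v₀ ∈ e.source ∧ (∀ v, e v = sysMap P v) ∧
      (∀ v ∈ e.source, (Jac P v).det ≠ 0) ∧
      ∀ z ∈ e.target, ∃ S : (Fin n → ℂ) →L[ℂ] (Fin n → ℂ), HasFDerivAt e.symm S z ∧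
        (∀ x, sysD P (e.symm z) (S x) = x) ∧ (∀ x, S (sysD P (e.symm z) x) = x) := by
  classical
  have key : ∀ v, (Jac P v).det ≠ 0 → ∃ A : (Fin n → ℂ) ≃L[ℂ] (Fin n → ℂ), (A : (Fin n → ℂ) →L[ℂ] (Fin n → ℂ)) = sysD P v := by
    intro v hv
    have hinj : Function.Injective (sysD P v).toLinearMap := by
      rw [injective_iff_map_eq_zero]
      intro x hx
      have : (Jac P v).mulVec x = 0 := by rw [← sysD_eq]; exact hx
      exact Matrix.eq_zero_of_mulVec_eq_zero hv this
    refine ⟨(LinearEquiv.ofInjectiveEndo _ hinj).toContinuousLinearEquiv, ?_⟩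
    ext x; 
    simp only [LinearEquiv.ofInjectiveEndo]
    rfl
  obtain ⟨A, hA⟩ := key v₀ h
  have hst : HasStrictFDerivAt (sysMap P) (A : (Fin n → ℂ) →L[ℂ] (Fin n → ℂ)) v₀ := by
    rw [hA]; exact sysMap_hasStrict P v₀
  have hop : IsOpen {v | (Jac P v).det ≠ 0} := isOpen_ne_fun (det_Jac_continuous P) continuous_const
  refine ⟨(hst.toOpenPartialHomeomorph (sysMap P)).restrOpen _ hop, ?_, ?_, ?_, ?_⟩
  · exact ⟨hst.mem_toOpenPartialHomeomorph_source, h⟩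
  · intro v; rfl
  · intro v hv; exact hv.2
  · intro z hz
    set e := (hst.toOpenPartialHomeomorph (sysMap P)).restrOpen _ hop
    have hs : e.symm z ∈ e.source := e.map_target hz
    obtain ⟨B, hB⟩ := key _ hs.2
    refine ⟨(B.symm : (Fin n → ℂ) →L[ℂ] (Fin n → ℂ)), ?_, ?_, ?_⟩
    · apply e.hasFDerivAt_symm hz
      rw [hB]; exact (sysMap_hasStrict P _).hasFDerivAt
    · intro x; rw [← hB]; simp
    · intro x; rw [← hB]; simp

/-- linear form with given coefficients -/
noncomputable def linP {n : ℕ} (l : Fin n → ℂ) : MvPolynomial (Fin n) ℂ := ∑ i, MvPolynomial.C (l i) * X i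

theorem eval_linP {n : ℕ} (l v : Fin n → ℂ) : eval v (linP l) = ∑ i, l i * v i := by
  simp [linP]

theorem pderiv_linP {n : ℕ} (l : Fin n → ℂ) (j : Fin n) : pderiv j (linP l) = MvPolynomial.C (l j) := by
  simp only [linP, map_sum, pderiv_C_mul, pderiv_X]
  rw [Finset.sum_eq_single j]
  · simp
  · intro i _ hi
    simp [Pi.single_apply, hi.symm]
  · simp

theorem linP_hom {n : ℕ} (l : Fin n → ℂ) : (linP l).IsHomogeneous 1 := by
  apply IsHomogeneous.sum
  intro i _
  simpa using (isHomogeneous_C _ (l i)).mul (isHomogeneous_X ℂ i)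

theorem gradL_linP {n : ℕ} (l v x : Fin n → ℂ) : gradL (linP l) v x = ∑ i, l i * x i := by
  simp [gradL_apply, pderiv_linP]

theorem chart_exists (q₁ q₂ g ξ : MvPolynomial (Fin 6) ℂ) (v₀ : Fin 6 → ℂ)
    (hind : ∀ a b c : ℂ,
      (∀ i, a * eval v₀ (pderiv i q₁) + b * eval v₀ (pderiv i q₂)
        + c * eval v₀ (pderiv i g) = 0) → a = 0 ∧ b = 0 ∧ c = 0)
    (k₁ : gradL q₁ v₀ v₀ = 0) (k₂ : gradL q₂ v₀ v₀ = 0) (k₃ : gradL g v₀ v₀ = 0)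
    (k₄ : gradL ξ v₀ v₀ ≠ 0) :
    ∃ l₁ l₂ : Fin 6 → ℂ, (Jac ![q₁, q₂, g, ξ, linP l₁, linP l₂] v₀).det ≠ 0 := by
  let r : Fin 4 → (Fin 6 → ℂ) := ![fun i => eval v₀ (pderiv i q₁), fun i => eval v₀ (pderiv i q₂),
    fun i => eval v₀ (pderiv i g), fun i => eval v₀ (pderiv i ξ)]
  have hr : LinearIndependent ℂ r := by
    rw [Fintype.linearIndependent_iff]
    intro c hc
    have h1 : ∀ i, c 0 * eval v₀ (pderiv i q₁) + c 1 * eval v₀ (pderiv i q₂)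
        + c 2 * eval v₀ (pderiv i g) + c 3 * eval v₀ (pderiv i ξ) = 0 := by
      intro i
      have := congrFun hc i
      simpa [Fin.sum_univ_four, r] using this
    have h3 : c 3 = 0 := by
      have h2 : c 0 * gradL q₁ v₀ v₀ + c 1 * gradL q₂ v₀ v₀ + c 2 * gradL g v₀ v₀ + c 3 * gradL ξ v₀ v₀ = 0 := by
        simp only [gradL_apply, Finset.mul_sum, ← Finset.sum_add_distrib]
        apply Finset.sum_eq_zero
        intro i _
        linear_combination v₀ i * h1 i
      rw [k₁, k₂, k₃] at h2
      simpa [k₄] using h2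
    have := hind (c 0) (c 1) (c 2) (by intro i; have := h1 i; rw [h3] at this; simpa using this)
    intro i
    fin_cases i
    exacts [this.1, this.2.1, this.2.2, h3]
  obtain ⟨x, hx⟩ := exists_linearIndependent_snoc_of_lt_finrank hr (by simp)
  obtain ⟨y, hy⟩ := exists_linearIndependent_snoc_of_lt_finrank hx (by simp)
  refine ⟨x, y, ?_⟩
  have : (Jac ![q₁, q₂, g, ξ, linP x, linP y] v₀).row = Fin.snoc (α := fun _ => Fin 6 → ℂ) (Fin.snoc (α := fun _ => Fin 6 → ℂ) r x) y := by
    ext i j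
    fin_cases i
    · rfl
    · rfl
    · rfl
    · rfl
    · simp [Jac, pderiv_linP]; rfl
    · simp [Jac, pderiv_linP]; rfl
  rw [← this, Matrix.linearIndependent_rows_iff_isUnit, Matrix.isUnit_iff_isUnit_det] at hy
  exact hy.ne_zero

theorem real_det_eq (A : (Fin 2 → ℂ) →L[ℂ] (Fin 2 → ℂ)) :
    (A.restrictScalars ℝ).det = ‖LinearMap.det (A : (Fin 2 → ℂ) →ₗ[ℂ] (Fin 2 → ℂ))‖ ^ 2 := by
  have := LinearMap.det_restrictScalars (R := ℝ) (S := ℂ) (f := (A : (Fin 2 → ℂ) →ₗ[ℂ] (Fin 2 → ℂ)))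
  rw [ContinuousLinearMap.det]
  have h2 : ((A.restrictScalars ℝ : (Fin 2 → ℂ) →L[ℝ] (Fin 2 → ℂ)) : (Fin 2 → ℂ) →ₗ[ℝ] (Fin 2 → ℂ)) =
    (A : (Fin 2 → ℂ) →ₗ[ℂ] (Fin 2 → ℂ)).restrictScalars ℝ := rfl
  rw [h2, this, Algebra.norm_complex_apply, Complex.sq_norm]

/-- inclusion of the last two coordinates -/
noncomputable def iotaL : (Fin 2 → ℂ) →L[ℂ] (Fin 6 → ℂ) :=
  ContinuousLinearMap.pi ![0, 0, 0, 0, ContinuousLinearMap.proj 0, ContinuousLinearMap.proj 1]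

theorem iotaL_apply (l : Fin 2 → ℂ) : iotaL l = ![0, 0, 0, 0, l 0, l 1] := by
  ext i; fin_cases i <;> simp [iotaL]

/-- the affine plane of values -/
noncomputable def iotaA (l : Fin 2 → ℂ) : Fin 6 → ℂ := ![0, 0, 0, 1, l 0, l 1]

theorem iotaA_eq : iotaA = fun l => ![0, 0, 0, 1, 0, 0] + iotaL l := by
  ext l i; fin_cases i <;> simp [iotaA, iotaL_apply]

theorem iotaA_hasFDerivAt (l : Fin 2 → ℂ) : HasFDerivAt iotaA iotaL l := by
  rw [iotaA_eq]
  exact (iotaL.hasFDerivAt).const_add _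

theorem iotaA_inj {l l' : Fin 2 → ℂ} (h : iotaA l = iotaA l') : l = l' := by
  ext i
  fin_cases i
  · simpa [iotaA] using congrFun h 4
  · simpa [iotaA] using congrFun h 5

open MeasureTheory Topology Set in
theorem sard_null (q₁ q₂ g f₀ f₁ f₂ : MvPolynomial (Fin 6) ℂ) {d e : ℕ} (he : 0 < e)
    (h₁ : q₁.IsHomogeneous 2) (h₂ : q₂.IsHomogeneous 2) (hg : g.IsHomogeneous d)
    (hX : IsSmoothCI3 q₁ q₂ g) (hf₀ : f₀.IsHomogeneous e)  :
    volume ((fun v => (![eval v f₁, eval v f₂] : Fin 2 → ℂ)) ''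
      {v | eval v q₁ = 0 ∧ eval v q₂ = 0 ∧ eval v g = 0 ∧ eval v f₀ = 1 ∧
        (Jac ![q₁, q₂, g, f₀, f₁, f₂] v).det = 0}) = 0 := by
  set T := {v : Fin 6 → ℂ | eval v q₁ = 0 ∧ eval v q₂ = 0 ∧ eval v g = 0 ∧ eval v f₀ = 1 ∧
        (Jac ![q₁, q₂, g, f₀, f₁, f₂] v).det = 0} with hT
  set ψ : (Fin 6 → ℂ) → (Fin 2 → ℂ) := fun v => ![eval v f₁, eval v f₂] with hψ
  let ψD : (Fin 6 → ℂ) → ((Fin 6 → ℂ) →L[ℂ] (Fin 2 → ℂ)) := fun v => ContinuousLinearMap.pi ![gradL f₁ v, gradL f₂ v]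
  have hψD : ∀ v, HasFDerivAt ψ (ψD v) v := by
    intro v
    rw [hasFDerivAt_pi']
    intro i
    fin_cases i
    · exact (eval_hasStrict f₁ v).hasFDerivAt
    · exact (eval_hasStrict f₂ v).hasFDerivAt
  have hloc : ∀ v₀ ∈ T, ∃ O : Set (Fin 6 → ℂ), IsOpen O ∧ v₀ ∈ O ∧ volume (ψ '' (T ∩ O)) = 0 := by
    intro v₀ hv₀
    obtain ⟨t1, t2, t3, t4, t5⟩ := hv₀
    have hv0 : v₀ ≠ 0 := by
      rintro rfl
      have := eval_hom hf₀ 0 0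
      rw [smul_zero, t4, zero_pow he.ne'] at this
      simp at this
    obtain ⟨l₁, l₂, hdet⟩ := chart_exists q₁ q₂ g f₀ v₀ (hX v₀ hv0 t1 t2 t3)
      (by rw [euler_gradL h₁, t1, mul_zero]) (by rw [euler_gradL h₂, t2, mul_zero])
      (by rw [euler_gradL hg, t3, mul_zero]) (by rw [euler_gradL hf₀, t4]; simpa using he.ne')
    obtain ⟨c, hc1, hc2, hc3, hc4⟩ := sys_ift _ v₀ hdet
    refine ⟨c.source, c.open_source, hc1, ?_⟩
    let S : Set (Fin 2 → ℂ) := {l | iotaA l ∈ c.target ∧ c.symm (iotaA l) ∈ T}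
    have hsub : ψ '' (T ∩ c.source) ⊆ (fun l => ψ (c.symm (iotaA l))) '' S := by
      rintro _ ⟨v, ⟨hvT, hvs⟩, rfl⟩
      have hz : iotaA ![eval v (linP l₁), eval v (linP l₂)] = c v := by
        rw [hc2]
        ext i
        obtain ⟨t1, t2, t3, t4, t5⟩ := hvT
        fin_cases i <;> simp [iotaA, sysMap, t1, t2, t3, t4]
      refine ⟨![eval v (linP l₁), eval v (linP l₂)], ⟨?_, ?_⟩, ?_⟩
      · rw [hz]; exact c.map_source hvs
      · rw [hz, c.left_inv hvs]; exact hvT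
      · simp only [hz, c.left_inv hvs]
    refine measure_mono_null hsub ?_
    have hder : ∀ l ∈ S, ∃ A : (Fin 2 → ℂ) →L[ℂ] (Fin 2 → ℂ),
        HasFDerivAt (fun l => ψ (c.symm (iotaA l))) A l ∧ LinearMap.det (A : (Fin 2 → ℂ) →ₗ[ℂ] (Fin 2 → ℂ)) = 0 := by
      intro l hl
      obtain ⟨Sg, hS1, hS2, hS3⟩ := hc4 _ hl.1
      refine ⟨(ψD (c.symm (iotaA l))).comp (Sg.comp iotaL), (hψD _).comp l (hS1.comp l (iotaA_hasFDerivAt l)), ?_⟩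
      obtain ⟨t1, t2, t3, t4, t5⟩ := hl.2
      obtain ⟨x, hx0, hx⟩ := Matrix.exists_mulVec_eq_zero_iff.mpr t5
      have hx' : ∀ i, gradL (![q₁, q₂, g, f₀, f₁, f₂] i) (c.symm (iotaA l)) x = 0 := by
        intro i; rw [← Jac_mulVec, hx]; rfl
      set w := c.symm (iotaA l)
      have h6 : iotaL ![gradL (linP l₁) w x, gradL (linP l₂) w x] = sysD ![q₁, q₂, g, f₀, linP l₁, linP l₂] w x := by
        rw [iotaL_apply]
        ext i
        fin_cases i
        · simpa [sysD] using (hx' 0).symm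
        · simpa [sysD] using (hx' 1).symm
        · simpa [sysD] using (hx' 2).symm
        · simpa [sysD] using (hx' 3).symm
        · simp [sysD]
        · simp [sysD]
      by_contra hne
      have hzero := LinearMap.ker_eq_bot.mp ((LinearMap.isUnit_iff_ker_eq_bot _).mp ((LinearMap.isUnit_iff_isUnit_det _).mpr (isUnit_iff_ne_zero.mpr hne)))
      rw [injective_iff_map_eq_zero] at hzero
      have h7 := hzero ![gradL (linP l₁) w x, gradL (linP l₂) w x] (by
        show ψD w (Sg (iotaL _)) = 0
        rw [h6, hS3]
        ext i
        fin_cases i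
        · simpa [ψD] using hx' 4
        · simpa [ψD] using hx' 5)
      rw [h7, map_zero] at h6
      have := hS3 x
      rw [← h6, map_zero] at this
      exact hx0 this.symm
    choose! A hA1 hA2 using hder
    refine addHaar_image_eq_zero_of_det_fderivWithin_eq_zero volume (f' := fun l => (A l).restrictScalars ℝ) ?_ ?_
    · intro l hl
      exact ((hA1 l hl).restrictScalars ℝ).hasFDerivWithinAt
    · intro l hl
      rw [real_det_eq, hA2 l hl]; simp
  choose! O hO1 hO2 hO3 using hloc
  obtain ⟨t, ht1, ht2, ht3⟩ := TopologicalSpace.countable_cover_nhdsWithin (s := T) (f := O)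
    (fun x hx => mem_nhdsWithin_of_mem_nhds ((hO1 x hx).mem_nhds (hO2 x hx)))
  have hsub : ψ '' T ⊆ ⋃ x ∈ t, ψ '' (T ∩ O x) := by
    rintro _ ⟨v, hv, rfl⟩
    obtain ⟨x, hx, hvx⟩ := mem_iUnion₂.mp (ht3 hv)
    exact mem_iUnion₂.mpr ⟨x, hx, v, ⟨hv, hvx⟩, rfl⟩
  refine measure_mono_null hsub ?_
  rw [measure_biUnion_null_iff ht2]
  exact fun x hx => hO3 x (ht1 hx)

open MeasureTheory Topology Set in
theorem crit_poly (q₁ q₂ g f₀ f₁ f₂ : MvPolynomial (Fin 6) ℂ) {d e : ℕ} (he : 0 < e)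
    (h₁ : q₁.IsHomogeneous 2) (h₂ : q₂.IsHomogeneous 2) (hg : g.IsHomogeneous d)
    (hX : IsSmoothCI3 q₁ q₂ g) (hf₀ : f₀.IsHomogeneous e)  :
    ∃ D : MvPolynomial (Fin 2) ℂ, D ≠ 0 ∧ ∀ v, eval v q₁ = 0 → eval v q₂ = 0 → eval v g = 0 → eval v f₀ = 1 →
        (Jac ![q₁, q₂, g, f₀, f₁, f₂] v).det = 0 → eval ![eval v f₁, eval v f₂] D = 0 := by
  set Φ := ![q₁, q₂, g, f₀, f₁, f₂] with hΦ
  let Jp : MvPolynomial (Fin 6) ℂ := (Matrix.of fun i j => pderiv j (Φ i) : Matrix (Fin 6) (Fin 6) (MvPolynomial (Fin 6) ℂ)).det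
  have hJp : ∀ v, eval v Jp = (Jac Φ v).det := by
    intro v
    rw [RingHom.map_det]; rfl
  have hnull := sard_null q₁ q₂ g f₀ f₁ f₂ he h₁ h₂ hg hX hf₀
  have hfun : ∀ v, (fun i => eval v (![f₁, f₂] i)) = ![eval v f₁, eval v f₂] := by
    intro v; ext i; fin_cases i <;> rfl
  rcases elim_image {q₁, q₂, g, f₀ - 1, Jp} ![f₁, f₂] with ⟨D, hD, hDv⟩ | ⟨r, hr, hrv⟩
  · refine ⟨D, hD, fun v t1 t2 t3 t4 t5 => ?_⟩
    have := hDv v (by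
      intro p hp
      simp only [mem_insert_iff, mem_singleton_iff] at hp
      rcases hp with rfl | rfl | rfl | rfl | rfl
      · exact t1
      · exact t2
      · exact t3
      · simp [t4]
      · rw [hJp, t5])
    rwa [hfun] at this
  · exfalso
    have hop : IsOpen {y : Fin 2 → ℂ | eval y r ≠ 0} := isOpen_ne_fun (eval_continuous r) continuous_const
    have hne : {y : Fin 2 → ℂ | eval y r ≠ 0}.Nonempty := by
      by_contra hcon
      rw [not_nonempty_iff_eq_empty] at hcon
      apply hr
      apply MvPolynomial.funext
      intro y
      by_contra h
      have : y ∈ {y : Fin 2 → ℂ | eval y r ≠ 0} := by simpa using h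
      rw [hcon] at this; exact this
    have hpos := hop.measure_pos volume hne
    refine hpos.ne' (measure_mono_null ?_ hnull)
    intro y hy
    obtain ⟨v, hv, hvy⟩ := hrv y hy
    refine ⟨v, ⟨hv _ (by simp), hv _ (by simp), hv _ (by simp), ?_, ?_⟩, ?_⟩
    · have := hv (f₀ - 1) (by simp)
      simpa [sub_eq_zero] using this
    · rw [← hJp]; exact hv _ (by simp)
    · rw [hfun] at hvy; exact hvy

theorem pvanish_iff {ι : Type} [Fintype ι] {f : MvPolynomial (ι) ℂ} {k : ℕ} (hf : f.IsHomogeneous k) (v : ι → ℂ) (hv : v ≠ 0) :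
    PVanish f (Projectivization.mk ℂ v hv) ↔ eval v f = 0 := by
  constructor
  · intro h; exact h v hv rfl
  · intro h w hw hwv
    rw [Projectivization.mk_eq_mk_iff'] at hwv
    obtain ⟨a, rfl⟩ := hwv
    have : eval (a • v) f = a ^ k * eval v f := by
      rw [eval_eq, eval_eq, Finset.mul_sum]
      refine Finset.sum_congr rfl fun m hm => ?_
      have h1 : m.degree = k := by
        have := hf (mem_support_iff.mp hm)
        rwa [Finsupp.degree_eq_weight_one]
      simp only [Pi.smul_apply, smul_eq_mul, mul_pow]
      rw [Finset.prod_mul_distrib, Finset.prod_pow_eq_pow_sum]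
      rw [← h1, Finsupp.degree_eq_sum]
      rw [Finset.sum_subset (Finset.subset_univ m.support)]
      · ring
      · intro x _ hx; simpa using hx
    rw [this, h, mul_zero]

theorem dense_open_poly {n : ℕ} {V : Set (PPt (Fin n))} (hV : ContainsDenseOpenOf Set.univ V) :
    ∃ (h : MvPolynomial (Fin n) ℂ) (k : ℕ), h.IsHomogeneous k ∧ h ≠ 0 ∧
      ∀ (v : Fin n → ℂ) (hv : v ≠ 0), eval v h ≠ 0 → Projectivization.mk ℂ v hv ∈ V := by
  obtain ⟨Y, ⟨fs, hfs, rfl⟩, hY1, hY2⟩ := hV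
  rw [Set.not_subset] at hY1
  obtain ⟨x, _, hx⟩ := hY1
  simp only [Set.mem_ofPred_eq, not_forall] at hx
  obtain ⟨f, hf, hfx⟩ := hx
  obtain ⟨k, hk⟩ := hfs f hf
  refine ⟨f, k, hk, ?_, ?_⟩
  · rintro rfl
    exact hfx fun v hv _ => by simp
  · intro v hv hne
    apply hY2
    refine ⟨trivial, fun h => hne ?_⟩
    exact (pvanish_iff hk v hv).mp (h f hf)

theorem dense_open_of_poly {n k : ℕ} {V : Set (PPt (Fin n))} (h : MvPolynomial (Fin n) ℂ) (hh : h.IsHomogeneous k) (i : Fin n) (h0 : h ≠ 0)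
    (hV : ∀ (v : Fin n → ℂ) (hv : v ≠ 0), eval v h ≠ 0 → Projectivization.mk ℂ v hv ∈ V) :
    ContainsDenseOpenOf Set.univ V := by
  refine ⟨{x | ∀ f ∈ ({h} : Set (MvPolynomial (Fin n) ℂ)), PVanish f x}, ⟨{h}, ?_, rfl⟩, ?_, ?_⟩
  · rintro f rfl; exact ⟨k, hh⟩
  · intro hsub
    apply mul_ne_zero h0 (X_ne_zero (R := ℂ) i)
    apply MvPolynomial.funext
    intro v
    by_cases hv : v = 0
    · subst hv; simp
    · have := hsub (Set.mem_univ (Projectivization.mk ℂ v hv)) h rfl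
      rw [pvanish_iff hh] at this
      simp [this]
  · rintro x ⟨_, hx⟩
    induction x using Projectivization.ind with
    | h v hv =>
      apply hV
      intro h3
      apply hx
      rintro f rfl
      exact (pvanish_iff hh v hv).mpr h3

theorem ne_one_vec (y : Fin 2 → ℂ) : (![1, y 0, y 1] : Fin 3 → ℂ) ≠ 0 := by
  intro h; simpa using congrFun h 0

/-- affine chart of the plane -/
noncomputable def ptY (y : Fin 2 → ℂ) : PPt (Fin 3) := Projectivization.mk ℂ ![1, y 0, y 1] (ne_one_vec y)

theorem eval_aeval' {n m : ℕ} (F : Fin n → MvPolynomial (Fin m) ℂ) (x : Fin m → ℂ) (D : MvPolynomial (Fin n) ℂ) :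
    eval x (aeval F D) = eval (fun i => eval x (F i)) D := by
  induction D using MvPolynomial.induction_on with
  | C a => simp
  | add p q hp hq => simp only [map_add, hp, hq]
  | mul_X p i hp => simp only [map_mul, hp, aeval_X, eval_X]

theorem exists_eval_ne {n : ℕ} {p : MvPolynomial (Fin n) ℂ} (hp : p ≠ 0) : ∃ y, eval y p ≠ 0 := by
  by_contra! h
  exact hp (MvPolynomial.funext fun y => by simpa using h y)

theorem dehom_poly {k : ℕ} (h : MvPolynomial (Fin 3) ℂ) (hh : h.IsHomogeneous k) (h0 : h ≠ 0) :
    ∃ D : MvPolynomial (Fin 2) ℂ, D ≠ 0 ∧ ∀ y, eval y D = eval ![1, y 0, y 1] h := by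
  have key : ∀ y, eval y (aeval ![1, X 0, X 1] h : MvPolynomial (Fin 2) ℂ) = eval ![1, y 0, y 1] h := by
    intro y
    rw [eval_aeval']
    congr 2
    ext i
    fin_cases i <;> simp
  refine ⟨aeval ![1, X 0, X 1] h, ?_, key⟩
  obtain ⟨v, hv⟩ := exists_eval_ne (mul_ne_zero h0 (X_ne_zero (R := ℂ) 0))
  rw [map_mul, eval_X] at hv
  have hv1 := left_ne_zero_of_mul hv
  have hv2 := right_ne_zero_of_mul hv
  intro hcon
  have h3 := key ![v 1 / v 0, v 2 / v 0]
  rw [hcon, map_zero] at h3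
  have h4 : v = v 0 • ![1, (![v 1 / v 0, v 2 / v 0] : Fin 2 → ℂ) 0, (![v 1 / v 0, v 2 / v 0] : Fin 2 → ℂ) 1] := by
    ext i
    fin_cases i <;> simp <;> field_simp
  rw [h4, eval_hom hh, ← h3, mul_zero] at hv1
  exact hv1 rfl

/-- the polynomial system of the affine fibres -/
noncomputable def sysPhi (q₁ q₂ g : MvPolynomial (Fin 6) ℂ) (φ : RatMapTo (Fin 6) 2) : Fin 6 → MvPolynomial (Fin 6) ℂ :=
  ![q₁, q₂, g, φ.F 0, φ.F 1, φ.F 2]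

/-- the affine fibre -/
def Fhat (q₁ q₂ g : MvPolynomial (Fin 6) ℂ) (φ : RatMapTo (Fin 6) 2) (y : Fin 2 → ℂ) : Set (Fin 6 → ℂ) :=
  {w | sysMap (sysPhi q₁ q₂ g φ) w = iotaA y}

theorem mem_Fhat {q₁ q₂ g : MvPolynomial (Fin 6) ℂ} {φ : RatMapTo (Fin 6) 2} {y : Fin 2 → ℂ} {w : Fin 6 → ℂ} :
    w ∈ Fhat q₁ q₂ g φ y ↔ eval w q₁ = 0 ∧ eval w q₂ = 0 ∧ eval w g = 0 ∧ eval w (φ.F 0) = 1 ∧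
      eval w (φ.F 1) = y 0 ∧ eval w (φ.F 2) = y 1 := by
  constructor
  · intro h
    exact ⟨congrFun h 0, congrFun h 1, congrFun h 2, congrFun h 3, congrFun h 4, congrFun h 5⟩
  · rintro ⟨a1, a2, a3, a4, a5, a6⟩
    show sysMap _ _ = _
    ext i
    fin_cases i
    exacts [a1, a2, a3, a4, a5, a6]

theorem evalVec_smul (φ : RatMapTo (Fin 6) 2) (c : ℂ) (v : Fin 6 → ℂ) :
    φ.evalVec (c • v) = c ^ φ.e • φ.evalVec v := by
  ext j
  exact eval_hom (φ.homog j) c v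

theorem mem_fiber_iff {q₁ q₂ g : MvPolynomial (Fin 6) ℂ} {d : ℕ}
    (h₁ : q₁.IsHomogeneous 2) (h₂ : q₂.IsHomogeneous 2) (hg : g.IsHomogeneous d)
    (φ : RatMapTo (Fin 6) 2) (v : Fin 6 → ℂ) (hv : v ≠ 0) (z : Fin 3 → ℂ) (hz : z ≠ 0) :
    Projectivization.mk ℂ v hv ∈ φ.fiber (ZeroSet q₁ ∩ ZeroSet q₂ ∩ ZeroSet g) (Projectivization.mk ℂ z hz) ↔
      eval v q₁ = 0 ∧ eval v q₂ = 0 ∧ eval v g = 0 ∧ ∃ c : ℂ, c ≠ 0 ∧ φ.evalVec v = c • z := by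
  have e1 : Projectivization.mk ℂ v hv ∈ ZeroSet q₁ ↔ eval v q₁ = 0 := pvanish_iff h₁ v hv
  have e2 : Projectivization.mk ℂ v hv ∈ ZeroSet q₂ ↔ eval v q₂ = 0 := pvanish_iff h₂ v hv
  have e3 : Projectivization.mk ℂ v hv ∈ ZeroSet g ↔ eval v g = 0 := pvanish_iff hg v hv
  have e4 : φ.mapsTo (Projectivization.mk ℂ v hv) (Projectivization.mk ℂ z hz) ↔ ∃ c : ℂ, c ≠ 0 ∧ φ.evalVec v = c • z := by
    constructor
    · intro h
      obtain ⟨hw, h3⟩ := h v hv rfl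
      rw [Projectivization.mk_eq_mk_iff'] at h3
      obtain ⟨a, ha⟩ := h3
      refine ⟨a, ?_, ha.symm⟩
      rintro rfl
      rw [zero_smul] at ha
      exact hw ha.symm
    · rintro ⟨c, hc, hcz⟩ w hw hwv
      rw [Projectivization.mk_eq_mk_iff'] at hwv
      obtain ⟨a, rfl⟩ := hwv
      have ha : a ≠ 0 := by rintro rfl; simp at hw
      have hne : φ.evalVec (a • v) ≠ 0 := by
        rw [evalVec_smul, hcz]
        exact smul_ne_zero (pow_ne_zero _ ha) (smul_ne_zero hc hz)
      refine ⟨hne, ?_⟩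
      rw [Projectivization.mk_eq_mk_iff']
      exact ⟨a ^ φ.e * c, by rw [evalVec_smul, hcz, smul_smul]⟩
  show (_ ∧ _) ↔ _
  rw [e4]
  show ((_ ∧ _) ∧ _) ∧ _ ↔ _
  rw [← e1, ← e2, ← e3]
  tauto

theorem Fhat_ne_zero {q₁ q₂ g : MvPolynomial (Fin 6) ℂ} {φ : RatMapTo (Fin 6) 2} (he : 0 < φ.e) {y : Fin 2 → ℂ} {w : Fin 6 → ℂ}
    (hw : w ∈ Fhat q₁ q₂ g φ y) : w ≠ 0 := by
  rintro rfl
  have := eval_hom (φ.homog 0) 0 0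
  rw [smul_zero, (mem_Fhat.mp hw).2.2.2.1, zero_pow he.ne'] at this
  simp at this

theorem Fhat_mem_fiber {q₁ q₂ g : MvPolynomial (Fin 6) ℂ} {d : ℕ}
    (h₁ : q₁.IsHomogeneous 2) (h₂ : q₂.IsHomogeneous 2) (hg : g.IsHomogeneous d)
    {φ : RatMapTo (Fin 6) 2} {y : Fin 2 → ℂ} {w : Fin 6 → ℂ}
    (hw : w ∈ Fhat q₁ q₂ g φ y) (hw0 : w ≠ 0) :
    Projectivization.mk ℂ w hw0 ∈ φ.fiber (ZeroSet q₁ ∩ ZeroSet q₂ ∩ ZeroSet g) (ptY y) := by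
  obtain ⟨a1, a2, a3, a4, a5, a6⟩ := mem_Fhat.mp hw
  rw [ptY, mem_fiber_iff h₁ h₂ hg]
  refine ⟨a1, a2, a3, 1, one_ne_zero, ?_⟩
  ext i
  fin_cases i
  · simpa [RatMapTo.evalVec] using a4
  · simpa [RatMapTo.evalVec] using a5
  · simpa [RatMapTo.evalVec] using a6

theorem Fhat_rep {q₁ q₂ g : MvPolynomial (Fin 6) ℂ} {d : ℕ}
    (h₁ : q₁.IsHomogeneous 2) (h₂ : q₂.IsHomogeneous 2) (hg : g.IsHomogeneous d)
    {φ : RatMapTo (Fin 6) 2} (he : 0 < φ.e) {y : Fin 2 → ℂ} (x : PPt (Fin 6))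
    (hx : x ∈ φ.fiber (ZeroSet q₁ ∩ ZeroSet q₂ ∩ ZeroSet g) (ptY y)) :
    ∃ (w : Fin 6 → ℂ) (hw : w ≠ 0), w ∈ Fhat q₁ q₂ g φ y ∧ Projectivization.mk ℂ w hw = x := by
  induction x using Projectivization.ind with
  | h v hv =>
  rw [ptY, mem_fiber_iff h₁ h₂ hg] at hx
  obtain ⟨a1, a2, a3, c, hc, hcv⟩ := hx
  obtain ⟨t, ht⟩ := IsAlgClosed.exists_pow_nat_eq (c⁻¹) he
  have ht0 : t ≠ 0 := by
    rintro rfl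
    rw [zero_pow he.ne'] at ht
    exact inv_ne_zero hc ht.symm
  have hev : φ.evalVec (t • v) = ![1, y 0, y 1] := by
    rw [evalVec_smul, hcv, smul_smul, ht, inv_mul_cancel₀ hc, one_smul]
  refine ⟨t • v, smul_ne_zero ht0 hv, mem_Fhat.mpr ⟨?_, ?_, ?_, ?_, ?_, ?_⟩, ?_⟩
  · rw [eval_hom h₁, a1, mul_zero]
  · rw [eval_hom h₂, a2, mul_zero]
  · rw [eval_hom hg, a3, mul_zero]
  · exact congrFun hev 0
  · exact congrFun hev 1
  · exact congrFun hev 2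
  · rw [Projectivization.mk_eq_mk_iff']; exact ⟨t, rfl⟩

theorem Fhat_smul {q₁ q₂ g : MvPolynomial (Fin 6) ℂ} {d : ℕ}
    (h₁ : q₁.IsHomogeneous 2) (h₂ : q₂.IsHomogeneous 2) (hg : g.IsHomogeneous d)
    {φ : RatMapTo (Fin 6) 2} {y : Fin 2 → ℂ} {w : Fin 6 → ℂ} {ζ : ℂ} (hζ : ζ ^ φ.e = 1)
    (hw : w ∈ Fhat q₁ q₂ g φ y) : ζ • w ∈ Fhat q₁ q₂ g φ y := by
  rw [mem_Fhat] at hw ⊢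
  obtain ⟨a1, a2, a3, a4, a5, a6⟩ := hw
  refine ⟨?_, ?_, ?_, ?_, ?_, ?_⟩
  · rw [eval_hom h₁, a1, mul_zero]
  · rw [eval_hom h₂, a2, mul_zero]
  · rw [eval_hom hg, a3, mul_zero]
  · rw [eval_hom (φ.homog 0), a4, hζ, one_mul]
  · rw [eval_hom (φ.homog 1), a5, hζ, one_mul]
  · rw [eval_hom (φ.homog 2), a6, hζ, one_mul]

theorem Fhat_same {q₁ q₂ g : MvPolynomial (Fin 6) ℂ}
    {φ : RatMapTo (Fin 6) 2} {y y' : Fin 2 → ℂ} {w : Fin 6 → ℂ} {t : ℂ}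
    (hw : w ∈ Fhat q₁ q₂ g φ y) (hw' : t • w ∈ Fhat q₁ q₂ g φ y') : t ^ φ.e = 1 ∧ y = y' := by
  rw [mem_Fhat] at hw hw'
  obtain ⟨a1, a2, a3, a4, a5, a6⟩ := hw
  obtain ⟨b1, b2, b3, b4, b5, b6⟩ := hw'
  rw [eval_hom (φ.homog _)] at b4 b5 b6
  rw [a4, mul_one] at b4
  refine ⟨b4, ?_⟩
  rw [b4, one_mul] at b5 b6
  ext i
  fin_cases i
  · exact a5.symm.trans b5
  · exact a6.symm.trans b6

theorem Fhat_card {q₁ q₂ g : MvPolynomial (Fin 6) ℂ} {d δ : ℕ}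
    (h₁ : q₁.IsHomogeneous 2) (h₂ : q₂.IsHomogeneous 2) (hg : g.IsHomogeneous d)
    (φ : RatMapTo (Fin 6) 2) (he : 0 < φ.e) (y : Fin 2 → ℂ)
    (hfin : (φ.fiber (ZeroSet q₁ ∩ ZeroSet q₂ ∩ ZeroSet g) (ptY y)).Finite)
    (hcard : (φ.fiber (ZeroSet q₁ ∩ ZeroSet q₂ ∩ ZeroSet g) (ptY y)).ncard = δ) :
    (Fhat q₁ q₂ g φ y).Finite ∧ (Fhat q₁ q₂ g φ y).ncard = δ * φ.e := by
  set Fb := φ.fiber (ZeroSet q₁ ∩ ZeroSet q₂ ∩ ZeroSet g) (ptY y)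
  have : NeZero φ.e := ⟨he.ne'⟩
  have hrep := fun x : Fb => Fhat_rep h₁ h₂ hg he x.1 x.2
  choose r hr0 hrF hrx using hrep
  have hroot : ∀ ζ : rootsOfUnity φ.e ℂ, ((ζ : ℂˣ) : ℂ) ^ φ.e = 1 := by
    intro ζ
    have := ζ.2
    rw [mem_rootsOfUnity'] at this
    exact this
  let F : Fb × rootsOfUnity φ.e ℂ → Fhat q₁ q₂ g φ y := fun p =>
    ⟨((p.2 : ℂˣ) : ℂ) • r p.1, Fhat_smul h₁ h₂ hg (hroot p.2) (hrF p.1)⟩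
  have hF : Function.Bijective F := by
    constructor
    · rintro ⟨x, ζ⟩ ⟨x', ζ'⟩ h
      have h' : ((ζ : ℂˣ) : ℂ) • r x = ((ζ' : ℂˣ) : ℂ) • r x' := congrArg Subtype.val h
      have hx : x = x' := by
        apply Subtype.ext
        rw [← hrx x, ← hrx x', Projectivization.mk_eq_mk_iff']
        refine ⟨((ζ : ℂˣ) : ℂ)⁻¹ * ((ζ' : ℂˣ) : ℂ), ?_⟩
        rw [mul_smul, ← h', smul_smul, inv_mul_cancel₀ (Units.ne_zero _), one_smul]
      subst hx
      have := smul_left_injective ℂ (hr0 x) h'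
      rw [Prod.mk.injEq]
      exact ⟨rfl, Subtype.ext (Units.ext this)⟩
    · rintro ⟨w, hw⟩
      have hw0 := Fhat_ne_zero he hw
      let x : Fb := ⟨_, Fhat_mem_fiber h₁ h₂ hg hw hw0⟩
      have := hrx x
      rw [show x.1 = Projectivization.mk ℂ w hw0 from rfl] at this
      rw [eq_comm, Projectivization.mk_eq_mk_iff'] at this
      obtain ⟨t, ht⟩ := this
      have ht1 : t ^ φ.e = 1 := (Fhat_same (hrF x) (by rw [ht]; exact hw)).1
      have ht0 : t ≠ 0 := by rintro rfl; rw [zero_smul] at ht; exact hw0 ht.symm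
      refine ⟨⟨x, ⟨Units.mk0 t ht0, ?_⟩⟩, ?_⟩
      · rw [mem_rootsOfUnity']; simpa using ht1
      · apply Subtype.ext
        simpa [F] using ht
  have : Finite Fb := hfin
  constructor
  · exact Finite.of_surjective F hF.2
  · rw [← Nat.card_coe_set_eq, ← Nat.card_congr (Equiv.ofBijective F hF), Nat.card_prod, Nat.card_coe_set_eq, hcard,
      Complex.card_rootsOfUnity]

theorem affine_pkg {q₁ q₂ g : MvPolynomial (Fin 6) ℂ} {d δ : ℕ}
    (h₁ : q₁.IsHomogeneous 2) (h₂ : q₂.IsHomogeneous 2) (hg : g.IsHomogeneous d)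
    (hX : IsSmoothCI3 q₁ q₂ g) (φ : RatMapTo (Fin 6) 2)
    (hφ : φ.DominantOfDegree (ZeroSet q₁ ∩ ZeroSet q₂ ∩ ZeroSet g) δ)
    (V₀ : Set (PPt (Fin 3))) (hV₀ : ContainsDenseOpenOf Set.univ V₀) :
    0 < φ.e ∧ ∃ D : MvPolynomial (Fin 2) ℂ, D ≠ 0 ∧ ∀ y, eval y D ≠ 0 →
      ptY y ∈ V₀ ∧ (φ.fiber (ZeroSet q₁ ∩ ZeroSet q₂ ∩ ZeroSet g) (ptY y)).Finite ∧
      (φ.fiber (ZeroSet q₁ ∩ ZeroSet q₂ ∩ ZeroSet g) (ptY y)).ncard = δ ∧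
      (Fhat q₁ q₂ g φ y).Finite ∧ (Fhat q₁ q₂ g φ y).ncard = δ * φ.e ∧
      ∀ w ∈ Fhat q₁ q₂ g φ y, (Jac (sysPhi q₁ q₂ g φ) w).det ≠ 0 := by
  obtain ⟨hδ, V, hV, hVf⟩ := hφ
  obtain ⟨p, k, hp, hp0, hpV⟩ := dense_open_poly hV
  obtain ⟨p', k', hp', hp0', hpV'⟩ := dense_open_poly hV₀
  obtain ⟨D₁, hD₁, hD₁e⟩ := dehom_poly p hp hp0
  obtain ⟨D₂, hD₂, hD₂e⟩ := dehom_poly p' hp' hp0'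
  have hgood : ∀ y, eval y D₁ ≠ 0 → ptY y ∈ V := by
    intro y hy
    exact hpV _ _ (by rw [← hD₁e]; exact hy)
  have he : 0 < φ.e := by
    by_contra hcon
    have he0 : φ.e = 0 := by omega
    have hconst : ∀ v, φ.evalVec v = φ.evalVec 0 := by
      intro v
      have := evalVec_smul φ 0 v
      rw [he0, pow_zero, one_smul, zero_smul] at this
      exact this.symm
    have hall : ∀ y, eval y D₁ ≠ 0 → φ.evalVec 0 1 = y 0 * φ.evalVec 0 0 ∧ φ.evalVec 0 0 ≠ 0 := by
      intro y hy
      obtain ⟨hf, hc⟩ := hVf _ (hgood y hy)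
      have : (φ.fiber (ZeroSet q₁ ∩ ZeroSet q₂ ∩ ZeroSet g) (ptY y)).Nonempty := by
        rw [← Set.ncard_pos hf, hc]; exact hδ
      obtain ⟨x, hx⟩ := this
      induction x using Projectivization.ind with
      | h v hv =>
      rw [ptY, mem_fiber_iff h₁ h₂ hg] at hx
      obtain ⟨a1, a2, a3, c, hc, hcv⟩ := hx
      rw [hconst] at hcv
      rw [hcv]
      simp [hc, mul_comm]
    obtain ⟨y, hy⟩ := exists_eval_ne hD₁
    have hy' := (hall y hy).2
    have hne : (X 0 - MvPolynomial.C (φ.evalVec 0 1 / φ.evalVec 0 0) : MvPolynomial (Fin 2) ℂ) ≠ 0 := by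
      intro h
      have := congrArg (eval ![φ.evalVec 0 1 / φ.evalVec 0 0 + 1, 0]) h
      simp at this
    obtain ⟨z, hz⟩ := exists_eval_ne (mul_ne_zero hD₁ hne)
    rw [map_mul] at hz
    have h1 := (hall z (left_ne_zero_of_mul hz)).1
    have h2 := right_ne_zero_of_mul hz
    apply h2
    rw [h1]
    simp [hy']
  refine ⟨he, ?_⟩
  obtain ⟨D₃, hD₃, hD₃e⟩ := crit_poly q₁ q₂ g (φ.F 0) (φ.F 1) (φ.F 2) he h₁ h₂ hg hX (φ.homog 0)
  refine ⟨D₁ * D₂ * D₃, mul_ne_zero (mul_ne_zero hD₁ hD₂) hD₃, fun y hy => ?_⟩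
  rw [map_mul, map_mul] at hy
  have y3 := right_ne_zero_of_mul hy
  have y2 := right_ne_zero_of_mul (left_ne_zero_of_mul hy)
  have y1 := left_ne_zero_of_mul (left_ne_zero_of_mul hy)
  obtain ⟨hf, hc⟩ := hVf _ (hgood y y1)
  obtain ⟨c1, c2⟩ := Fhat_card h₁ h₂ hg φ he y hf hc
  refine ⟨hpV' _ _ (by rw [← hD₂e]; exact y2), hf, hc, c1, c2, ?_⟩
  intro w hw hdet
  rw [mem_Fhat] at hw
  obtain ⟨a1, a2, a3, a4, a5, a6⟩ := hw
  apply y3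
  have := hD₃e w a1 a2 a3 a4 hdet
  rw [a5, a6] at this
  rw [← this]
  congr 2
  ext i
  fin_cases i <;> rfl

open Topology Filter Set in
theorem local_sections {q₁ q₂ g : MvPolynomial (Fin 6) ℂ} {φ : RatMapTo (Fin 6) 2} {N : ℕ}
    {U : Set (Fin 2 → ℂ)} (hU : IsOpen U)
    (hF : ∀ y ∈ U, (Fhat q₁ q₂ g φ y).Finite ∧ (Fhat q₁ q₂ g φ y).ncard = N ∧
      ∀ w ∈ Fhat q₁ q₂ g φ y, (Jac (sysPhi q₁ q₂ g φ) w).det ≠ 0) (y₀ : Fin 2 → ℂ) (hy₀ : y₀ ∈ U) :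
    ∃ (B : Set (Fin 2 → ℂ)) (s : Fin N → (Fin 2 → ℂ) → (Fin 6 → ℂ)), IsOpen B ∧ y₀ ∈ B ∧ B ⊆ U ∧
      ∀ y ∈ B, Fhat q₁ q₂ g φ y = range (fun i => s i y) ∧ Function.Injective (fun i => s i y) ∧
        ∀ i, DifferentiableAt ℂ (s i) y := by
  classical
  obtain ⟨hfin, hcard, hJ⟩ := hF y₀ hy₀
  have : Finite (Fhat q₁ q₂ g φ y₀) := hfin
  have heq : Nonempty (Fin N ≃ Fhat q₁ q₂ g φ y₀) := by
    refine ⟨(Finite.equivFinOfCardEq ?_).symm⟩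
    rw [Nat.card_coe_set_eq, hcard]
  obtain ⟨w⟩ := heq
  have hc := fun i => sys_ift (sysPhi q₁ q₂ g φ) (w i).1 (hJ _ (w i).2)
  choose c hc1 hc2 hc3 hc4 using hc
  let s : Fin N → (Fin 2 → ℂ) → (Fin 6 → ℂ) := fun i y => (c i).symm (iotaA y)
  have hcont : Continuous iotaA := by
    rw [iotaA_eq]; exact continuous_const.add iotaL.continuous
  have hw : ∀ i, iotaA y₀ = c i (w i).1 := by
    intro i; rw [hc2]; exact (w i).2.symm
  have hs0 : ∀ i, s i y₀ = (w i).1 := by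
    intro i
    show (c i).symm (iotaA y₀) = _
    rw [hw, (c i).left_inv (hc1 i)]
  have htar : ∀ i, ∀ᶠ y in 𝓝 y₀, iotaA y ∈ (c i).target := by
    intro i
    apply hcont.continuousAt.eventually_mem
    apply (c i).open_target.mem_nhds
    rw [hw]; exact (c i).map_source (hc1 i)
  have hdiff : ∀ i y, iotaA y ∈ (c i).target → DifferentiableAt ℂ (s i) y := by
    intro i y hy
    obtain ⟨S, hS, _⟩ := hc4 i _ hy
    exact (hS.comp y (iotaA_hasFDerivAt y)).differentiableAt
  have hne : ∀ i j, i ≠ j → ∀ᶠ y in 𝓝 y₀, s i y ≠ s j y := by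
    intro i j hij
    have hci := (hdiff i y₀ (htar i).self_of_nhds).continuousAt
    have hcj := (hdiff j y₀ (htar j).self_of_nhds).continuousAt
    have hopen : IsOpen {p : (Fin 6 → ℂ) × (Fin 6 → ℂ) | p.1 ≠ p.2} := isOpen_ne_fun continuous_fst continuous_snd
    refine (hci.prodMk hcj).eventually_mem (hopen.mem_nhds ?_)
    show s i y₀ ≠ s j y₀
    rw [hs0, hs0]
    exact fun h => hij (w.injective (Subtype.ext h))
  have hall : ∀ᶠ y in 𝓝 y₀, y ∈ U ∧ (∀ i, iotaA y ∈ (c i).target) ∧ ∀ i j, i ≠ j → s i y ≠ s j y := by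
    refine (hU.eventually_mem hy₀).and ((eventually_all.mpr htar).and ?_)
    rw [eventually_all]; intro i
    rw [eventually_all]; intro j
    by_cases hij : i = j
    · exact Eventually.of_forall fun y h => absurd hij h
    · exact (hne i j hij).mono fun y hy _ => hy
  obtain ⟨B, hB, hBo, hyB⟩ := eventually_nhds_iff.mp hall
  refine ⟨B, s, hBo, hyB, fun y hy => (hB y hy).1, fun y hy => ?_⟩
  obtain ⟨hyU, hyt, hyn⟩ := hB y hy
  have hinj : Function.Injective (fun i => s i y) := by
    intro i j hij
    by_contra h
    exact hyn i j h hij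
  refine ⟨?_, hinj, fun i => hdiff i y (hyt i)⟩
  symm
  obtain ⟨f1, f2, _⟩ := hF y hyU
  apply Set.eq_of_subset_of_ncard_le _ _ f1
  · rintro _ ⟨i, rfl⟩
    show sysMap _ _ = _
    rw [← hc2 i]
    exact (c i).right_inv (hyt i)
  · rw [f2, ← Set.image_univ, Set.ncard_image_of_injective _ hinj, Set.ncard_univ, Nat.card_fin]

open MeasureTheory Topology Filter Set in
theorem l2_abstract {N κ : ℕ} {U : Set (Fin 2 → ℂ)} (Fh : (Fin 2 → ℂ) → Set (Fin 6 → ℂ))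
    (f : (Fin 6 → ℂ) → ℂ)
    (hsec : ∀ y₀ ∈ U, ∃ (B : Set (Fin 2 → ℂ)) (s : Fin N → (Fin 2 → ℂ) → (Fin 6 → ℂ)), IsOpen B ∧ y₀ ∈ B ∧ B ⊆ U ∧
      ∀ y ∈ B, Fh y = range (fun i => s i y) ∧ Function.Injective (fun i => s i y) ∧
        ∀ i, DifferentiableAt ℂ (s i) y)
    (O : Fin κ → Set (Fin 6 → ℂ)) (hO : ∀ j, IsOpen (O j)) (ρ : Fin κ → (Fin 6 → ℂ) → (Fin 2 → ℂ))
    (hρd : ∀ j, ∀ v ∈ O j, DifferentiableAt ℂ (ρ j) v)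
    (K : ℝ) (hρb : ∀ j, ∀ y ∈ U, ∀ v ∈ Fh y, v ∈ O j → ‖ρ j v‖ ≤ K)
    (hρi : ∀ j y y' v v', v ∈ Fh y → v' ∈ Fh y' → v ∈ O j → v' ∈ O j → ρ j v = ρ j v' → y = y')
    (hcov : ∀ y ∈ U, ∀ v ∈ Fh y, ∃ j, v ∈ O j)
    (C : ℝ)
    (hC : ∀ j y s, y ∈ U → (∀ᶠ y' in 𝓝 y, s y' ∈ Fh y') → DifferentiableAt ℂ s y → s y ∈ O j →
      ‖f (s y)‖ ≤ C * ‖LinearMap.det ((fderiv ℂ (fun y => ρ j (s y)) y : (Fin 2 → ℂ) →L[ℂ] (Fin 2 → ℂ)) : (Fin 2 → ℂ) →ₗ[ℂ] (Fin 2 → ℂ))‖) :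
    ∫⁻ y in U, ENNReal.ofReal (‖∑ᶠ w ∈ Fh y, f w‖ ^ 2) < ⊤ := by
  classical
  rcases U.eq_empty_or_nonempty with rfl | hne
  · simp
  choose! B s hB1 hB2 hB3 hB4 using hsec
  obtain ⟨t, htU, htc, htcov⟩ := TopologicalSpace.countable_cover_nhdsWithin (s := U) (f := B)
    (fun x hx => mem_nhdsWithin_of_mem_nhds ((hB1 x hx).mem_nhds (hB2 x hx)))
  have htne : t.Nonempty := by
    obtain ⟨y, hy⟩ := hne
    obtain ⟨x, hx, _⟩ := mem_iUnion₂.mp (htcov hy)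
    exact ⟨x, hx⟩
  obtain ⟨c, hc⟩ := htc.exists_eq_range htne
  have hcU : ∀ n, c n ∈ U := fun n => htU (by rw [hc]; exact mem_range_self n)
  set A : ℕ → Set (Fin 2 → ℂ) := disjointed fun n => B (c n) with hA
  have hAB : ∀ n, A n ⊆ B (c n) := fun n => disjointed_subset _ n
  have hAm : ∀ n, MeasurableSet (A n) := fun n =>
    MeasurableSet.disjointed (fun n => (hB1 _ (hcU n)).measurableSet) n
  have hAd : Pairwise (Function.onFun Disjoint A) := disjoint_disjointed _
  have hAU : U = ⋃ n, A n := by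
    rw [hA, iUnion_disjointed]
    apply subset_antisymm
    · intro y hy
      obtain ⟨x, hx, hyx⟩ := mem_iUnion₂.mp (htcov hy)
      rw [hc] at hx
      obtain ⟨n, rfl⟩ := hx
      exact mem_iUnion.mpr ⟨n, hyx⟩
    · exact iUnion_subset fun n => hB3 _ (hcU n)
  let h : ℕ → Fin N × Fin κ → (Fin 2 → ℂ) → (Fin 2 → ℂ) := fun n p y => ρ p.2 (s (c n) p.1 y)
  let G : ℕ → Fin N × Fin κ → Set (Fin 2 → ℂ) := fun n p => A n ∩ {y ∈ B (c n) | s (c n) p.1 y ∈ O p.2}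
  have hGm : ∀ n p, MeasurableSet (G n p) := by
    intro n p
    refine (hAm n).inter (IsOpen.measurableSet ?_)
    have hco : ContinuousOn (s (c n) p.1) (B (c n)) := fun y hy =>
      ((hB4 _ (hcU n) y hy).2.2 p.1).continuousAt.continuousWithinAt
    exact hco.isOpen_inter_preimage (hB1 _ (hcU n)) (hO p.2)
  have hhd : ∀ n p, ∀ y ∈ G n p, DifferentiableAt ℂ (h n p) y := by
    intro n p y hy
    exact (hρd p.2 _ hy.2.2).comp y ((hB4 _ (hcU n) y hy.2.1).2.2 p.1)
  have hhR : ∀ n p, ∀ y ∈ G n p, HasFDerivWithinAt (h n p) (fderiv ℝ (h n p) y) (G n p) y := by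
    intro n p y hy
    exact ((hhd n p y hy).restrictScalars ℝ).hasFDerivAt.hasFDerivWithinAt
  have hdet : ∀ n p, ∀ y ∈ G n p, (fderiv ℝ (h n p) y).det = ‖LinearMap.det ((fderiv ℂ (h n p) y : (Fin 2 → ℂ) →L[ℂ] (Fin 2 → ℂ)) : (Fin 2 → ℂ) →ₗ[ℂ] (Fin 2 → ℂ))‖ ^ 2 := by
    intro n p y hy
    rw [(hhd n p y hy).fderiv_restrictScalars ℝ, real_det_eq]
  have hmemF : ∀ n p, ∀ y ∈ B (c n), s (c n) p y ∈ Fh y := by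
    intro n p y hy
    rw [(hB4 _ (hcU n) y hy).1]; exact mem_range_self p
  have hinj : ∀ n p, InjOn (h n p) (G n p) := by
    intro n p y hy y' hy' hyy
    exact hρi p.2 y y' _ _ (hmemF n p.1 y hy.2.1) (hmemF n p.1 y' hy'.2.1) hy.2.2 hy'.2.2 hyy
  have himg : ∀ n p, ∫⁻ y in G n p, ENNReal.ofReal |(fderiv ℝ (h n p) y).det| = volume (h n p '' G n p) :=
    fun n p => lintegral_abs_det_fderiv_eq_addHaar_image volume (hGm n p) (hhR n p) (hinj n p)
  have hsum : ∀ p, ∑' n, volume (h n p '' G n p) ≤ volume (Metric.closedBall (0 : Fin 2 → ℂ) K) := by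
    intro p
    rw [← measure_iUnion]
    · apply measure_mono
      refine iUnion_subset fun n => ?_
      rintro _ ⟨y, hy, rfl⟩
      rw [mem_closedBall_zero_iff]
      exact hρb p.2 y (hB3 _ (hcU n) hy.2.1) _ (hmemF n p.1 y hy.2.1) hy.2.2
    · intro n m hnm
      show Disjoint _ _
      rw [Set.disjoint_left]
      rintro _ ⟨y, hy, rfl⟩ ⟨y', hy', hyy⟩
      have := hρi p.2 y' y _ _ (hmemF m p.1 y' hy'.2.1) (hmemF n p.1 y hy.2.1) hy'.2.2 hy.2.2 hyy
      subst this
      exact Set.disjoint_left.mp (hAd hnm) hy.1 hy'.1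
    · intro n
      exact measurable_image_of_fderivWithin (hGm n p) (hhR n p) (hinj n p)
  have hpt : ∀ n, ∀ y ∈ A n, ENNReal.ofReal (‖∑ᶠ w ∈ Fh y, f w‖ ^ 2) ≤
      ENNReal.ofReal (N * C ^ 2) * ∑ p, (G n p).indicator (fun y => ENNReal.ofReal |(fderiv ℝ (h n p) y).det|) y := by
    intro n y hy
    have hyB := hAB n hy
    obtain ⟨b1, b2, b3⟩ := hB4 _ (hcU n) y hyB
    rw [b1, finsum_mem_range b2, finsum_eq_sum_of_fintype]
    have hone : ∀ i, ‖f (s (c n) i y)‖ ^ 2 ≤ C ^ 2 * ∑ j, (if y ∈ G n (i, j) then |(fderiv ℝ (h n (i, j)) y).det| else 0) := by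
      intro i
      obtain ⟨j, hj⟩ := hcov y (hB3 _ (hcU n) hyB) _ (hmemF n i y hyB)
      have hyG : y ∈ G n (i, j) := ⟨hy, hyB, hj⟩
      have h1 := hC j y (s (c n) i) (hB3 _ (hcU n) hyB) (by
        filter_upwards [(hB1 _ (hcU n)).mem_nhds hyB] with y' hy'
        exact hmemF n i y' hy') (b3 i) hj
      have h2 : ‖f (s (c n) i y)‖ ^ 2 ≤ C ^ 2 * |(fderiv ℝ (h n (i, j)) y).det| := by
        rw [hdet n (i, j) y hyG, abs_of_nonneg (by positivity), ← mul_pow]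
        exact pow_le_pow_left₀ (norm_nonneg _) h1 2
      refine h2.trans (mul_le_mul_of_nonneg_left ?_ (sq_nonneg C))
      have := Finset.single_le_sum (f := fun j => (if y ∈ G n (i, j) then |(fderiv ℝ (h n (i, j)) y).det| else 0))
        (fun j _ => by split_ifs <;> positivity) (Finset.mem_univ j)
      simpa only [hyG, if_true] using this
    have hind : ∀ p, (G n p).indicator (fun y => ENNReal.ofReal |(fderiv ℝ (h n p) y).det|) y =
        ENNReal.ofReal (if y ∈ G n p then |(fderiv ℝ (h n p) y).det| else 0) := by
      intro p
      by_cases hp : y ∈ G n p <;> simp [hp]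
    rw [Finset.sum_congr rfl fun p _ => hind p, ← ENNReal.ofReal_sum_of_nonneg, ← ENNReal.ofReal_mul (by positivity)]
    · apply ENNReal.ofReal_le_ofReal
      calc ‖∑ i, f (s (c n) i y)‖ ^ 2 ≤ (∑ i, ‖f (s (c n) i y)‖) ^ 2 :=
            pow_le_pow_left₀ (norm_nonneg _) (norm_sum_le _ _) 2
        _ ≤ N * ∑ i, ‖f (s (c n) i y)‖ ^ 2 := by
            simpa using sq_sum_le_card_mul_sum_sq (s := Finset.univ) (f := fun i => ‖f (s (c n) i y)‖)
        _ ≤ N * ∑ i, (C ^ 2 * ∑ j, (if y ∈ G n (i, j) then |(fderiv ℝ (h n (i, j)) y).det| else 0)) := by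
            gcongr with i; exact hone i
        _ = _ := by
            rw [← Finset.mul_sum, Fintype.sum_prod_type, mul_assoc]
    · intro p _; split_ifs <;> positivity
  have hmeas : ∀ n p, Measurable ((G n p).indicator (fun y => ENNReal.ofReal |(fderiv ℝ (h n p) y).det|)) := by
    intro n p
    refine Measurable.indicator ?_ (hGm n p)
    apply ENNReal.measurable_ofReal.comp
    refine continuous_abs.measurable.comp ?_
    exact ContinuousLinearMap.continuous_det.measurable.comp (measurable_fderiv ℝ (h n p))
  have hint : ∀ n, ∫⁻ y in A n, ENNReal.ofReal (‖∑ᶠ w ∈ Fh y, f w‖ ^ 2) ≤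
      ENNReal.ofReal (N * C ^ 2) * ∑ p, volume (h n p '' G n p) := by
    intro n
    calc _ ≤ ∫⁻ y in A n, ENNReal.ofReal (N * C ^ 2) * ∑ p, (G n p).indicator (fun y => ENNReal.ofReal |(fderiv ℝ (h n p) y).det|) y :=
          setLIntegral_mono' (hAm n) (hpt n)
      _ = ENNReal.ofReal (N * C ^ 2) * ∑ p, ∫⁻ y in A n, (G n p).indicator (fun y => ENNReal.ofReal |(fderiv ℝ (h n p) y).det|) y := by
          rw [lintegral_const_mul _ (Finset.measurable_sum _ fun p _ => hmeas n p), lintegral_finsetSum _ fun p _ => hmeas n p]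
      _ ≤ _ := by
          gcongr with p
          rw [← himg, ← lintegral_indicator (hGm n p)]
          exact setLIntegral_le_lintegral _ _
  rw [hAU, lintegral_iUnion hAm hAd]
  calc ∑' n, ∫⁻ y in A n, ENNReal.ofReal (‖∑ᶠ w ∈ Fh y, f w‖ ^ 2)
      ≤ ∑' n, ENNReal.ofReal (N * C ^ 2) * ∑ p, volume (h n p '' G n p) := ENNReal.tsum_le_tsum hint
    _ = ENNReal.ofReal (N * C ^ 2) * ∑ p, ∑' n, volume (h n p '' G n p) := by
        rw [ENNReal.tsum_mul_left, Summable.tsum_finsetSum fun _ _ => ENNReal.summable]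
    _ ≤ ENNReal.ofReal (N * C ^ 2) * ∑ p : Fin N × Fin κ, volume (Metric.closedBall (0 : Fin 2 → ℂ) K) := by
        gcongr with p; exact hsum p
    _ < ⊤ := by
        apply ENNReal.mul_lt_top ENNReal.ofReal_lt_top
        rw [ENNReal.sum_lt_top]
        intro p _
        exact measure_closedBall_lt_top

theorem det6_block (a : Fin 3 → Fin 6 → ℂ) :
    Matrix.det (Matrix.of ![![1,0,0,a 0 0, a 1 0, a 2 0], ![0,1,0,a 0 1, a 1 1, a 2 1], ![0,0,1,a 0 2, a 1 2, a 2 2],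
      ![0,0,0,a 0 3,a 1 3,a 2 3], ![0,0,0,a 0 4,a 1 4,a 2 4], ![0,0,0,a 0 5,a 1 5,a 2 5]]) =
    a 0 3 * (a 1 4 * a 2 5 - a 2 4 * a 1 5) - a 1 3 * (a 0 4 * a 2 5 - a 2 4 * a 0 5) + a 2 3 * (a 0 4 * a 1 5 - a 1 4 * a 0 5) := by
  simp [Matrix.det_succ_column_zero, Fin.sum_univ_succ, Fin.succAbove]
  ring

theorem mat_id (J M : Matrix (Fin 6) (Fin 6) ℂ) (hJ : J.det ≠ 0) (hrow : ∀ i : Fin 6, i.1 < 3 → J i = M i)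
    (v S₀ S₁ : Fin 6 → ℂ) (e y₀ y₁ : ℂ)
    (hv : J.mulVec v = ![0, 0, 0, e, e * y₀, e * y₁]) (h0 : J.mulVec S₀ = ![0, 0, 0, 0, 1, 0])
    (h1 : J.mulVec S₁ = ![0, 0, 0, 0, 0, 1]) :
    M.det * e = J.det * (M.mulVec v 3 * (M.mulVec S₀ 4 * M.mulVec S₁ 5 - M.mulVec S₁ 4 * M.mulVec S₀ 5)
      - M.mulVec S₀ 3 * (M.mulVec v 4 * M.mulVec S₁ 5 - M.mulVec S₁ 4 * M.mulVec v 5)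
      + M.mulVec S₁ 3 * (M.mulVec v 4 * M.mulVec S₀ 5 - M.mulVec S₀ 4 * M.mulVec v 5)) := by
  have hJu : IsUnit J.det := isUnit_iff_ne_zero.mpr hJ
  let c : Fin 6 → (Fin 6 → ℂ) := fun j => J⁻¹.mulVec (Pi.single j 1)
  have hc : ∀ j, J.mulVec (c j) = Pi.single j 1 := by
    intro j
    show J.mulVec (J⁻¹.mulVec _) = _
    rw [Matrix.mulVec_mulVec, Matrix.mul_nonsing_inv _ hJu, Matrix.one_mulVec]
  let N : Matrix (Fin 6) (Fin 6) ℂ := Matrix.of ![c 0, c 1, c 2, v, S₀, S₁]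
  have hmul : ∀ A : Matrix (Fin 6) (Fin 6) ℂ, A * N.transpose = (Matrix.of fun j => A.mulVec (N j)).transpose := by
    intro A; ext i j; simp [Matrix.mul_apply, Matrix.mulVec, dotProduct]
  have hJM : ∀ (x : Fin 6 → ℂ) (i : Fin 6), i.1 < 3 → M.mulVec x i = J.mulVec x i := by
    intro x i hi; simp [Matrix.mulVec, hrow i hi]
  have hJN : J * N.transpose = Matrix.of ![![1,0,0,0,0,0], ![0,1,0,0,0,0], ![0,0,1,0,0,0], ![0,0,0,e,0,0], ![0,0,0,e*y₀,1,0], ![0,0,0,e*y₁,0,1]] := by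
    rw [hmul]
    ext i j
    fin_cases j
    · have : N 0 = c 0 := rfl
      simp [this, hc]; fin_cases i <;> simp
    · have : N 1 = c 1 := rfl
      simp [this, hc]; fin_cases i <;> simp
    · have : N 2 = c 2 := rfl
      simp [this, hc]; fin_cases i <;> simp
    · have : N 3 = v := rfl
      simp [this, hv]; fin_cases i <;> simp
    · have : N 4 = S₀ := rfl
      simp [this, h0]; fin_cases i <;> simp
    · have : N 5 = S₁ := rfl
      simp [this, h1]; fin_cases i <;> simp
  have d1 : J.det * N.det = e := by
    have := det6_block ![![0,0,0,e,e*y₀,e*y₁],![0,0,0,0,1,0],![0,0,0,0,0,1]]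
    have h2 := congrArg Matrix.det hJN
    rw [Matrix.det_mul, Matrix.det_transpose] at h2
    rw [h2]
    simpa using this
  let m : Fin 3 → Fin 6 → ℂ := ![M.mulVec v, M.mulVec S₀, M.mulVec S₁]
  have hfirst : ∀ (i : Fin 6) (hi : i.1 < 3) (j : Fin 6), M.mulVec (c j) i = (Pi.single j 1 : Fin 6 → ℂ) i := by
    intro i hi j; rw [hJM _ _ hi, hc]
  have d2 : M.det * N.det = M.mulVec v 3 * (M.mulVec S₀ 4 * M.mulVec S₁ 5 - M.mulVec S₁ 4 * M.mulVec S₀ 5)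
      - M.mulVec S₀ 3 * (M.mulVec v 4 * M.mulVec S₁ 5 - M.mulVec S₁ 4 * M.mulVec v 5)
      + M.mulVec S₁ 3 * (M.mulVec v 4 * M.mulVec S₀ 5 - M.mulVec S₀ 4 * M.mulVec v 5) := by
    rw [← Matrix.det_transpose N, ← Matrix.det_mul, ← Matrix.det_transpose, hmul, Matrix.transpose_transpose]
    have z : ∀ i : Fin 6, i.1 < 3 → M.mulVec v i = 0 ∧ M.mulVec S₀ i = 0 ∧ M.mulVec S₁ i = 0 := by
      intro i hi
      rw [hJM _ _ hi, hJM _ _ hi, hJM _ _ hi, hv, h0, h1]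
      fin_cases i
      · simp
      · simp
      · simp
      all_goals (simp at hi)
    have : (Matrix.of fun j => M.mulVec (N j)) = Matrix.of ![
        ![1,0,0,M.mulVec (c 0) 3, M.mulVec (c 0) 4, M.mulVec (c 0) 5],
        ![0,1,0,M.mulVec (c 1) 3, M.mulVec (c 1) 4, M.mulVec (c 1) 5],
        ![0,0,1,M.mulVec (c 2) 3, M.mulVec (c 2) 4, M.mulVec (c 2) 5],
        ![0,0,0,M.mulVec v 3, M.mulVec v 4, M.mulVec v 5],
        ![0,0,0,M.mulVec S₀ 3, M.mulVec S₀ 4, M.mulVec S₀ 5],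
        ![0,0,0,M.mulVec S₁ 3, M.mulVec S₁ 4, M.mulVec S₁ 5]] := by
      ext j i
      fin_cases j
      · have : N 0 = c 0 := rfl
        fin_cases i <;> simp [this, hfirst]
      · have : N 1 = c 1 := rfl
        fin_cases i <;> simp [this, hfirst]
      · have : N 2 = c 2 := rfl
        fin_cases i <;> simp [this, hfirst]
      · have : N 3 = v := rfl
        fin_cases i <;> simp [this, z]
      · have : N 4 = S₀ := rfl
        fin_cases i <;> simp [this, z]
      · have : N 5 = S₁ := rfl
        fin_cases i <;> simp [this, z]
    rw [this]
    have h5 := det6_block ![![M.mulVec (c 0) 3, M.mulVec (c 1) 3, M.mulVec (c 2) 3, M.mulVec v 3, M.mulVec S₀ 3, M.mulVec S₁ 3],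
      ![M.mulVec (c 0) 4, M.mulVec (c 1) 4, M.mulVec (c 2) 4, M.mulVec v 4, M.mulVec S₀ 4, M.mulVec S₁ 4],
      ![M.mulVec (c 0) 5, M.mulVec (c 1) 5, M.mulVec (c 2) 5, M.mulVec v 5, M.mulVec S₀ 5, M.mulVec S₁ 5]]
    simp at h5
    rw [h5]
    ring
  rw [← d2, ← d1]; ring

theorem Jac_det_hom {n : ℕ} (P : Fin n → MvPolynomial (Fin n) ℂ) (k : Fin n → ℕ) (hP : ∀ i, (P i).IsHomogeneous (k i))
    (c : ℂ) (v : Fin n → ℂ) : (Jac P (c • v)).det = (∏ i, c ^ (k i - 1)) * (Jac P v).det := by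
  rw [← Matrix.det_mul_column]
  congr 1
  ext i j
  simp [Jac, eval_hom (pderiv_hom (hP i) j)]

theorem Jac_chart_hom {q₁ q₂ g : MvPolynomial (Fin 6) ℂ} {d : ℕ} (hd : 2 ≤ d)
    (h₁ : q₁.IsHomogeneous 2) (h₂ : q₂.IsHomogeneous 2) (hg : g.IsHomogeneous d) (k : Fin 6) (l₁ l₂ : Fin 6 → ℂ)
    (c : ℂ) (v : Fin 6 → ℂ) :
    (Jac ![q₁, q₂, g, X k, linP l₁, linP l₂] (c • v)).det = c ^ (d + 1) * (Jac ![q₁, q₂, g, X k, linP l₁, linP l₂] v).det := by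
  rw [Jac_det_hom _ ![2, 2, d, 1, 1, 1]]
  · simp [Fin.prod_univ_succ]
    left
    rw [← pow_succ', ← pow_succ']
    congr 1; omega
  · intro i
    fin_cases i
    exacts [h₁, h₂, hg, isHomogeneous_X ℂ k, linP_hom _, linP_hom _]

/-- projection chart -/
noncomputable def rhoC (k : Fin 6) (l₁ l₂ : Fin 6 → ℂ) (v : Fin 6 → ℂ) : Fin 2 → ℂ :=
  ![(∑ i, l₁ i * v i) * (v k)⁻¹, (∑ i, l₂ i * v i) * (v k)⁻¹]

theorem rhoC_hasFDerivAt (k : Fin 6) (l₁ l₂ : Fin 6 → ℂ) (v : Fin 6 → ℂ) (hv : v k ≠ 0) :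
    ∃ R : (Fin 6 → ℂ) →L[ℂ] (Fin 2 → ℂ), HasFDerivAt (rhoC k l₁ l₂) R v ∧
      ∀ x, R x 0 = ((∑ i, l₁ i * x i) * v k - (∑ i, l₁ i * v i) * x k) / (v k) ^ 2 ∧
        R x 1 = ((∑ i, l₂ i * x i) * v k - (∑ i, l₂ i * v i) * x k) / (v k) ^ 2 := by
  have hk : HasFDerivAt (fun x : Fin 6 → ℂ => (x k)⁻¹) (-((v k ^ 2)⁻¹) • ContinuousLinearMap.proj (R := ℂ) (φ := fun _ : Fin 6 => ℂ) k) v := by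
    have h1 : HasFDerivAt (fun x : Fin 6 → ℂ => x k) (ContinuousLinearMap.proj (R := ℂ) (φ := fun _ : Fin 6 => ℂ) k) v :=
      (ContinuousLinearMap.proj (R := ℂ) (φ := fun _ : Fin 6 => ℂ) k).hasFDerivAt
    exact (hasDerivAt_inv hv).comp_hasFDerivAt v h1
  have hl : ∀ l : Fin 6 → ℂ, HasFDerivAt (fun x : Fin 6 → ℂ => ∑ i, l i * x i) (gradL (linP l) v) v := by
    intro l
    refine (eval_hasStrict (linP l) v).hasFDerivAt.congr_of_eventuallyEq (Filter.Eventually.of_forall fun x => ?_)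
    simp [eval_linP]
  refine ⟨ContinuousLinearMap.pi ![(∑ i, l₁ i * v i) • (-((v k ^ 2)⁻¹) • ContinuousLinearMap.proj (R := ℂ) (φ := fun _ : Fin 6 => ℂ) k) + (v k)⁻¹ • gradL (linP l₁) v,
     (∑ i, l₂ i * v i) • (-((v k ^ 2)⁻¹) • ContinuousLinearMap.proj (R := ℂ) (φ := fun _ : Fin 6 => ℂ) k) + (v k)⁻¹ • gradL (linP l₂) v], ?_, ?_⟩
  · rw [hasFDerivAt_pi']
    intro i
    fin_cases i
    · exact (hl l₁).mul hk
    · exact (hl l₂).mul hk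
  · intro x
    constructor
    · simp [gradL_linP]; field_simp; ring
    · simp [gradL_linP]; field_simp; ring

theorem alg_sec (a b c x0 x1 x2 y0 y1 y2 : ℂ) (h : a ≠ 0) :
    a * (x1 * y2 - x2 * y1) - b * (x0 * y2 - x2 * y0) + c * (x0 * y1 - x1 * y0) =
    a ^ 3 * ((x1 * a - x0 * b) / a ^ 2 * ((y2 * a - y0 * c) / a ^ 2) - (x2 * a - x0 * c) / a ^ 2 * ((y1 * a - y0 * b) / a ^ 2)) := by
  field_simp
  ring

theorem rows_eq (q₁ q₂ g : MvPolynomial (Fin 6) ℂ) (φ : RatMapTo (Fin 6) 2) (k : Fin 6) (l₁ l₂ v : Fin 6 → ℂ) :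
    ∀ i : Fin 6, i.1 < 3 → (Jac (sysPhi q₁ q₂ g φ) v) i = (Jac ![q₁, q₂, g, X k, linP l₁, linP l₂] v) i := by
  intro i hi
  have h : sysPhi q₁ q₂ g φ i = (![q₁, q₂, g, X k, linP l₁, linP l₂] : Fin 6 → MvPolynomial (Fin 6) ℂ) i := by
    fin_cases i
    · simp [sysPhi]
    · simp [sysPhi]
    · simp [sysPhi]
    all_goals (simp at hi)
  funext j
  simp only [Jac]
  simp [h]

theorem row3 (q₁ q₂ g : MvPolynomial (Fin 6) ℂ) (k : Fin 6) (l₁ l₂ v x : Fin 6 → ℂ) :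
    (Jac ![q₁, q₂, g, X k, linP l₁, linP l₂] v).mulVec x 3 = x k := by
  rw [Jac_mulVec]
  simp only [gradL_apply]
  rw [Finset.sum_eq_single k]
  · simp
  · intro j _ hj; simp [pderiv_X, Pi.single_apply, hj.symm]
  · simp

theorem row4 (q₁ q₂ g : MvPolynomial (Fin 6) ℂ) (k : Fin 6) (l₁ l₂ v x : Fin 6 → ℂ) :
    (Jac ![q₁, q₂, g, X k, linP l₁, linP l₂] v).mulVec x 4 = ∑ i, l₁ i * x i := by
  rw [Jac_mulVec]
  have : (![q₁, q₂, g, X k, linP l₁, linP l₂] : Fin 6 → MvPolynomial (Fin 6) ℂ) 4 = linP l₁ := by simp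
  rw [this, gradL_linP]

theorem row5 (q₁ q₂ g : MvPolynomial (Fin 6) ℂ) (k : Fin 6) (l₁ l₂ v x : Fin 6 → ℂ) :
    (Jac ![q₁, q₂, g, X k, linP l₁, linP l₂] v).mulVec x 5 = ∑ i, l₂ i * x i := by
  rw [Jac_mulVec]
  have : (![q₁, q₂, g, X k, linP l₁, linP l₂] : Fin 6 → MvPolynomial (Fin 6) ℂ) 5 = linP l₂ := by simp
  rw [this, gradL_linP]

open Topology Filter in
theorem sec_det {q₁ q₂ g : MvPolynomial (Fin 6) ℂ} {d : ℕ}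
    (h₁ : q₁.IsHomogeneous 2) (h₂ : q₂.IsHomogeneous 2) (hg : g.IsHomogeneous d) (φ : RatMapTo (Fin 6) 2)
    (k : Fin 6) (l₁ l₂ : Fin 6 → ℂ) (s : (Fin 2 → ℂ) → (Fin 6 → ℂ)) (y : Fin 2 → ℂ)
    (hs : ∀ᶠ y' in 𝓝 y, s y' ∈ Fhat q₁ q₂ g φ y') (hsd : DifferentiableAt ℂ s y) (hk : s y k ≠ 0)
    (hJ : (Jac (sysPhi q₁ q₂ g φ) (s y)).det ≠ 0) :
    (Jac ![q₁, q₂, g, X k, linP l₁, linP l₂] (s y)).det * φ.e = (Jac (sysPhi q₁ q₂ g φ) (s y)).det * ((s y k) ^ 3 *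
      LinearMap.det ((fderiv ℂ (fun y => rhoC k l₁ l₂ (s y)) y : (Fin 2 → ℂ) →L[ℂ] (Fin 2 → ℂ)) : (Fin 2 → ℂ) →ₗ[ℂ] (Fin 2 → ℂ))) := by
  set v := s y with hv
  set S := fderiv ℂ s y
  have hS : HasFDerivAt s S y := hsd.hasFDerivAt
  obtain ⟨R, hR, hRx⟩ := rhoC_hasFDerivAt k l₁ l₂ v hk
  have hRS : fderiv ℂ (fun y => rhoC k l₁ l₂ (s y)) y = R.comp S := (hR.comp y hS).fderiv
  have hiota : (sysD (sysPhi q₁ q₂ g φ) v).comp S = iotaL := by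
    have e1 : HasFDerivAt (fun y => sysMap (sysPhi q₁ q₂ g φ) (s y)) ((sysD (sysPhi q₁ q₂ g φ) v).comp S) y :=
      (sysMap_hasStrict _ v).hasFDerivAt.comp y hS
    have e2 : HasFDerivAt (fun y => sysMap (sysPhi q₁ q₂ g φ) (s y)) iotaL y :=
      (iotaA_hasFDerivAt y).congr_of_eventuallyEq (hs.mono fun y' hy' => hy')
    exact e1.unique e2
  have hio : ∀ l, (Jac (sysPhi q₁ q₂ g φ) v).mulVec (S l) = iotaL l := by
    intro l; rw [← sysD_eq, ← hiota]; rfl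
  have hyF : v ∈ Fhat q₁ q₂ g φ y := hs.self_of_nhds
  obtain ⟨a1, a2, a3, a4, a5, a6⟩ := mem_Fhat.mp hyF
  have key := mat_id (Jac (sysPhi q₁ q₂ g φ) v) _ hJ (rows_eq q₁ q₂ g φ k l₁ l₂ v) v (S ![1, 0]) (S ![0, 1]) φ.e (y 0) (y 1)
    (by
      ext i
      rw [Jac_mulVec]
      fin_cases i
      · simpa [sysPhi, a1] using euler_gradL h₁ v
      · simpa [sysPhi, a2] using euler_gradL h₂ v
      · simpa [sysPhi, a3] using euler_gradL hg v
      · simpa [sysPhi, a4] using euler_gradL (φ.homog 0) v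
      · simpa [sysPhi, a5] using euler_gradL (φ.homog 1) v
      · simpa [sysPhi, a6] using euler_gradL (φ.homog 2) v)
    (by rw [hio, iotaL_apply]; simp) (by rw [hio, iotaL_apply]; simp)
  rw [key, row3, row3, row3, row4, row4, row4, row5, row5, row5]
  congr 1
  have hdet : LinearMap.det ((R.comp S : (Fin 2 → ℂ) →L[ℂ] (Fin 2 → ℂ)) : (Fin 2 → ℂ) →ₗ[ℂ] (Fin 2 → ℂ)) =
      R (S ![1, 0]) 0 * R (S ![0, 1]) 1 - R (S ![0, 1]) 0 * R (S ![1, 0]) 1 := by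
    rw [← LinearMap.det_toMatrix', Matrix.det_fin_two]
    have e0 : (Pi.single 0 1 : Fin 2 → ℂ) = ![1, 0] := by ext i; fin_cases i <;> simp
    have e1 : (Pi.single 1 1 : Fin 2 → ℂ) = ![0, 1] := by ext i; fin_cases i <;> simp
    simp [LinearMap.toMatrix'_apply, e0, e1]
  rw [hRS, hdet, (hRx _).1, (hRx _).1, (hRx _).2, (hRx _).2]
  exact alg_sec _ _ _ _ _ _ _ _ _ hk

theorem gradL_X (k : Fin 6) (v x : Fin 6 → ℂ) : gradL (X k : MvPolynomial (Fin 6) ℂ) v x = x k := by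
  rw [gradL_apply, Finset.sum_eq_single k]
  · simp
  · intro j _ hj; simp [pderiv_X, Pi.single_apply, hj.symm]
  · simp

open Topology Filter Set in
theorem chart_nhd {q₁ q₂ g : MvPolynomial (Fin 6) ℂ} {d : ℕ}
    (h₁ : q₁.IsHomogeneous 2) (h₂ : q₂.IsHomogeneous 2) (hg : g.IsHomogeneous d)
    (hX : IsSmoothCI3 q₁ q₂ g) (k : Fin 6) (v₀ : Fin 6 → ℂ) (hv : ‖v₀‖ ≤ 1) (hk : v₀ k = 1)
    (e1 : eval v₀ q₁ = 0) (e2 : eval v₀ q₂ = 0) (e3 : eval v₀ g = 0) :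
    ∃ (l₁ l₂ : Fin 6 → ℂ) (N : Set (Fin 6 → ℂ)) (ε : ℝ), 0 < ε ∧ IsOpen N ∧ v₀ ∈ N ∧
      (∀ v ∈ N, ‖v‖ < 2 ∧ ε ≤ ‖(Jac ![q₁, q₂, g, X k, linP l₁, linP l₂] v).det‖) ∧
      (∀ v ∈ N, ∀ v' ∈ N, sysMap ![q₁, q₂, g, X k, linP l₁, linP l₂] v = sysMap ![q₁, q₂, g, X k, linP l₁, linP l₂] v' → v = v') := by
  have h0 : v₀ ≠ 0 := by rintro rfl; simp at hk
  obtain ⟨l₁, l₂, hdet⟩ := chart_exists q₁ q₂ g (X k) v₀ (hX v₀ h0 e1 e2 e3)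
    (by rw [euler_gradL h₁, e1, mul_zero]) (by rw [euler_gradL h₂, e2, mul_zero]) (by rw [euler_gradL hg, e3, mul_zero])
    (by rw [gradL_X, hk]; exact one_ne_zero)
  obtain ⟨e, hes, hee, -, -⟩ := sys_ift _ v₀ hdet
  have hc := (det_Jac_continuous ![q₁, q₂, g, X k, linP l₁, linP l₂]).norm
  have hpos := norm_pos_iff.mpr hdet
  refine ⟨l₁, l₂, (e.source ∩ {v | ‖v‖ < 2}) ∩ {v | ‖(Jac ![q₁, q₂, g, X k, linP l₁, linP l₂] v₀).det‖ / 2 < ‖(Jac ![q₁, q₂, g, X k, linP l₁, linP l₂] v).det‖},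
    ‖(Jac ![q₁, q₂, g, X k, linP l₁, linP l₂] v₀).det‖ / 2, by positivity, ?_, ⟨⟨hes, ?_⟩, ?_⟩, ?_, ?_⟩
  · exact (e.open_source.inter (isOpen_lt continuous_norm continuous_const)).inter (isOpen_lt continuous_const hc)
  · simp only [Set.mem_ofPred_eq]; linarith
  · simp only [Set.mem_ofPred_eq]; linarith
  · rintro v ⟨⟨_, h⟩, h'⟩
    simp only [Set.mem_ofPred_eq] at h h'
    exact ⟨h, h'.le⟩
  · rintro v ⟨⟨hv, _⟩, _⟩ v' ⟨⟨hv', _⟩, _⟩ h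
    rw [← hee, ← hee] at h
    exact e.injOn hv hv' h

open Topology Filter Set in
theorem charts_fin {q₁ q₂ g : MvPolynomial (Fin 6) ℂ} {d : ℕ}
    (h₁ : q₁.IsHomogeneous 2) (h₂ : q₂.IsHomogeneous 2) (hg : g.IsHomogeneous d)
    (hX : IsSmoothCI3 q₁ q₂ g) :
    ∃ (κ : ℕ) (k : Fin κ → Fin 6) (l₁ l₂ : Fin κ → Fin 6 → ℂ) (N : Fin κ → Set (Fin 6 → ℂ)) (ε : Fin κ → ℝ), 
      (∀ j, 0 < ε j ∧ IsOpen (N j) ∧ 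
      (∀ v ∈ N j, ‖v‖ < 2 ∧ ε j ≤ ‖(Jac ![q₁, q₂, g, X (k j), linP (l₁ j), linP (l₂ j)] v).det‖) ∧
      (∀ v ∈ N j, ∀ v' ∈ N j, sysMap ![q₁, q₂, g, X (k j), linP (l₁ j), linP (l₂ j)] v = sysMap ![q₁, q₂, g, X (k j), linP (l₁ j), linP (l₂ j)] v' → v = v')) ∧
      ∀ (i : Fin 6) (v : Fin 6 → ℂ), ‖v‖ ≤ 1 → v i = 1 → eval v q₁ = 0 → eval v q₂ = 0 → eval v g = 0 →
        ∃ j, k j = i ∧ v ∈ N j := by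
  classical
  let S : Fin 6 → Set (Fin 6 → ℂ) := fun i => {v | ‖v‖ ≤ 1 ∧ v i = 1 ∧ eval v q₁ = 0 ∧ eval v q₂ = 0 ∧ eval v g = 0}
  have hS : ∀ i, IsCompact (S i) := by
    intro i
    refine (isCompact_closedBall (0 : Fin 6 → ℂ) 1).of_isClosed_subset ?_ ?_
    · exact (isClosed_le continuous_norm continuous_const).inter ((isClosed_eq (continuous_apply i) continuous_const).inter
        ((isClosed_eq (eval_continuous q₁) continuous_const).inter ((isClosed_eq (eval_continuous q₂) continuous_const).inter
        (isClosed_eq (eval_continuous g) continuous_const))))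
    · intro v hv; simpa using hv.1
  have key := fun (i : Fin 6) (v : Fin 6 → ℂ) (h : v ∈ S i) => chart_nhd h₁ h₂ hg hX i v h.1 h.2.1 h.2.2.1 h.2.2.2.1 h.2.2.2.2
  choose l₁ l₂ N ε hε hN hvN hN1 hN2 using key
  have hfin : ∀ i, ∃ t : Finset (S i), S i ⊆ ⋃ x ∈ t, N i x.1 x.2 := by
    intro i
    obtain ⟨t, ht⟩ := (hS i).elim_finite_subcover (fun x : S i => N i x.1 x.2) (fun x => hN i x.1 x.2)
      (fun v hv => mem_iUnion.mpr ⟨⟨v, hv⟩, hvN i v hv⟩)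
    exact ⟨t, ht⟩
  choose t ht using hfin
  let I := Σ i : Fin 6, {x : S i // x ∈ t i}
  let E : Fin (Fintype.card I) ≃ I := (Fintype.equivFin I).symm
  refine ⟨Fintype.card I, fun j => (E j).1, fun j => l₁ _ _ (E j).2.1.2, fun j => l₂ _ _ (E j).2.1.2, fun j => N _ _ (E j).2.1.2,
    fun j => ε _ _ (E j).2.1.2, fun j => ⟨hε _ _ _, hN _ _ _, hN1 _ _ _, hN2 _ _ _⟩, ?_⟩
  intro i v a1 a2 a3 a4 a5
  obtain ⟨x, hx⟩ := mem_iUnion.mp (ht i (show v ∈ S i from ⟨a1, a2, a3, a4, a5⟩))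
  obtain ⟨hxt, hx⟩ := mem_iUnion.mp hx
  refine ⟨E.symm ⟨i, ⟨x, hxt⟩⟩, ?_, ?_⟩
  · simp
  · have : ∀ z : I, z = ⟨i, ⟨x, hxt⟩⟩ → v ∈ N z.1 z.2.1 z.2.1.2 := by
      rintro z rfl; exact hx
    exact this _ (E.apply_symm_apply _)

theorem rhoC_smul (k : Fin 6) (l₁ l₂ v : Fin 6 → ℂ) :
    rhoC k l₁ l₂ v = ![∑ i, l₁ i * ((v k)⁻¹ • v) i, ∑ i, l₂ i * ((v k)⁻¹ • v) i] := by
  unfold rhoC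
  congr 1
  · simp [Finset.sum_mul]; exact Finset.sum_congr rfl fun i _ => by ring
  · congr 1
    simp [Finset.sum_mul]; exact Finset.sum_congr rfl fun i _ => by ring

theorem rhoC_bound (k : Fin 6) (l₁ l₂ v : Fin 6 → ℂ) (h : ‖(v k)⁻¹ • v‖ < 2) :
    ‖rhoC k l₁ l₂ v‖ ≤ ∑ i, (‖l₁ i‖ + ‖l₂ i‖) * 2 := by
  rw [rhoC_smul]
  set w := (v k)⁻¹ • v
  have hw : ∀ i, ‖w i‖ ≤ 2 := fun i => (norm_le_pi_norm w i).trans h.le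
  refine (pi_norm_le_iff_of_nonneg (by positivity)).mpr fun i => ?_
  have key : ∀ l : Fin 6 → ℂ, (∀ i, ‖l i‖ ≤ ‖l₁ i‖ + ‖l₂ i‖) → ‖∑ i, l i * w i‖ ≤ ∑ i, (‖l₁ i‖ + ‖l₂ i‖) * 2 := by
    intro l hl
    refine (norm_sum_le _ _).trans (Finset.sum_le_sum fun i _ => ?_)
    rw [norm_mul]
    exact mul_le_mul (hl i) (hw i) (norm_nonneg _) (by positivity)
  fin_cases i
  · exact key l₁ (by simp)
  · exact key l₂ (by simp)

theorem alg_bound (Pv Pw J c T e A : ℂ) (m M ε : ℝ) (n : ℕ) (hJ : J ≠ 0) (hc : c ≠ 0) (hn : 2 ≤ n)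
    (h1 : Pv = c ^ (n - 2) * Pw) (h2 : (c ^ (n + 1) * T) * e = J * (c ^ 3 * A)) (hP : ‖Pw‖ ≤ M) (hε : 0 < ε) (hT : ε ≤ ‖T‖)
    (hm : 0 < m) (he : ‖e‖ = m) : ‖Pv / J‖ ≤ M / (ε * m) * ‖A‖ := by
  have h3 : c ^ (n - 2) * T * e = J * A := by
    have : c ^ (n + 1) = c ^ (n - 2) * c ^ 3 := by rw [← pow_add]; congr 1; omega
    rw [this] at h2
    have hc3 : c ^ 3 ≠ 0 := pow_ne_zero _ hc
    apply mul_right_cancel₀ hc3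
    linear_combination h2
  have h4 : Pv / J * (T * e) = Pw * A := by
    rw [h1]; field_simp; linear_combination Pw * h3
  have h5 : ‖Pv / J‖ * (‖T‖ * m) = ‖Pw‖ * ‖A‖ := by
    rw [← he, ← norm_mul, ← norm_mul, h4, norm_mul]
  rw [div_mul_eq_mul_div, le_div_iff₀ (by positivity)]
  calc ‖Pv / J‖ * (ε * m) ≤ ‖Pv / J‖ * (‖T‖ * m) := by gcongr
    _ = ‖Pw‖ * ‖A‖ := h5
    _ ≤ M * ‖A‖ := by gcongr

theorem sysChart_eq {q₁ q₂ g : MvPolynomial (Fin 6) ℂ} {k : Fin 6} {l₁ l₂ w w' : Fin 6 → ℂ}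
    (a : eval w q₁ = eval w' q₁) (b : eval w q₂ = eval w' q₂) (c : eval w g = eval w' g)
    (hk : w k = w' k) (h4 : ∑ i, l₁ i * w i = ∑ i, l₁ i * w' i) (h5 : ∑ i, l₂ i * w i = ∑ i, l₂ i * w' i) :
    sysMap ![q₁, q₂, g, X k, linP l₁, linP l₂] w = sysMap ![q₁, q₂, g, X k, linP l₁, linP l₂] w' := by
  ext i
  unfold sysMap
  fin_cases i
  · simpa using a
  · simpa using b
  · simpa using c
  · simpa using hk
  · simpa [eval_linP] using h4
  · simpa [eval_linP] using h5

open Topology Filter Set in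
theorem trace_l2 {q₁ q₂ g : MvPolynomial (Fin 6) ℂ} {d n : ℕ} (hd : 2 ≤ d)
    (h₁ : q₁.IsHomogeneous 2) (h₂ : q₂.IsHomogeneous 2) (hg : g.IsHomogeneous d)
    (hX : IsSmoothCI3 q₁ q₂ g) (φ : RatMapTo (Fin 6) 2) (he : 0 < φ.e) {U : Set (Fin 2 → ℂ)} (hU : IsOpen U)
    (hF : ∀ y ∈ U, (Fhat q₁ q₂ g φ y).Finite ∧ (Fhat q₁ q₂ g φ y).ncard = n ∧
      ∀ w ∈ Fhat q₁ q₂ g φ y, (Jac (sysPhi q₁ q₂ g φ) w).det ≠ 0)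
    (P : MvPolynomial (Fin 6) ℂ) (hP : P.IsHomogeneous (d - 2)) :
    ∫⁻ y in U, ENNReal.ofReal (‖∑ᶠ w ∈ Fhat q₁ q₂ g φ y, eval w P / (Jac (sysPhi q₁ q₂ g φ) w).det‖ ^ 2) < ⊤ := by
  obtain ⟨κ, k, l₁, l₂, N, ε, hN, hcov⟩ := charts_fin h₁ h₂ hg hX
  obtain ⟨M, hM⟩ : ∃ M, ∀ w : Fin 6 → ℂ, ‖w‖ < 2 → ‖eval w P‖ ≤ M := by
    obtain ⟨M, hM⟩ := (isCompact_closedBall (0 : Fin 6 → ℂ) 2).exists_bound_of_continuousOn (eval_continuous P).continuousOn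
    exact ⟨M, fun w hw => hM w (by simpa using hw.le)⟩
  have hM0 : 0 ≤ M := (norm_nonneg _).trans (hM 0 (by simp))
  have hee : (0 : ℝ) < φ.e := by exact_mod_cast he
  have hden : ∀ j, 0 ≤ M / (ε j * φ.e) := fun j => div_nonneg hM0 (mul_nonneg (hN j).1.le hee.le)
  let O : Fin κ → Set (Fin 6 → ℂ) := fun j => {v | v (k j) ≠ 0 ∧ (v (k j))⁻¹ • v ∈ N j}
  refine l2_abstract (κ := κ) (Fhat q₁ q₂ g φ) (fun w => eval w P / (Jac (sysPhi q₁ q₂ g φ) w).det) (local_sections hU hF) O ?_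
    (fun j => rhoC (k j) (l₁ j) (l₂ j)) ?_ (∑ j, ∑ i, (‖l₁ j i‖ + ‖l₂ j i‖) * 2) ?_ ?_ ?_ (∑ j, M / (ε j * φ.e)) ?_
  · intro j
    have ho : IsOpen {v : Fin 6 → ℂ | v (k j) ≠ 0} := isOpen_ne_fun (continuous_apply _) continuous_const
    have hc : ContinuousOn (fun v : Fin 6 → ℂ => (v (k j))⁻¹ • v) {v : Fin 6 → ℂ | v (k j) ≠ 0} :=
      ((continuous_apply (k j)).continuousOn.inv₀ (fun v hv => hv)).smul continuousOn_id
    exact hc.isOpen_inter_preimage ho (hN j).2.1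
  · intro j v hv
    obtain ⟨R, hR, -⟩ := rhoC_hasFDerivAt (k j) (l₁ j) (l₂ j) v hv.1
    exact hR.differentiableAt
  · intro j y _ v _ hv
    refine (rhoC_bound _ _ _ _ ((hN j).2.2.1 _ hv.2).1).trans ?_
    exact Finset.single_le_sum (f := fun j => ∑ i, (‖l₁ j i‖ + ‖l₂ j i‖) * 2) (fun j _ => by positivity) (Finset.mem_univ j)
  · intro j y y' v v' hv hv' hvO hvO' hρ
    have hw : (v (k j))⁻¹ • v = (v' (k j))⁻¹ • v' := by
      refine (hN j).2.2.2 _ hvO.2 _ hvO'.2 ?_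
      obtain ⟨a1, a2, a3, -⟩ := mem_Fhat.mp hv
      obtain ⟨b1, b2, b3, -⟩ := mem_Fhat.mp hv'
      simp only [rhoC_smul] at hρ
      refine sysChart_eq ?_ ?_ ?_ ?_ (congrFun hρ 0) (congrFun hρ 1)
      · rw [eval_hom h₁, eval_hom h₁, a1, b1]; simp
      · rw [eval_hom h₂, eval_hom h₂, a2, b2]; simp
      · rw [eval_hom hg, eval_hom hg, a3, b3]; simp
      · have := hvO.1; have := hvO'.1
        simp [*]
    have : v' = (v' (k j) * (v (k j))⁻¹) • v := by
      rw [mul_smul, hw, smul_smul, mul_inv_cancel₀ hvO'.1, one_smul]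
    exact (Fhat_same (t := v' (k j) * (v (k j))⁻¹) hv (by rw [← this]; exact hv')).2
  · intro y _ v hv
    have hv0 := Fhat_ne_zero he hv
    obtain ⟨a1, a2, a3, -⟩ := mem_Fhat.mp hv
    obtain ⟨i, -, hi⟩ := Finset.exists_max_image (Finset.univ : Finset (Fin 6)) (fun i => ‖v i‖) ⟨0, Finset.mem_univ _⟩
    have hvi : v i ≠ 0 := by
      intro h
      apply hv0; ext j
      have := hi j (Finset.mem_univ _)
      rw [h, norm_zero] at this
      simpa using this
    obtain ⟨j, rfl, hj⟩ := hcov i ((v i)⁻¹ • v) (by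
        refine (pi_norm_le_iff_of_nonneg zero_le_one).mpr fun j => ?_
        simp only [Pi.smul_apply, smul_eq_mul, norm_mul, norm_inv]
        rw [inv_mul_le_iff₀ (norm_pos_iff.mpr hvi), mul_one]
        exact hi j (Finset.mem_univ _))
      (by simp [hvi]) (by rw [eval_hom h₁, a1, mul_zero]) (by rw [eval_hom h₂, a2, mul_zero]) (by rw [eval_hom hg, a3, mul_zero])
    exact ⟨j, hvi, hj⟩
  · intro j y s hy hs hsd hsO
    have hJ := (hF y hy).2.2 (s y) hs.self_of_nhds
    have key := sec_det h₁ h₂ hg φ (k j) (l₁ j) (l₂ j) s y hs hsd hsO.1 hJ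
    have hvw : s y = (s y (k j)) • ((s y (k j))⁻¹ • s y) := by rw [smul_smul, mul_inv_cancel₀ hsO.1, one_smul]
    have hT : (Jac ![q₁, q₂, g, X (k j), linP (l₁ j), linP (l₂ j)] (s y)).det = (s y (k j)) ^ (d + 1) * (Jac ![q₁, q₂, g, X (k j), linP (l₁ j), linP (l₂ j)] ((s y (k j))⁻¹ • s y)).det := by
      conv_lhs => rw [hvw]
      exact Jac_chart_hom hd h₁ h₂ hg _ _ _ _ _
    have hPv : eval (s y) P = (s y (k j)) ^ (d - 2) * eval ((s y (k j))⁻¹ • s y) P := by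
      conv_lhs => rw [hvw]
      exact eval_hom hP _ _
    rw [hT] at key
    have hN2 := (hN j).2.2.1 _ hsO.2
    refine (alg_bound _ _ _ _ _ _ _ (φ.e : ℝ) M (ε j) d hJ hsO.1 hd hPv key (hM _ hN2.1) (hN j).1 hN2.2 hee (by simp)).trans ?_
    refine mul_le_mul_of_nonneg_right ?_ (norm_nonneg _)
    exact Finset.single_le_sum (f := fun j => M / (ε j * φ.e)) (fun j _ => hden j) (Finset.mem_univ j)

theorem poly_slice {σ : Type} (f : σ → Polynomial ℂ) (D : MvPolynomial σ ℂ) (v : ℂ) :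
    (aeval f D).eval v = eval (fun i => (f i).eval v) D := by
  rw [← Polynomial.coe_evalRingHom, MvPolynomial.aeval_def, MvPolynomial.hom_eval₂]
  have : ((Polynomial.evalRingHom v).comp (algebraMap ℂ (Polynomial ℂ))) = RingHom.id ℂ := by
    ext x; simp
  rw [this]
  rfl

open Topology Filter Set MeasureTheory in
theorem l2_zero2 (D : MvPolynomial (Fin 2) ℂ) (T : (Fin 2 → ℂ) → ℂ)
    (hT : ∀ y, eval y D ≠ 0 → DifferentiableAt ℂ T y)
    (hint : ∫⁻ y in {y | eval y D ≠ 0}, ENNReal.ofReal (‖T y‖ ^ 2) < ⊤) :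
    ∀ y, eval y D ≠ 0 → T y = 0 := by
  classical
  intro y hy
  set U : Set (Fin 2 → ℂ) := {y | eval y D ≠ 0} with hUdef
  have hU : IsOpen U := isOpen_ne_fun (eval_continuous D) continuous_const
  have hTc : ContinuousOn T U := fun y hy => (hT y hy).continuousAt.continuousWithinAt
  set T' : (Fin 2 → ℂ) → ℂ := U.piecewise T (fun _ => 0) with hT'
  have hTm : Measurable T' := hTc.measurable_piecewise continuousOn_const hU.measurableSet
  set F : (Fin 2 → ℂ) → ENNReal := fun y => ENNReal.ofReal (‖T' y‖ ^ 2) with hFdef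
  have hFm : Measurable F := (hTm.norm.pow_const 2).ennreal_ofReal
  have hF : ∫⁻ y, F y < ⊤ := by
    have : F = U.indicator (fun y => ENNReal.ofReal (‖T y‖ ^ 2)) := by
      ext y
      by_cases h : y ∈ U
      · simp [hFdef, hT', h]
      · simp [hFdef, hT', h]
    rw [this, lintegral_indicator hU.measurableSet]
    exact hint
  have hmp := volume_preserving_finTwoArrow ℂ
  have hF2 : ∫⁻ p : ℂ × ℂ, F ![p.1, p.2] < ⊤ := by
    have := hmp.symm.lintegral_comp hFm
    rw [← this] at hF
    exact hF
  have hFm2 : Measurable (fun p : ℂ × ℂ => F ![p.1, p.2]) := hFm.comp (MeasurableEquiv.finTwoArrow (α := ℂ)).symm.measurable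
  rw [MeasureTheory.Measure.volume_eq_prod, lintegral_prod _ hFm2.aemeasurable] at hF2
  have hae : ∀ᵐ u : ℂ, ∫⁻ v, F ![u, v] < ⊤ := ae_lt_top hFm2.lintegral_prod_right' hF2.ne
  have hfin : ∀ᵐ u : ℂ, eval ![u, y 1] D ≠ 0 := by
    let p : Polynomial ℂ := aeval ![Polynomial.X, Polynomial.C (y 1)] D
    have hp : ∀ u, p.eval u = eval ![u, y 1] D := by
      intro u; rw [poly_slice]; congr 2; ext i; fin_cases i <;> simp
    have hyy : ![y 0, y 1] = y := by ext i; fin_cases i <;> rfl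
    have hp0 : p ≠ 0 := by
      intro h
      have := hp (y 0)
      rw [h, hyy] at this; exact hy (by simpa using this.symm)
    have : (p.roots.toFinset : Set ℂ).Finite := Finset.finite_toSet _
    have h0 := this.measure_zero volume
    rw [measure_eq_zero_iff_ae_notMem] at h0
    filter_upwards [h0] with u hu h
    apply hu
    simp [hp0, hp, h]
  have hgood : ∀ᵐ u : ℂ, T' ![u, y 1] = 0 := by
    filter_upwards [hae, hfin] with u hu1 hu2
    let p : Polynomial ℂ := aeval ![Polynomial.C u, Polynomial.X] D
    have hp : ∀ v, p.eval v = eval ![u, v] D := by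
      intro v; rw [poly_slice]; congr 2; ext i; fin_cases i <;> simp
    have hp0 : p ≠ 0 := by
      intro h
      have := hp (y 1)
      rw [h] at this; exact hu2 (by simpa using this.symm)
    refine l2_remove p.roots.toFinset (fun v => T' ![u, v]) ?_ hu1 (y 1) (by simp [hp0, hp, hu2])
    intro v hv
    have hv' : ![u, v] ∈ U := by
      simp [hp0, hp] at hv; exact hv
    have h1 : DifferentiableAt ℂ (fun v : ℂ => (![u, v] : Fin 2 → ℂ)) v := by
      rw [differentiableAt_pi]
      intro i; fin_cases i
      · exact differentiableAt_const _
      · exact differentiableAt_id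
    have h2 : DifferentiableAt ℂ T' ![u, v] := by
      refine (hT _ hv').congr_of_eventuallyEq ?_
      filter_upwards [hU.mem_nhds hv'] with z hz
      simp [hT', hz]
    exact (DifferentiableAt.comp v h2 h1).differentiableWithinAt
  have hdense := Measure.dense_of_ae hgood
  have hyy : ![y 0, y 1] = y := by ext i; fin_cases i <;> rfl
  have hTy : T' y = T y := by simp [hT', show y ∈ U from hy]
  rw [← hTy]
  by_contra hne
  have hcont : ContinuousAt T' y := by
    refine (hT _ hy).continuousAt.congr ?_
    filter_upwards [hU.mem_nhds hy] with z hz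
    simp [hT', hz]
  have hc1 : ContinuousAt (fun u : ℂ => T' ![u, y 1]) (y 0) := by
    have h1 : ContinuousAt (fun u : ℂ => (![u, y 1] : Fin 2 → ℂ)) (y 0) := by
      rw [continuousAt_pi]
      intro i; fin_cases i
      · exact continuousAt_id
      · exact continuousAt_const
    exact ContinuousAt.comp (g := T') (by rw [hyy]; exact hcont) h1
  have : ∀ᶠ u in 𝓝 (y 0), T' ![u, y 1] ≠ 0 := hc1.eventually_ne (by rw [hyy]; exact hne)
  obtain ⟨u, hu1, hu2⟩ := hdense.inter_nhds_nonempty this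
  exact hu2 hu1

theorem det_Jac_diff {n : ℕ} (P : Fin n → MvPolynomial (Fin n) ℂ) (v : Fin n → ℂ) :
    DifferentiableAt ℂ (fun v => (Jac P v).det) v := by
  have : (fun v => (Jac P v).det) = fun v => eval v (Matrix.det (Matrix.of fun i j => pderiv j (P i))) := by
    ext v
    rw [RingHom.map_det]
    rfl
  rw [this]
  exact (eval_hasStrict _ v).hasFDerivAt.differentiableAt

open Topology Filter Set MeasureTheory in
theorem trace_zero {q₁ q₂ g : MvPolynomial (Fin 6) ℂ} {d n : ℕ} (hd : 2 ≤ d)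
    (h₁ : q₁.IsHomogeneous 2) (h₂ : q₂.IsHomogeneous 2) (hg : g.IsHomogeneous d)
    (hX : IsSmoothCI3 q₁ q₂ g) (φ : RatMapTo (Fin 6) 2) (he : 0 < φ.e) (D : MvPolynomial (Fin 2) ℂ)
    (hF : ∀ y, eval y D ≠ 0 → (Fhat q₁ q₂ g φ y).Finite ∧ (Fhat q₁ q₂ g φ y).ncard = n ∧
      ∀ w ∈ Fhat q₁ q₂ g φ y, (Jac (sysPhi q₁ q₂ g φ) w).det ≠ 0)
    (P : MvPolynomial (Fin 6) ℂ) (hP : P.IsHomogeneous (d - 2)) (y : Fin 2 → ℂ) (hy : eval y D ≠ 0) :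
    ∑ᶠ w ∈ Fhat q₁ q₂ g φ y, eval w P / (Jac (sysPhi q₁ q₂ g φ) w).det = 0 := by
  have hU : IsOpen {y | eval y D ≠ 0} := isOpen_ne_fun (eval_continuous D) continuous_const
  refine l2_zero2 D (fun y => ∑ᶠ w ∈ Fhat q₁ q₂ g φ y, eval w P / (Jac (sysPhi q₁ q₂ g φ) w).det) ?_
    (trace_l2 hd h₁ h₂ hg hX φ he hU hF P hP) y hy
  intro y hy
  obtain ⟨B, s, hB, hyB, hBU, hs⟩ := local_sections hU hF y hy
  have hev : (fun y => ∑ᶠ w ∈ Fhat q₁ q₂ g φ y, eval w P / (Jac (sysPhi q₁ q₂ g φ) w).det) =ᶠ[𝓝 y]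
      fun y => ∑ i, eval (s i y) P / (Jac (sysPhi q₁ q₂ g φ) (s i y)).det := by
    filter_upwards [hB.mem_nhds hyB] with z hz
    rw [(hs z hz).1, finsum_mem_range (hs z hz).2.1, finsum_eq_sum_of_fintype]
  refine DifferentiableAt.congr_of_eventuallyEq ?_ hev
  refine DifferentiableAt.fun_sum fun i _ => ?_
  have hsd := (hs y hyB).2.2 i
  have a1 : DifferentiableAt ℂ (fun y => eval (s i y) P) y :=
    DifferentiableAt.comp (g := fun v => eval v P) y (eval_hasStrict _ _).hasFDerivAt.differentiableAt hsd
  have a2 : DifferentiableAt ℂ (fun y => (Jac (sysPhi q₁ q₂ g φ) (s i y)).det) y :=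
    DifferentiableAt.comp (g := fun v => (Jac (sysPhi q₁ q₂ g φ) v).det) y (det_Jac_diff _ _) hsd
  have a3 : (Jac (sysPhi q₁ q₂ g φ) (s i y)).det ≠ 0 :=
    (hF y hy).2.2 _ (by rw [(hs y hyB).1]; exact Set.mem_range_self i)
  simp only [div_eq_mul_inv]
  exact (a1.mul (a2.inv a3) :)

theorem sysPhi_det_hom {q₁ q₂ g : MvPolynomial (Fin 6) ℂ} {d : ℕ} (hd : 2 ≤ d)
    (h₁ : q₁.IsHomogeneous 2) (h₂ : q₂.IsHomogeneous 2) (hg : g.IsHomogeneous d)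
    (φ : RatMapTo (Fin 6) 2) (he : 0 < φ.e) (ζ : ℂ) (hζ : ζ ^ φ.e = 1) (w : Fin 6 → ℂ) :
    (Jac (sysPhi q₁ q₂ g φ) (ζ • w)).det = ζ ^ (d - 2) * (Jac (sysPhi q₁ q₂ g φ) w).det := by
  rw [Jac_det_hom _ ![2, 2, d, φ.e, φ.e, φ.e]]
  · congr 1
    have : ∏ i, ζ ^ ((![2, 2, d, φ.e, φ.e, φ.e] : Fin 6 → ℕ) i - 1) = ζ ^ (d - 2) * (ζ ^ φ.e) ^ 3 := by
      simp only [Fin.prod_univ_succ]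
      simp
      rw [← pow_mul]
      simp only [← pow_add, ← pow_succ']
      congr 1
      omega
    rw [this, hζ]; simp
  · intro i
    fin_cases i
    exacts [h₁, h₂, hg, φ.homog 0, φ.homog 1, φ.homog 2]

theorem fiber_cb {q₁ q₂ g : MvPolynomial (Fin 6) ℂ} {d n : ℕ} (hd : 2 ≤ d)
    (h₁ : q₁.IsHomogeneous 2) (h₂ : q₂.IsHomogeneous 2) (hg : g.IsHomogeneous d)
    (hX : IsSmoothCI3 q₁ q₂ g) (φ : RatMapTo (Fin 6) 2) (he : 0 < φ.e) (D : MvPolynomial (Fin 2) ℂ)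
    (hF : ∀ y, eval y D ≠ 0 → (Fhat q₁ q₂ g φ y).Finite ∧ (Fhat q₁ q₂ g φ y).ncard = n ∧
      ∀ w ∈ Fhat q₁ q₂ g φ y, (Jac (sysPhi q₁ q₂ g φ) w).det ≠ 0)
    (P : MvPolynomial (Fin 6) ℂ) (hP : P.IsHomogeneous (d - 2)) (y : Fin 2 → ℂ) (hy : eval y D ≠ 0)
    (x : PPt (Fin 6)) (hx : x ∈ φ.fiber (ZeroSet q₁ ∩ ZeroSet q₂ ∩ ZeroSet g) (ptY y))
    (hv : ∀ x' ∈ φ.fiber (ZeroSet q₁ ∩ ZeroSet q₂ ∩ ZeroSet g) (ptY y), x' ≠ x → PVanish P x') : PVanish P x := by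
  classical
  obtain ⟨w₀, hw₀0, hw₀, rfl⟩ := Fhat_rep h₁ h₂ hg he x hx
  rw [pvanish_iff hP]
  by_contra hne
  obtain ⟨hfin, -, hJ⟩ := hF y hy
  have hz := trace_zero hd h₁ h₂ hg hX φ he D hF P hP y hy
  rw [finsum_mem_eq_finite_toFinset_sum _ hfin] at hz
  have hterm : ∀ w ∈ hfin.toFinset, eval w P / (Jac (sysPhi q₁ q₂ g φ) w).det =
      if (∃ ζ : ℂ, ζ ^ φ.e = 1 ∧ w = ζ • w₀) then eval w₀ P / (Jac (sysPhi q₁ q₂ g φ) w₀).det else 0 := by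
    intro w hw
    rw [Set.Finite.mem_toFinset] at hw
    split_ifs with h
    · obtain ⟨ζ, hζ, rfl⟩ := h
      have hζ0 : ζ ≠ 0 := by rintro rfl; rw [zero_pow he.ne'] at hζ; exact zero_ne_one hζ
      rw [sysPhi_det_hom hd h₁ h₂ hg φ he ζ hζ, eval_hom hP]
      exact mul_div_mul_left _ _ (pow_ne_zero _ hζ0)
    · have hw0 := Fhat_ne_zero he hw
      have := hv _ (Fhat_mem_fiber h₁ h₂ hg hw hw0) (by
        intro heq
        rw [Projectivization.mk_eq_mk_iff'] at heq
        obtain ⟨t, ht⟩ := heq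
        exact h ⟨t, (Fhat_same hw₀ (by rw [ht]; exact hw)).1, ht.symm⟩)
      rw [pvanish_iff hP] at this
      rw [this, zero_div]
  rw [Finset.sum_congr rfl hterm, ← Finset.sum_filter, Finset.sum_const, smul_eq_zero] at hz
  rcases hz with hz | hz
  · rw [Finset.card_eq_zero, Finset.filter_eq_empty_iff] at hz
    exact hz (x := w₀) (by simpa using hw₀) ⟨1, by simp⟩
  · exact div_ne_zero hne (hJ _ hw₀) hz

theorem hom0_const {n : ℕ} {p : MvPolynomial (Fin n) ℂ} (hp : p.IsHomogeneous 0) (v : Fin n → ℂ) : eval v p = eval 0 p := by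
  have := eval_hom hp 0 v
  simpa using this.symm

theorem hom1_add {n : ℕ} {p : MvPolynomial (Fin n) ℂ} (hp : p.IsHomogeneous 1) (v w : Fin n → ℂ) :
    eval (v + w) p = eval v p + eval w p := by
  have h : ∀ v, eval v p = ∑ i, eval 0 (pderiv i p) * v i := by
    intro v
    have := euler_gradL hp v
    rw [gradL_apply] at this
    simp only [Nat.cast_one, one_mul] at this
    rw [← this]
    refine Finset.sum_congr rfl fun i _ => ?_
    rw [hom0_const (pderiv_hom hp i) v]
  rw [h, h, h, ← Finset.sum_add_distrib]
  exact Finset.sum_congr rfl fun i _ => by simp [mul_add]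

theorem gradL_add_left {n : ℕ} {f : MvPolynomial (Fin n) ℂ} (hf : f.IsHomogeneous 2) (v w x : Fin n → ℂ) :
    gradL f (v + w) x = gradL f v x + gradL f w x := by
  simp only [gradL_apply, ← Finset.sum_add_distrib]
  exact Finset.sum_congr rfl fun i _ => by rw [hom1_add (pderiv_hom hf i)]; ring

theorem gradL_smul_left {n : ℕ} {f : MvPolynomial (Fin n) ℂ} (hf : f.IsHomogeneous 2) (c : ℂ) (v x : Fin n → ℂ) :
    gradL f (c • v) x = c * gradL f v x := by
  rw [gradL_hom hf]; simp

theorem quad_add {n : ℕ} {f : MvPolynomial (Fin n) ℂ} (hf : f.IsHomogeneous 2) (v w : Fin n → ℂ) :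
    eval (v + w) f = eval v f + eval w f + gradL f v w := by
  let h : ℂ → ℂ := fun t => eval (v + t • w) f - (t * gradL f v w + t ^ 2 * eval w f)
  have hd : ∀ t, HasDerivAt h 0 t := by
    intro t
    have h1 : HasDerivAt (fun t : ℂ => v + t • w) w t := by
      have : HasDerivAt (fun t : ℂ => t • w) ((1 : ℂ) • w) t := (hasDerivAt_id t).smul_const w
      simpa using this.const_add v
    have h2 := (eval_hasStrict f (v + t • w)).hasFDerivAt.comp_hasDerivAt t h1
    have h3 : HasDerivAt (fun t : ℂ => t * gradL f v w + t ^ 2 * eval w f) (1 * gradL f v w + (2 * t) * eval w f) t := by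
      have a := (hasDerivAt_id t).mul_const (gradL f v w)
      have b := ((hasDerivAt_pow 2 t).mul_const (eval w f))
      have c := a.add b
      have e : (2 : ℕ) * t ^ (2 - 1) * eval w f = 2 * t * eval w f := by simp
      rw [e] at c
      exact c
    have h4 := h2.sub h3
    rw [gradL_add_left hf, gradL_smul_left hf, euler_gradL hf] at h4
    have : gradL f v w + t * ((2 : ℕ) * eval w f) - (1 * gradL f v w + 2 * t * eval w f) = 0 := by push_cast; ring
    rw [this] at h4
    exact h4
  have := is_const_of_deriv_eq_zero (f := h) (fun t => (hd t).differentiableAt) (fun t => (hd t).deriv) 1 0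
  simp [h] at this
  linear_combination this

theorem gradL_symm {n : ℕ} {f : MvPolynomial (Fin n) ℂ} (hf : f.IsHomogeneous 2) (v w : Fin n → ℂ) :
    gradL f v w = gradL f w v := by
  have h1 := quad_add hf v w
  have h2 := quad_add hf w v
  rw [add_comm w v] at h2
  linear_combination h2 - h1

theorem quad3 {n : ℕ} {f : MvPolynomial (Fin n) ℂ} (hf : f.IsHomogeneous 2) (u v w : Fin n → ℂ) (x y z : ℂ) :
    eval (x • u + y • v + z • w) f = x ^ 2 * eval u f + y ^ 2 * eval v f + z ^ 2 * eval w f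
      + x * y * gradL f u v + x * z * gradL f u w + y * z * gradL f v w := by
  rw [quad_add hf, quad_add hf, gradL_add_left hf, gradL_smul_left hf, gradL_smul_left hf, eval_hom hf, eval_hom hf, eval_hom hf]
  simp only [map_smul, smul_eq_mul, gradL_smul_left hf]
  ring

theorem span3_mem {V : Type*} [AddCommGroup V] [Module ℂ V] {W : Submodule ℂ V} (hW : Module.finrank ℂ W = 3)
    {u v w : V} (hu : u ∈ W) (hv : v ∈ W) (hw : w ∈ W) (hl : LinearIndependent ℂ ![u, v, w]) :
    Submodule.span ℂ {u, v, w} = W ∧ ∀ x ∈ W, ∃ a b c : ℂ, x = a • u + b • v + c • w := by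
  have hfd : FiniteDimensional ℂ W := Module.finite_of_finrank_pos (by omega)
  have h1 : Submodule.span ℂ {u, v, w} ≤ W := by
    rw [Submodule.span_le]; rintro x (rfl | rfl | rfl) <;> assumption
  have h2 : Module.finrank ℂ (Submodule.span ℂ {u, v, w}) = 3 := by
    have := finrank_span_eq_card hl
    have e : Set.range ![u, v, w] = {u, v, w} := by ext; simp [eq_comm]; tauto
    rw [e] at this
    simpa using this
  have h3 := Submodule.eq_of_le_of_finrank_eq h1 (by rw [h2, hW])
  refine ⟨h3, fun x hx => ?_⟩
  rw [← h3, Submodule.mem_span_triple] at hx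
  obtain ⟨a, b, c, h⟩ := hx
  exact ⟨a, b, c, h.symm⟩

theorem indep3_of {V : Type*} [AddCommGroup V] [Module ℂ V] {u v w : V} (h : LinearIndependent ℂ ![u, v])
    (hw : ∀ a b : ℂ, w ≠ a • u + b • v) : LinearIndependent ℂ ![u, v, w] := by
  rw [LinearIndependent.pair_iff] at h
  rw [Fintype.linearIndependent_iff]
  intro c hc
  simp [Fin.sum_univ_three] at hc
  by_cases h2 : c 2 = 0
  · rw [h2, zero_smul, add_zero] at hc
    obtain ⟨h0, h1⟩ := h _ _ hc
    intro i; fin_cases i <;> simp [h0, h1, h2]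
  · exfalso
    apply hw (-(c 2)⁻¹ * c 0) (-(c 2)⁻¹ * c 1)
    have : w = -(c 2)⁻¹ • (c 0 • u + c 1 • v) := by
      have : c 0 • u + c 1 • v = - (c 2 • w) := eq_neg_of_add_eq_zero_left hc
      rw [this, smul_neg, neg_smul, neg_neg, smul_smul, inv_mul_cancel₀ h2, one_smul]
    rw [this, smul_add, smul_smul, smul_smul]

theorem conic_pair {W : Submodule ℂ (Fin 6 → ℂ)} (hW : Module.finrank ℂ W = 3) {f : MvPolynomial (Fin 6) ℂ}
    (hf : f.IsHomogeneous 2) 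
    (hs : ∀ v ∈ W, v ≠ 0 → eval v f = 0 → ∃ w ∈ W, (∑ i, eval v (pderiv i f) * w i) ≠ 0)
    {u v : Fin 6 → ℂ} (hu : u ∈ W) (hv : v ∈ W) (hl : LinearIndependent ℂ ![u, v])
    (fu : eval u f = 0) (fv : eval v f = 0) : gradL f u v ≠ 0 := by
  intro h0
  have h2 : Module.finrank ℂ (Submodule.span ℂ {u, v}) = 2 := by
    have := finrank_span_eq_card hl
    have e : Set.range ![u, v] = {u, v} := by ext; simp [eq_comm]; tauto
    rw [e] at this
    simpa using this
  obtain ⟨w, hw, hwn⟩ : ∃ w ∈ W, w ∉ Submodule.span ℂ {u, v} := by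
    by_contra hc
    push Not at hc
    have := Submodule.finrank_mono (show W ≤ _ from hc)
    omega
  have hl3 : LinearIndependent ℂ ![u, v, w] := by
    apply indep3_of hl
    intro a b e
    apply hwn
    rw [e]
    exact Submodule.mem_span_pair.2 ⟨a, b, rfl⟩
  obtain ⟨-, hsp⟩ := span3_mem hW hu hv hw hl3
  have key : ∀ p q : ℂ, p * gradL f u w + q * gradL f v w = 0 → p = 0 ∧ q = 0 := by
    intro p q hpq
    by_contra hne
    have hx0 : p • u + q • v ≠ 0 := fun h => hne (LinearIndependent.pair_iff.1 hl p q h)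
    obtain ⟨z, hz, hz0⟩ := hs (p • u + q • v) (W.add_mem (W.smul_mem _ hu) (W.smul_mem _ hv)) hx0 (by
      have := quad3 hf u v 0 p q 0
      simp [fu, fv, h0] at this
      exact this)
    apply hz0
    rw [← gradL_apply]
    obtain ⟨a, b, c, rfl⟩ := hsp z hz
    rw [gradL_add_left hf, gradL_smul_left hf, gradL_smul_left hf]
    simp only [map_add, map_smul, smul_eq_mul]
    rw [gradL_symm hf v u, h0, euler_gradL hf, euler_gradL hf, fu, fv]
    linear_combination c * hpq
  obtain ⟨h3, h4⟩ := key (gradL f v w) (- gradL f u w) (by ring)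
  have := key 1 0 (by rw [neg_eq_zero.1 h4]; ring)
  simp at this

theorem conic_indep {W : Submodule ℂ (Fin 6 → ℂ)} (hW : Module.finrank ℂ W = 3) {f : MvPolynomial (Fin 6) ℂ}
    (hf : f.IsHomogeneous 2) 
    (hs : ∀ v ∈ W, v ≠ 0 → eval v f = 0 → ∃ w ∈ W, (∑ i, eval v (pderiv i f) * w i) ≠ 0)
    {u v w : Fin 6 → ℂ} (hu : u ∈ W) (hv : v ∈ W) (hw : w ∈ W) (hl : LinearIndependent ℂ ![u, v])
    (hl1 : LinearIndependent ℂ ![u, w]) (hl2 : LinearIndependent ℂ ![v, w])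
    (fu : eval u f = 0) (fv : eval v f = 0) (fw : eval w f = 0) : LinearIndependent ℂ ![u, v, w] := by
  apply indep3_of hl
  rintro a b rfl
  have h1 := quad3 hf u v 0 a b 0
  simp [fu, fv] at h1
  rw [fw] at h1
  have h2 := conic_pair hW hf hs hu hv hl fu fv
  rcases (by simpa [h2] using h1.symm : a = 0 ∨ b = 0) with rfl | rfl
  · have := LinearIndependent.pair_iff.1 hl2 b (-1) (by simp)
    simp at this
  · have := LinearIndependent.pair_iff.1 hl1 a (-1) (by simp)
    simp at this

/-- forms avoiding a vector and vanishing on finitely many subspaces -/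
theorem avoid_form (T : Finset (Submodule ℂ (Fin 6 → ℂ))) (w : Fin 6 → ℂ) (hw0 : w ≠ 0) :
    ∀ m, T.card ≤ m → (∀ L ∈ T, w ∉ L) →
    ∃ P : MvPolynomial (Fin 6) ℂ, P.IsHomogeneous m ∧ eval w P ≠ 0 ∧ ∀ L ∈ T, ∀ v ∈ L, eval v P = 0 := by
  classical
  have one : ∀ L : Submodule ℂ (Fin 6 → ℂ), w ∉ L → ∃ P : MvPolynomial (Fin 6) ℂ, P.IsHomogeneous 1 ∧ eval w P ≠ 0 ∧ ∀ v ∈ L, eval v P = 0 := by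
    intro L hL
    obtain ⟨f, hf, hk⟩ := Submodule.exists_le_ker_of_notMem hL
    have e : ∀ v, eval v (linP fun i => f (Pi.single i 1)) = f v := by
      intro v
      rw [eval_linP]
      conv_rhs => rw [← Finset.univ_sum_single v, map_sum]
      refine Finset.sum_congr rfl fun i _ => ?_
      have : (Pi.single i (v i) : Fin 6 → ℂ) = v i • Pi.single i 1 := by
        rw [← Pi.single_smul]; simp
      rw [this, map_smul, smul_eq_mul, mul_comm]
    refine ⟨linP fun i => f (Pi.single i 1), linP_hom _, ?_, ?_⟩
    · rw [e]; exact hf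
    · intro v hv; rw [e]; exact hk hv
  induction T using Finset.induction_on with
  | empty =>
    intro m _ _
    obtain ⟨P, hP, hw, -⟩ := one ⊥ (by simpa using hw0)
    refine ⟨P ^ m, by simpa using hP.pow m, by simpa using pow_ne_zero m hw, by simp⟩
  | insert L T hLT ih =>
    intro m hm hL
    rw [Finset.card_insert_of_notMem hLT] at hm
    obtain ⟨P, hP, hw, hv⟩ := ih (m - 1) (by omega) (fun L' h => hL L' (Finset.mem_insert_of_mem h))
    obtain ⟨P1, hP1, hw1, hv1⟩ := one L (hL L (Finset.mem_insert_self _ _))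
    refine ⟨P1 * P, ?_, ?_, ?_⟩
    · have := hP1.mul hP
      rwa [show 1 + (m - 1) = m by omega] at this
    · simp [hw, hw1]
    · intro L' hL' v hvL
      rcases Finset.mem_insert.1 hL' with rfl | h
      · simp [hv1 v hvL]
      · simp [hv L' h v hvL]

theorem pair_indep_of_mk_ne {v w : Fin 6 → ℂ} (hv : v ≠ 0) (hw : w ≠ 0)
    (h : Projectivization.mk ℂ v hv ≠ Projectivization.mk ℂ w hw) : LinearIndependent ℂ ![v, w] := by
  rw [LinearIndependent.pair_iff]
  intro s t hst
  by_cases hs : s = 0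
  · subst hs
    simpa [hw] using hst
  · exfalso
    apply h
    have ht : t ≠ 0 := by
      rintro rfl
      simp [hs, hv] at hst
    rw [Projectivization.mk_eq_mk_iff']
    refine ⟨-(s⁻¹ * t), ?_⟩
    have : s • v = -(t • w) := eq_neg_of_add_eq_zero_left hst
    rw [neg_smul, mul_smul, ← smul_neg, ← this, smul_smul, inv_mul_cancel₀ hs, one_smul]

theorem mk_ne_of_pair {v w : Fin 6 → ℂ} (hv : v ≠ 0) (hw : w ≠ 0)
    (h : LinearIndependent ℂ ![v, w]) : Projectivization.mk ℂ v hv ≠ Projectivization.mk ℂ w hw := by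
  intro he
  rw [Projectivization.mk_eq_mk_iff'] at he
  obtain ⟨a, ha⟩ := he
  have := LinearIndependent.pair_iff.1 h 1 (-a) (by rw [← ha]; simp)
  simp at this

theorem fiber_ge {q₁ q₂ g : MvPolynomial (Fin 6) ℂ} {d n δ : ℕ} (hd : 4 ≤ d)
    (h₁ : q₁.IsHomogeneous 2) (h₂ : q₂.IsHomogeneous 2) (hg : g.IsHomogeneous d)
    (hX : IsSmoothCI3 q₁ q₂ g) (φ : RatMapTo (Fin 6) 2) (he : 0 < φ.e) (D : MvPolynomial (Fin 2) ℂ)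
    (hF : ∀ y, eval y D ≠ 0 → (Fhat q₁ q₂ g φ y).Finite ∧ (Fhat q₁ q₂ g φ y).ncard = n ∧
      ∀ w ∈ Fhat q₁ q₂ g φ y, (Jac (sysPhi q₁ q₂ g φ) w).det ≠ 0)
    (y : Fin 2 → ℂ) (hy : eval y D ≠ 0) 
    (hfin : (φ.fiber (ZeroSet q₁ ∩ ZeroSet q₂ ∩ ZeroSet g) (ptY y)).Finite)
    (hcard : (φ.fiber (ZeroSet q₁ ∩ ZeroSet q₂ ∩ ZeroSet g) (ptY y)).ncard = δ) (hδ : 0 < δ)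
    {W : Submodule ℂ (Fin 6 → ℂ)} {C : Set (PPt (Fin 6))} (hC : IsConicIn W C)
    (hsub : φ.fiber (ZeroSet q₁ ∩ ZeroSet q₂ ∩ ZeroSet g) (ptY y) ⊆ C) : d + 1 ≤ δ := by
  classical
  by_contra hlt
  obtain ⟨hW, f, hf, rfl, -, hs⟩ := hC
  set S := hfin.toFinset with hS
  have hSc : S.card = δ := by rw [← hcard, Set.ncard_eq_toFinset_card _ hfin]
  obtain ⟨x, hx⟩ : S.Nonempty := Finset.card_pos.1 (by omega)
  have memS : ∀ z, z ∈ S ↔ z ∈ φ.fiber (ZeroSet q₁ ∩ ZeroSet q₂ ∩ ZeroSet g) (ptY y) := by simp [hS]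
  have rW : ∀ z ∈ S, z.rep ∈ W := by
    intro z hz
    apply (hsub ((memS z).1 hz)).1
    rw [Projectivization.submodule_eq]
    exact Submodule.mem_span_singleton_self _
  have rf : ∀ z ∈ S, eval z.rep f = 0 := by
    intro z hz
    exact (hsub ((memS z).1 hz)).2 z.rep z.rep_nonzero (Projectivization.mk_rep z)
  have rp : ∀ z w : PPt (Fin 6), z ≠ w → LinearIndependent ℂ ![z.rep, w.rep] := by
    intro z w hzw
    apply pair_indep_of_mk_ne z.rep_nonzero w.rep_nonzero
    rwa [Projectivization.mk_rep, Projectivization.mk_rep]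
  have r1 : ∀ z, z ≠ x → x.rep ∉ z.submodule := by
    intro z hz hm
    rw [Projectivization.submodule_eq, Submodule.mem_span_singleton] at hm
    obtain ⟨a, ha⟩ := hm
    have := LinearIndependent.pair_iff.1 (rp z x hz) a (-1) (by rw [← ha]; simp)
    simp at this
  -- the general step
  have step : ∀ T : Finset (Submodule ℂ (Fin 6 → ℂ)), T.card ≤ d - 2 → (∀ L ∈ T, x.rep ∉ L) →
      (∀ z ∈ S, z ≠ x → ∃ L ∈ T, z.rep ∈ L) → False := by
    intro T hT hL hz
    obtain ⟨P, hP, hw, hv⟩ := avoid_form T x.rep x.rep_nonzero (d - 2) hT hL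
    have := fiber_cb (by omega) h₁ h₂ hg hX φ he D hF P hP y hy x ((memS x).1 hx) (by
      intro x' hx' hne
      obtain ⟨L, hL, hm⟩ := hz x' ((memS x').2 hx') hne
      rw [← Projectivization.mk_rep x', pvanish_iff hP]
      exact hv L hL _ hm)
    exact hw (this _ x.rep_nonzero (Projectivization.mk_rep x))
  by_cases hc : (S.erase x).card ≤ 1
  · refine step ((S.erase x).image fun z => z.submodule) (Finset.card_image_le.trans (by omega)) ?_ ?_
    · intro L hL
      obtain ⟨z, hz, rfl⟩ := Finset.mem_image.1 hL
      exact r1 z (Finset.ne_of_mem_erase hz)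
    · intro z hz hzx
      refine ⟨z.submodule, Finset.mem_image_of_mem _ (Finset.mem_erase.2 ⟨hzx, hz⟩), ?_⟩
      rw [Projectivization.submodule_eq]
      exact Submodule.mem_span_singleton_self _
  · obtain ⟨a, b, ha, hb, hab⟩ := Finset.one_lt_card_iff.1 (not_le.1 hc)
    have ha' := Finset.mem_erase.1 ha
    have hb' := Finset.mem_erase.1 hb
    refine step (insert (Submodule.span ℂ {a.rep, b.rep}) ((((S.erase x).erase a).erase b).image fun z => z.submodule)) ?_ ?_ ?_
    · refine (Finset.card_insert_le _ _).trans ?_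
      have := Finset.card_image_le (s := (((S.erase x).erase a).erase b)) (f := fun z : PPt (Fin 6) => z.submodule)
      rw [Finset.card_erase_of_mem (Finset.mem_erase.2 ⟨hab.symm, hb⟩), Finset.card_erase_of_mem ha, Finset.card_erase_of_mem hx] at this
      omega
    · intro L hL
      rcases Finset.mem_insert.1 hL with rfl | hL
      · intro hm
        obtain ⟨p, q, hpq⟩ := Submodule.mem_span_pair.1 hm
        have := conic_indep hW hf hs (rW a ha'.2) (rW b hb'.2) (rW x hx) (rp a b hab) (rp a x ha'.1) (rp b x hb'.1)
          (rf a ha'.2) (rf b hb'.2) (rf x hx)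
        have := (Fintype.linearIndependent_iff.1 this) ![p, q, -1] (by
          simp [Fin.sum_univ_three, hpq]) 2
        simp at this
      · obtain ⟨z, hz, rfl⟩ := Finset.mem_image.1 hL
        exact r1 z (Finset.ne_of_mem_erase (Finset.mem_of_mem_erase (Finset.mem_of_mem_erase hz)))
    · intro z hz hzx
      by_cases hza : z = a
      · exact ⟨_, Finset.mem_insert_self _ _, Submodule.subset_span (by simp [hza])⟩
      by_cases hzb : z = b
      · exact ⟨_, Finset.mem_insert_self _ _, Submodule.subset_span (by simp [hzb])⟩
      refine ⟨z.submodule, Finset.mem_insert_of_mem (Finset.mem_image_of_mem _ ?_), ?_⟩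
      · simp [hza, hzb, hzx, hz]
      rw [Projectivization.submodule_eq]
      exact Submodule.mem_span_singleton_self _

noncomputable def bilQ {f : MvPolynomial (Fin 6) ℂ} (hf : f.IsHomogeneous 2) : (Fin 6 → ℂ) →ₗ[ℂ] Module.Dual ℂ (Fin 6 → ℂ) where
  toFun v := (gradL f v : (Fin 6 → ℂ) →ₗ[ℂ] ℂ)
  map_add' v w := by ext x; simp [gradL_add_left hf]
  map_smul' c v := by ext x; simp [gradL_smul_left hf]

theorem bilQ_apply {f : MvPolynomial (Fin 6) ℂ} (hf : f.IsHomogeneous 2) (v w : Fin 6 → ℂ) : bilQ hf v w = gradL f v w := rfl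

theorem no_plane {q₁ q₂ : MvPolynomial (Fin 6) ℂ}
    (h₁ : q₁.IsHomogeneous 2) (h₂ : q₂.IsHomogeneous 2) (hZ : IsSmoothCI2 q₁ q₂)
    {W : Submodule ℂ (Fin 6 → ℂ)} (hW : Module.finrank ℂ W = 3)
    (e₁ : ∀ v ∈ W, eval v q₁ = 0) (e₂ : ∀ v ∈ W, eval v q₂ = 0) : False := by
  have iso : ∀ {f : MvPolynomial (Fin 6) ℂ} (hf : f.IsHomogeneous 2), (∀ v ∈ W, eval v f = 0) →
      ∀ v : W, bilQ hf v ∈ W.dualAnnihilator := by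
    intro f hf h v
    rw [Submodule.mem_dualAnnihilator]
    intro w hw
    have := quad_add hf v w
    rw [h _ (W.add_mem v.2 hw), h _ v.2, h _ hw] at this
    rw [bilQ_apply]
    simpa using this.symm
  have hfr : Module.finrank ℂ W.dualAnnihilator = 3 := by
    have := Subspace.finrank_add_finrank_dualAnnihilator_eq W
    simp [hW] at this
    omega
  let L₁ : W →ₗ[ℂ] W.dualAnnihilator := ((bilQ h₁).comp W.subtype).codRestrict _ (iso h₁ e₁)
  let L₂ : W →ₗ[ℂ] W.dualAnnihilator := ((bilQ h₂).comp W.subtype).codRestrict _ (iso h₂ e₂)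
  have fin : ∀ v : W, v ≠ 0 → ∀ a b : ℂ, a • L₁ v + b • L₂ v = 0 → a = 0 ∧ b = 0 := by
    intro v hv a b hab
    apply hZ v (by simpa using hv) (e₁ _ v.2) (e₂ _ v.2)
    intro i
    have := congrArg (fun l : W.dualAnnihilator => (l : Module.Dual ℂ (Fin 6 → ℂ)) (Pi.single i 1)) hab
    rw [← gradL_single, ← gradL_single]
    exact this
  by_cases hi : Function.Injective L₂
  · let e := LinearEquiv.ofInjectiveOfFinrankEq L₂ hi (by rw [hW, hfr])
    have : Nontrivial W := Module.nontrivial_of_finrank_pos (R := ℂ) (by omega)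
    obtain ⟨μ, hμ⟩ := Module.End.exists_eigenvalue (e.symm.toLinearMap.comp L₁)
    obtain ⟨v, hv⟩ := hμ.exists_hasEigenvector
    have h1 := hv.apply_eq_smul
    have h2 : L₁ v = μ • L₂ v := by
      have := congrArg e h1
      simp at this
      rw [this]
      rfl
    have := fin v hv.2 1 (-μ) (by rw [h2, one_smul]; apply Subtype.ext; ext x; simp)
    simp at this
  · rw [← LinearMap.ker_eq_bot, Submodule.eq_bot_iff] at hi
    push Not at hi
    obtain ⟨v, hv, hv0⟩ := hi
    have := fin v hv0 0 1 (by simpa using hv)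
    simp at this

/-- parametrization of the conic through three points -/
noncomputable def gam (R : MvPolynomial (Fin 6) ℂ) (u v w : Fin 6 → ℂ) (s t : ℂ) : Fin 6 → ℂ :=
  (-(gradL R u v * t * (gradL R v w * s + gradL R u w * t))) • u +
  (-(gradL R u v * s * (gradL R v w * s + gradL R u w * t))) • v +
  (gradL R u v ^ 2 * s * t) • w

theorem gam_zero {R : MvPolynomial (Fin 6) ℂ} (hR : R.IsHomogeneous 2) {u v w : Fin 6 → ℂ}
    (eu : eval u R = 0) (ev : eval v R = 0) (ew : eval w R = 0) (s t : ℂ) : eval (gam R u v w s t) R = 0 := by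
  rw [gam, quad3 hR, eu, ev, ew]
  ring

theorem conic_R {q₁ q₂ Q R : MvPolynomial (Fin 6) ℂ}
    (h₁ : q₁.IsHomogeneous 2) (h₂ : q₂.IsHomogeneous 2) (hZ : IsSmoothCI2 q₁ q₂) (hR : R.IsHomogeneous 2)
    (hRQ : ∀ v, eval v Q = 0 → (eval v R = 0 ↔ eval v q₁ = 0 ∧ eval v q₂ = 0))
    {W : Submodule ℂ (Fin 6 → ℂ)} {C : Set (PPt (Fin 6))} (hC : IsConicIn W C)
    (hCZ : C ⊆ ZeroSet q₁ ∩ ZeroSet q₂) (hQ : ∀ v ∈ W, eval v Q = 0)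
    {u v w : Fin 6 → ℂ} (hu : u ≠ 0) (hv : v ≠ 0) (hw : w ≠ 0) (cu : Projectivization.mk ℂ u hu ∈ C)
    (cv : Projectivization.mk ℂ v hv ∈ C) (cw : Projectivization.mk ℂ w hw ∈ C)
    (i1 : LinearIndependent ℂ ![u, v]) (i2 : LinearIndependent ℂ ![u, w]) (i3 : LinearIndependent ℂ ![v, w]) :
    gradL R u v ≠ 0 ∧ gradL R u w ≠ 0 ∧ gradL R v w ≠ 0 ∧ LinearIndependent ℂ ![u, v, w] ∧ Submodule.span ℂ {u, v, w} = W := by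
  obtain ⟨hW, f, hf, rfl, -, hs⟩ := hC
  have cW : ∀ {x : Fin 6 → ℂ} (hx : x ≠ 0), Projectivization.mk ℂ x hx ∈ {x : PPt (Fin 6) | x.submodule ≤ W ∧ PVanish f x} ↔
      x ∈ W ∧ eval x f = 0 := by
    intro x hx
    change _ ∧ _ ↔ _
    rw [pvanish_iff hf, Projectivization.submodule_mk, Submodule.span_singleton_le_iff_mem]
  obtain ⟨uW, fu⟩ := (cW hu).1 cu
  obtain ⟨vW, fv⟩ := (cW hv).1 cv
  obtain ⟨wW, fw⟩ := (cW hw).1 cw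
  have A0 := conic_pair hW hf hs uW vW i1 fu fv
  have B0 := conic_pair hW hf hs uW wW i2 fu fw
  have C0 := conic_pair hW hf hs vW wW i3 fv fw
  have i4 := conic_indep hW hf hs uW vW wW i1 i2 i3 fu fv fw
  obtain ⟨hsp, hsp'⟩ := span3_mem hW uW vW wW i4
  have R0 : ∀ x ∈ W, eval x f = 0 → eval x R = 0 := by
    intro x hx hfx
    by_cases hx0 : x = 0
    · rw [hx0]; simpa using eval_hom hR 0 0
    · have := hCZ ((cW hx0).2 ⟨hx, hfx⟩)
      rw [hRQ x (hQ x hx)]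
      exact ⟨this.1 _ hx0 rfl, this.2 _ hx0 rfl⟩
  have eu := R0 u uW fu
  have ev := R0 v vW fv
  have ew := R0 w wW fw
  have gW : ∀ s t, gam f u v w s t ∈ W := fun s t =>
    W.add_mem (W.add_mem (W.smul_mem _ uW) (W.smul_mem _ vW)) (W.smul_mem _ wW)
  have E : ∀ s t : ℂ, _ := fun s t => R0 _ (gW s t) (gam_zero hf fu fv fw s t)
  simp only [gam, quad3 hR, eu, ev, ew] at E
  set A := gradL f u v
  set B := gradL f u w
  set G := gradL f v w
  set A' := gradL R u v
  set B' := gradL R u w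
  set G' := gradL R v w
  have E1 : 2 * B * G * A' = A * (G * B' + B * G') := by
    have := E B G
    have hk : A ^ 2 * B * G * (2 * B * G) ≠ 0 := by simp [A0, B0, C0]
    apply mul_left_cancel₀ hk
    linear_combination this
  have E2 : 3 * B * G * A' = A * (2 * G * B' + B * G') := by
    have := E B (2 * G)
    have hk : A ^ 2 * B * (2 * G) * (3 * B * G) ≠ 0 := by simp [A0, B0, C0]
    apply mul_left_cancel₀ hk
    linear_combination this
  have E3 : B * A' = A * B' := mul_left_cancel₀ C0 (by linear_combination E2 - E1)
  have E4 : G * A' = A * G' := mul_left_cancel₀ B0 (by linear_combination 2 * E1 - E2)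
  have A'0 : A' ≠ 0 := by
    intro h0
    have hB : B' = 0 := by simpa [h0, A0] using E3
    have hG : G' = 0 := by simpa [h0, A0] using E4
    have hR0 : ∀ x ∈ W, eval x R = 0 := by
      intro x hx
      obtain ⟨p, q, r, rfl⟩ := hsp' x hx
      rw [quad3 hR, eu, ev, ew]
      linear_combination p * q * h0 + p * r * hB + q * r * hG
    exact no_plane h₁ h₂ hZ hW (fun x hx => ((hRQ x (hQ x hx)).1 (hR0 x hx)).1) (fun x hx => ((hRQ x (hQ x hx)).1 (hR0 x hx)).2)
  refine ⟨A'0, ?_, ?_, i4, hsp⟩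
  · intro h; rw [h] at E3; simp [B0, A'0] at E3
  · intro h; rw [h] at E4; simp [C0, A'0] at E4

theorem natDegree_aeval_le {d n k : ℕ} {g : MvPolynomial (Fin n) ℂ} (hg : g.IsHomogeneous d) (f : Fin n → Polynomial ℂ)
    (hf : ∀ i, (f i).natDegree ≤ k) : (aeval f g).natDegree ≤ k * d := by
  rw [aeval_def, eval₂_eq']
  apply Polynomial.natDegree_sum_le_of_forall_le
  intro m hm
  have hdeg : ∑ i, m i = d := by
    have := hg (mem_support_iff.1 hm)
    rw [Finsupp.weight_apply, Finsupp.sum_fintype] at this <;> simp_all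
  refine (Polynomial.natDegree_C_mul_le _ _).trans ((Polynomial.natDegree_prod_le _ _).trans ?_)
  rw [← hdeg, Finset.mul_sum]
  refine Finset.sum_le_sum fun i _ => Polynomial.natDegree_pow_le.trans ?_
  rw [mul_comm]
  exact Nat.mul_le_mul_right _ (hf i)

theorem gam_hom (R : MvPolynomial (Fin 6) ℂ) (u v w : Fin 6 → ℂ) (c s t : ℂ) :
    gam R u v w (c * s) (c * t) = c ^ 2 • gam R u v w s t := by
  simp only [gam, smul_add, smul_smul]
  congr 1
  · congr 1 <;> · congr 1; ring
  · congr 1; ring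

/-- coefficient polynomials of the parametrization -/
noncomputable def gamP (R : MvPolynomial (Fin 6) ℂ) (u v w : Fin 6 → ℂ) (i : Fin 6) : Polynomial ℂ :=
  - (Polynomial.C (gradL R u v) * (Polynomial.C (gradL R v w) * Polynomial.X + Polynomial.C (gradL R u w))) * Polynomial.C (u i)
  - (Polynomial.C (gradL R u v) * Polynomial.X * (Polynomial.C (gradL R v w) * Polynomial.X + Polynomial.C (gradL R u w))) * Polynomial.C (v i)
  + Polynomial.C (gradL R u v ^ 2) * Polynomial.X * Polynomial.C (w i)

theorem gamP_eval (R : MvPolynomial (Fin 6) ℂ) (u v w : Fin 6 → ℂ) (i : Fin 6) (s : ℂ) :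
    (gamP R u v w i).eval s = gam R u v w s 1 i := by
  simp [gamP, gam]
  ring

theorem gamP_deg (R : MvPolynomial (Fin 6) ℂ) (u v w : Fin 6 → ℂ) (i : Fin 6) : (gamP R u v w i).natDegree ≤ 2 := by
  unfold gamP
  compute_degree

theorem gam_cover {R : MvPolynomial (Fin 6) ℂ} (hR : R.IsHomogeneous 2) {u v w : Fin 6 → ℂ}
    (eu : eval u R = 0) (ev : eval v R = 0) (ew : eval w R = 0) (x y z : ℂ)
    (h : eval (x • u + y • v + z • w) R = 0) : 
    gam R u v w y x = (-(gradL R u v * (gradL R v w * y + gradL R u w * x))) • (x • u + y • v + z • w) := by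
  rw [quad3 hR, eu, ev, ew] at h
  simp only [gam, smul_add, smul_smul]
  congr 1
  · congr 1 <;> · congr 1; ring
  · congr 1; linear_combination gradL R u v * h

theorem gam_param {R : MvPolynomial (Fin 6) ℂ} (hR : R.IsHomogeneous 2) {u v w : Fin 6 → ℂ}
    (eu : eval u R = 0) (ev : eval v R = 0) (ew : eval w R = 0) 
    (ha : gradL R u v ≠ 0) (hb : gradL R u w ≠ 0) (hc : gradL R v w ≠ 0) (x y z : ℂ)
    (h : eval (x • u + y • v + z • w) R = 0) : (x = 0 ∧ z = 0) ∨ ∃ s c : ℂ, c ≠ 0 ∧ gam R u v w s 1 = c • (x • u + y • v + z • w) ∨ (x • u + y • v + z • w) = 0 := by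
  by_cases hx : x = 0
  · subst hx
    have h' := h
    rw [quad3 hR, eu, ev, ew] at h'
    have : y = 0 ∨ z = 0 := by simpa [hc] using h'
    rcases this with rfl | rfl
    · by_cases hz : z = 0
      · left; exact ⟨rfl, hz⟩
      · right
        refine ⟨-(gradL R u w / gradL R v w), -gradL R u v ^ 2 * (gradL R u w / gradL R v w) * z⁻¹, Or.inl ⟨?_, ?_⟩⟩
        · simp [ha, hb, hc, hz]
        · have k0 : gradL R v w * -(gradL R u w / gradL R v w) + gradL R u w * 1 = 0 := by field_simp; ring
          rw [gam, k0]
          simp only [mul_zero, neg_zero, zero_smul, zero_add, smul_smul]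
          congr 1
          field_simp
    · left; exact ⟨rfl, rfl⟩
  · right
    by_cases hk : gradL R v w * y + gradL R u w * x = 0
    · have h' := h
      rw [quad3 hR, eu, ev, ew] at h'
      have : gradL R u v * x * y = 0 := by linear_combination h' - z * hk
      have hy : y = 0 := by simpa [ha, hx] using this
      subst hy
      simp [hb, hx] at hk
    · refine ⟨y / x, x⁻¹ ^ 2 * (-(gradL R u v * (gradL R v w * y + gradL R u w * x))), Or.inl ⟨?_, ?_⟩⟩
      · simp [ha, hk, hx]
      · have := gam_hom R u v w x⁻¹ y x
        rw [gam_cover hR eu ev ew x y z h, inv_mul_cancel₀ hx, smul_smul] at this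
        rw [← this]
        congr 1
        field_simp

theorem bad_of_count {g R : MvPolynomial (Fin 6) ℂ} {d : ℕ} (hg : g.IsHomogeneous d) (hR : R.IsHomogeneous 2) {u v w : Fin 6 → ℂ}
    (eu : eval u R = 0) (ev : eval v R = 0) (ew : eval w R = 0) (gv : eval v g = 0) 
    (ha : gradL R u v ≠ 0) (hb : gradL R u w ≠ 0) (hc : gradL R v w ≠ 0) (hv : v ≠ 0)
    (S : Finset (PPt (Fin 6))) (hS : 2 * d + 2 ≤ S.card)
    (hSm : ∀ x ∈ S, ∃ p q r : ℂ, x.rep = p • u + q • v + r • w)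
    (hSR : ∀ x ∈ S, eval x.rep R = 0) (hSg : ∀ x ∈ S, eval x.rep g = 0) (s t : ℂ) : eval (gam R u v w s t) g = 0 := by
  classical
  have key : ∀ x ∈ S.erase (Projectivization.mk ℂ v hv), ∃ s c : ℂ, c ≠ 0 ∧ gam R u v w s 1 = c • x.rep := by
    intro x hx
    obtain ⟨hxv, hxS⟩ := Finset.mem_erase.1 hx
    obtain ⟨p, q, r, he⟩ := hSm x hxS
    have h0 := hSR x hxS
    rw [he] at h0
    rcases gam_param hR eu ev ew ha hb hc p q r h0 with ⟨rfl, rfl⟩ | ⟨s, c, h | h⟩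
    · exfalso
      apply hxv
      rw [← Projectivization.mk_rep x, Projectivization.mk_eq_mk_iff']
      exact ⟨q, by rw [he]; simp⟩
    · exact ⟨s, c, h.1, by rw [h.2, he]⟩
    · exact absurd (he.trans h) x.rep_nonzero
  choose! σ c hc0 hσ using key
  set p : Polynomial ℂ := aeval (gamP R u v w) g with hp
  have pe : ∀ s, p.eval s = eval (gam R u v w s 1) g := by
    intro s
    rw [hp, poly_slice]
    congr 2
    funext i
    exact gamP_eval R u v w i s
  have hinj : Set.InjOn σ (S.erase (Projectivization.mk ℂ v hv)) := by
    intro x hx x' hx' he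
    have h1 := hσ x hx
    have h2 := hσ x' hx'
    rw [he, h2] at h1
    rw [← Projectivization.mk_rep x, ← Projectivization.mk_rep x', Projectivization.mk_eq_mk_iff']
    refine ⟨(c x)⁻¹ * c x', ?_⟩
    rw [mul_smul, h1, smul_smul, inv_mul_cancel₀ (hc0 x hx), one_smul]
  have p0 : p = 0 := by
    apply Polynomial.eq_zero_of_natDegree_lt_card_of_eval_eq_zero' p ((S.erase (Projectivization.mk ℂ v hv)).image σ)
    · intro z hz
      obtain ⟨x, hx, rfl⟩ := Finset.mem_image.1 hz
      rw [pe, hσ x hx, eval_hom hg, hSg x (Finset.mem_of_mem_erase hx), mul_zero]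
    · rw [Finset.card_image_of_injOn hinj]
      have h1 := natDegree_aeval_le hg (gamP R u v w) (gamP_deg R u v w)
      have h2 := Finset.pred_card_le_card_erase (s := S) (a := Projectivization.mk ℂ v hv)
      rw [← hp] at h1
      omega
  have e1 : ∀ s, eval (gam R u v w s 1) g = 0 := fun s => by rw [← pe, p0, Polynomial.eval_zero]
  by_cases ht : t = 0
  · subst ht
    have : gam R u v w s 0 = (-(gradL R u v * s * (gradL R v w * s))) • v := by
      simp [gam]
    rw [this, eval_hom hg, gv, mul_zero]
  · have := gam_hom R u v w t (s / t) 1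
    rw [mul_div_cancel₀ _ ht, mul_one] at this
    rw [this, eval_hom hg, e1, mul_zero]

theorem bad_span {g R : MvPolynomial (Fin 6) ℂ} {d : ℕ} (hd : 0 < d) (hg : g.IsHomogeneous d) (hR : R.IsHomogeneous 2) {u v w : Fin 6 → ℂ}
    (eu : eval u R = 0) (ev : eval v R = 0) (ew : eval w R = 0) (gv : eval v g = 0) 
    (ha : gradL R u v ≠ 0) (hb : gradL R u w ≠ 0) (hc : gradL R v w ≠ 0)
    (hbad : ∀ s t, eval (gam R u v w s t) g = 0) (x : Fin 6 → ℂ) (hx : x ∈ Submodule.span ℂ {u, v, w})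
    (hxR : eval x R = 0) : eval x g = 0 := by
  obtain ⟨p, q, r, rfl⟩ := Submodule.mem_span_triple.1 hx
  rcases gam_param hR eu ev ew ha hb hc p q r hxR with ⟨rfl, rfl⟩ | ⟨s, c, h | h⟩
  · have : (0 : ℂ) • u + q • v + (0 : ℂ) • w = q • v := by simp
    rw [this, eval_hom hg, gv, mul_zero]
  · have := hbad s 1
    rw [h.2, eval_hom hg] at this
    simpa [h.1] using this
  · rw [h]
    have := eval_hom hg 0 0
    rw [zero_smul, zero_pow hd.ne', zero_mul] at this
    exact this

def e36 : Fin 3 ⊕ Fin 3 ≃ Fin 6 := finSumFinEquiv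

/-- square matrix with rows `n` and `h` -/
def blk {K : Type*} (n h : Matrix (Fin 3) (Fin 6) K) : Matrix (Fin 3 ⊕ Fin 3) (Fin 3 ⊕ Fin 3) K :=
  (Matrix.fromRows n h).submatrix id e36

theorem blk_key {K : Type*} [CommRing K] (n h : Matrix (Fin 3) (Fin 6) K) (a x : Matrix (Fin 6) (Fin 3) K)
    (hx : n * x = 0) (ha : n * a = 1) :
    (blk n h).det * ((Matrix.fromCols a x).submatrix e36 id).det = (h * x).det := by
  rw [blk, ← Matrix.det_mul, Matrix.submatrix_mul_equiv, Matrix.submatrix_id_id, Matrix.fromRows_mul_fromCols, hx, ha,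
    Matrix.det_fromBlocks_zero₁₂, Matrix.det_one, one_mul]

theorem blk_inv {n h : Matrix (Fin 3) (Fin 6) ℂ} (hn : (blk n h).det ≠ 0) : ∃ a : Matrix (Fin 6) (Fin 3) ℂ, n * a = 1 := by
  refine ⟨((blk n h)⁻¹).submatrix e36.symm Sum.inl, ?_⟩
  have h1 := Matrix.mul_nonsing_inv (blk n h) (isUnit_iff_ne_zero.2 hn)
  ext i j
  have h2 := congrFun (congrFun h1 (Sum.inl i)) (Sum.inl j)
  rw [Matrix.mul_apply] at h2 ⊢
  rw [← e36.sum_comp (fun k => n i k * _)]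
  simp only [Matrix.submatrix_apply, Equiv.symm_apply_apply]
  rw [Matrix.one_apply] at h2 ⊢
  simp only [Sum.inl.injEq] at h2
  rw [← h2]
  rfl

theorem blk_exists {n : Matrix (Fin 3) (Fin 6) ℂ} (hn : LinearIndependent ℂ n.row) : ∃ h : Matrix (Fin 3) (Fin 6) ℂ, (blk n h).det ≠ 0 := by
  obtain ⟨x, hx⟩ := exists_linearIndependent_snoc_of_lt_finrank hn (by simp)
  obtain ⟨y, hy⟩ := exists_linearIndependent_snoc_of_lt_finrank hx (by simp)
  obtain ⟨z, hz⟩ := exists_linearIndependent_snoc_of_lt_finrank hy (by simp)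
  refine ⟨Matrix.of ![x, y, z], ?_⟩
  have h1 : (Matrix.fromRows n (Matrix.of ![x, y, z])).submatrix e36.symm id = Matrix.of (Fin.snoc (α := fun _ => Fin 6 → ℂ) (Fin.snoc (α := fun _ => Fin 6 → ℂ) (Fin.snoc (α := fun _ => Fin 6 → ℂ) n.row x) y) z) := by
    ext i j
    fin_cases i <;> rfl
  have h2 : IsUnit (Matrix.of (Fin.snoc (α := fun _ => Fin 6 → ℂ) (Fin.snoc (α := fun _ => Fin 6 → ℂ) (Fin.snoc (α := fun _ => Fin 6 → ℂ) n.row x) y) z)) :=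
    Matrix.linearIndependent_rows_iff_isUnit.1 hz
  rw [← h1, Matrix.isUnit_iff_isUnit_det] at h2
  have h3 : blk n (Matrix.of ![x, y, z]) = ((Matrix.fromRows n (Matrix.of ![x, y, z])).submatrix e36.symm id).submatrix e36 e36 := by
    ext i j
    simp [blk]
  rw [h3, Matrix.det_submatrix_equiv_self]
  exact h2.ne_zero

theorem blk_map {K L : Type*} [CommRing K] [CommRing L] (f : K →+* L) (n h : Matrix (Fin 3) (Fin 6) K) :
    f (blk n h).det = (blk (n.map f) (h.map f)).det := by
  rw [RingHom.map_det]
  congr 1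
  ext i j
  rcases i with i | i <;> rfl

/-- the algebraic rigidity principle -/
theorem rigid_poly (n : Matrix (Fin 3) (Fin 6) (Polynomial ℂ)) (x : Matrix (Fin 6) (Fin 3) (Polynomial ℂ))
    (hx : n * x = 0) (hn : ∀ s, LinearIndependent ℂ (n.map (Polynomial.evalRingHom s)).row)
    (h₀ : Matrix (Fin 3) (Fin 6) ℂ) (hdeg : (h₀.map Polynomial.C * x).det.natDegree < (blk n (h₀.map Polynomial.C)).det.natDegree)
    (h : Matrix (Fin 3) (Fin 6) ℂ) (s : ℂ) : (h * x.map (Polynomial.evalRingHom s)).det = 0 := by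
  set P : Matrix (Fin 3) (Fin 6) ℂ → Polynomial ℂ := fun h => (blk n (h.map Polynomial.C)).det with hP
  set L : Matrix (Fin 3) (Fin 6) ℂ → Polynomial ℂ := fun h => (h.map Polynomial.C * x).det with hL
  have mapC : ∀ (h : Matrix (Fin 3) (Fin 6) ℂ) (s : ℂ), (h.map Polynomial.C).map (Polynomial.evalRingHom s) = h := by
    intro h s; ext i j; simp
  have eP : ∀ h s, (P h).eval s = (blk (n.map (Polynomial.evalRingHom s)) h).det := by
    intro h s
    have := blk_map (Polynomial.evalRingHom s) n (h.map Polynomial.C)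
    rw [mapC] at this
    exact this
  have eL : ∀ h s, (L h).eval s = (h * x.map (Polynomial.evalRingHom s)).det := by
    intro h s
    have := RingHom.map_det (Polynomial.evalRingHom s) (h.map Polynomial.C * x)
    rw [RingHom.mapMatrix_apply, Matrix.map_mul, mapC] at this
    exact this
  have hxs : ∀ s, n.map (Polynomial.evalRingHom s) * x.map (Polynomial.evalRingHom s) = 0 := by
    intro s
    rw [← Matrix.map_mul, hx]
    ext i j; simp
  have cross : ∀ h h', L h * P h' = L h' * P h := by
    intro h h'
    apply Polynomial.funext
    intro s
    obtain ⟨h1, hh1⟩ := blk_exists (hn s)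
    obtain ⟨a, ha⟩ := blk_inv hh1
    rw [Polynomial.eval_mul, Polynomial.eval_mul, eP, eP, eL, eL, ← blk_key _ h a _ (hxs s) ha, ← blk_key _ h' a _ (hxs s) ha]
    ring
  have htop : Ideal.span (Set.range P) = ⊤ := by
    by_contra hne
    obtain ⟨m, hm, hle⟩ := Ideal.exists_le_maximal _ hne
    have hpr : Submodule.IsPrincipal m := inferInstance
    obtain ⟨p, hp⟩ := hpr
    have hroot : ∃ s, p.eval s = 0 := by
      by_contra hc
      push Not at hc
      have hd0 : p.degree = 0 := by
        by_contra h
        obtain ⟨z, hz⟩ := IsAlgClosed.exists_root p h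
        exact hc z hz
      apply hm.ne_top
      rw [hp]
      exact Ideal.span_singleton_eq_top.2 (Polynomial.isUnit_iff_degree_eq_zero.2 hd0)
    obtain ⟨s, hs⟩ := hroot
    obtain ⟨h1, hh1⟩ := blk_exists (hn s)
    have : P h1 ∈ m := hle (Ideal.subset_span ⟨h1, rfl⟩)
    rw [hp] at this
    obtain ⟨r, hr⟩ := Ideal.mem_span_singleton.1 this
    apply hh1
    rw [← eP, hr, Polynomial.eval_mul, hs, zero_mul]
  have hdvd : P h₀ ∣ L h₀ := by
    have : ∀ r ∈ Ideal.span (Set.range P), P h₀ ∣ r * L h₀ := by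
      intro r hr
      induction hr using Submodule.span_induction with
      | mem r hr => 
        obtain ⟨h', rfl⟩ := hr
        rw [mul_comm, cross]
        exact dvd_mul_left _ _
      | zero => simp
      | add a b _ _ ha hb => rw [add_mul]; exact dvd_add ha hb
      | smul c a _ ha => rw [smul_eq_mul, mul_assoc]; exact ha.mul_left c
    simpa using this 1 (by rw [htop]; trivial)
  have hL0 : L h₀ = 0 := Polynomial.eq_zero_of_dvd_of_natDegree_lt hdvd hdeg
  have hP0 : P h₀ ≠ 0 := by
    intro h
    have : (P h₀).natDegree = 0 := by rw [h]; simp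
    have : (L h₀).natDegree < (P h₀).natDegree := hdeg
    omega
  have := cross h h₀
  rw [hL0, zero_mul] at this
  have : L h = 0 := by simpa [hP0] using this
  rw [← eL, this, Polynomial.eval_zero]

theorem natDegree_of_recip (P Pt : Polynomial ℂ) (N : ℕ) (h : ∀ u : ℂ, u ≠ 0 → Pt.eval u = u ^ N * P.eval u⁻¹)
    (h0 : Pt.eval 0 ≠ 0) : N ≤ P.natDegree := by
  by_contra hlt
  push Not at hlt
  apply h0
  have key : Polynomial.X * Pt = Polynomial.X * (Polynomial.X ^ (N - P.natDegree) * P.reverse) := by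
    apply Polynomial.funext
    intro u
    by_cases hu : u = 0
    · simp [hu]
    · have : Invertible u⁻¹ := invertibleOfNonzero (inv_ne_zero hu)
      have := Polynomial.eval₂_reverse_mul_pow (RingHom.id ℂ) u⁻¹ P
      rw [invOf_eq_inv, inv_inv] at this
      simp only [Polynomial.eval₂_id] at this
      rw [Polynomial.eval_mul, Polynomial.eval_mul, Polynomial.eval_mul, h u hu, ← this]
      simp only [Polynomial.eval_X, Polynomial.eval_pow]
      have e : u ^ N = u ^ (N - P.natDegree) * u ^ P.natDegree := by rw [← pow_add]; congr 1; omega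
      rw [e]
      have : u ^ P.natDegree * u⁻¹ ^ P.natDegree = 1 := by rw [← mul_pow, mul_inv_cancel₀ hu, one_pow]
      linear_combination (u * u ^ (N - P.natDegree) * Polynomial.eval u P.reverse) * this
  have := mul_left_cancel₀ Polynomial.X_ne_zero key
  rw [this]
  simp [Nat.sub_ne_zero_of_lt hlt]

theorem natDegree_det3_le (M : Matrix (Fin 3) (Fin 3) (Polynomial ℂ)) (hM : ∀ i j, (M i j).natDegree ≤ 2) : M.det.natDegree ≤ 6 := by
  rw [Matrix.det_apply]
  apply Polynomial.natDegree_sum_le_of_forall_le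
  intro σ _
  refine (Polynomial.natDegree_smul_le _ _).trans ((Polynomial.natDegree_prod_le _ _).trans ?_)
  refine (Finset.sum_le_sum fun i _ => hM (σ i) i).trans ?_
  simp

/-- quadratic parametrization -/
def qd (E : Fin 3 → Fin 6 → ℂ) (s t : ℂ) : Fin 6 → ℂ := s ^ 2 • E 0 + (s * t) • E 1 + t ^ 2 • E 2

noncomputable def qdP (E : Fin 3 → Fin 6 → ℂ) (i : Fin 6) : Polynomial ℂ :=
  Polynomial.C (E 0 i) * Polynomial.X ^ 2 + Polynomial.C (E 1 i) * Polynomial.X + Polynomial.C (E 2 i)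

theorem qdP_eval (E : Fin 3 → Fin 6 → ℂ) (i : Fin 6) (s : ℂ) : (qdP E i).eval s = qd E s 1 i := by
  simp [qdP, qd]; ring

theorem qd_hom (E : Fin 3 → Fin 6 → ℂ) (c s t : ℂ) : qd E (c * s) (c * t) = c ^ 2 • qd E s t := by
  simp only [qd, smul_add, smul_smul]
  congr 1
  · congr 1 <;> · congr 1; ring
  · congr 1; ring

theorem qd_ne_zero {E : Fin 3 → Fin 6 → ℂ} (hE : LinearIndependent ℂ E) (s : ℂ) : qd E s 1 ≠ 0 := by
  intro h
  have := Fintype.linearIndependent_iff.1 hE ![s ^ 2, s * 1, 1 ^ 2] (by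
    rw [← h]; simp [Fin.sum_univ_three, qd]) 2
  simp at this

noncomputable def nP (F : Fin 3 → MvPolynomial (Fin 6) ℂ) (E : Fin 3 → Fin 6 → ℂ) : Matrix (Fin 3) (Fin 6) (Polynomial ℂ) :=
  Matrix.of fun k i => aeval (qdP E) (pderiv i (F k))

theorem nP_eval (F : Fin 3 → MvPolynomial (Fin 6) ℂ) (E : Fin 3 → Fin 6 → ℂ) (s : ℂ) :
    (nP F E).map (Polynomial.evalRingHom s) = Matrix.of fun k i => eval (qd E s 1) (pderiv i (F k)) := by
  ext k i
  have := poly_slice (qdP E) (pderiv i (F k)) s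
  have e : (fun i => (qdP E i).eval s) = qd E s 1 := funext fun i => qdP_eval E i s
  rw [e] at this
  exact this

theorem grad_rows_indep {q₁ q₂ g : MvPolynomial (Fin 6) ℂ} (hX : IsSmoothCI3 q₁ q₂ g) (v : Fin 6 → ℂ) (hv : v ≠ 0)
    (e : ∀ k, eval v ((![q₁, q₂, g] : Fin 3 → _) k) = 0) :
    LinearIndependent ℂ (Matrix.of fun k i => eval v (pderiv i ((![q₁, q₂, g] : Fin 3 → _) k)) : Matrix (Fin 3) (Fin 6) ℂ).row := by
  rw [Fintype.linearIndependent_iff]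
  intro c hc
  have := hX v hv (e 0) (e 1) (e 2) (c 0) (c 1) (c 2) (by
    intro i
    have := congrFun hc i
    simpa [Fin.sum_univ_three] using this)
  intro i
  fin_cases i
  exacts [this.1, this.2.1, this.2.2]

theorem det_blk_scale (n : Matrix (Fin 3) (Fin 6) ℂ) (h : Matrix (Fin 3) (Fin 6) ℂ) (c : Fin 3 → ℂ) :
    (blk (Matrix.of fun k i => c k * n k i) h).det = (∏ k, c k) * (blk n h).det := by
  have := Matrix.det_mul_column (Sum.elim c 1 : Fin 3 ⊕ Fin 3 → ℂ) (blk n h)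
  rw [Fintype.prod_sum_type] at this
  simp only [Sum.elim_inl, Sum.elim_inr, Pi.one_apply, Finset.prod_const_one, mul_one] at this
  rw [← this]
  congr 1
  ext i j
  rcases i with i | i
  · rfl
  · simp [blk]

theorem conic_rigid {q₁ q₂ g : MvPolynomial (Fin 6) ℂ} {d : ℕ} (hd : 8 ≤ d)
    (h₁ : q₁.IsHomogeneous 2) (h₂ : q₂.IsHomogeneous 2) (hg : g.IsHomogeneous d) (hX : IsSmoothCI3 q₁ q₂ g)
    (E E' : Fin 3 → Fin 6 → ℂ) (hE : LinearIndependent ℂ E)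
    (z : ∀ k s t, eval (qd E s t) ((![q₁, q₂, g] : Fin 3 → _) k) = 0)
    (z' : ∀ k s t, gradL ((![q₁, q₂, g] : Fin 3 → _) k) (qd E s t) (qd E' s t) = 0) :
    ∃ a b : ℂ, E' 2 = a • E 1 + b • E 2 := by
  set F : Fin 3 → MvPolynomial (Fin 6) ℂ := ![q₁, q₂, g] with hF
  set dg : Fin 3 → ℕ := ![2, 2, d] with hdg
  have hh : ∀ k, (F k).IsHomogeneous (dg k) := by
    intro k; fin_cases k
    exacts [h₁, h₂, hg]
  let xP : Matrix (Fin 6) (Fin 3) (Polynomial ℂ) := Matrix.of fun i => 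
    ![Polynomial.C (2 * E 0 i) * Polynomial.X + Polynomial.C (E 1 i), qdP E i, qdP E' i]
  have xe : ∀ s, xP.map (Polynomial.evalRingHom s) = Matrix.of fun i j => (![(2 * s) • E 0 + E 1, qd E s 1, qd E' s 1] : Fin 3 → Fin 6 → ℂ) j i := by
    intro s
    ext i j
    fin_cases j
    · simp [xP]; ring
    · simp [xP, qdP_eval]
    · simp [xP, qdP_eval]
  have hn : ∀ s, LinearIndependent ℂ ((nP F E).map (Polynomial.evalRingHom s)).row := by
    intro s
    rw [nP_eval]
    exact grad_rows_indep hX _ (qd_ne_zero hE s) (fun k => z k s 1)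
  have ker : ∀ k s, gradL (F k) (qd E s 1) ((2 * s) • E 0 + E 1) = 0 ∧ gradL (F k) (qd E s 1) (qd E s 1) = 0 := by
    intro k s
    constructor
    · have h1 : HasDerivAt (fun s : ℂ => qd E s 1) ((2 * s) • E 0 + E 1) s := by
        have a1 : HasDerivAt (fun s : ℂ => s ^ 2 • E 0) ((2 * s) • E 0) s := by
          have := (hasDerivAt_pow 2 s).smul_const (E 0)
          simpa using this
        have a2 : HasDerivAt (fun s : ℂ => (s * 1) • E 1) ((1 * 1 : ℂ) • E 1) s :=
          ((hasDerivAt_id s).mul_const 1).smul_const (E 1)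
        have a3 := (a1.add a2).add_const ((1 : ℂ) ^ 2 • E 2)
        rw [mul_one, one_smul] at a3
        exact a3
      have h2 := (eval_hasStrict (F k) (qd E s 1)).hasFDerivAt.comp_hasDerivAt s h1
      have h3 : HasDerivAt (fun _ : ℂ => (0 : ℂ)) (gradL (F k) (qd E s 1) ((2 * s) • E 0 + E 1)) s := by
        refine h2.congr_of_eventuallyEq (Filter.Eventually.of_forall fun s => ?_)
        exact (z k s 1).symm
      exact h3.unique (hasDerivAt_const s 0)
    · rw [euler_gradL (hh k), z k, mul_zero]
  have hx : nP F E * xP = 0 := by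
    ext1 k j
    apply Polynomial.funext
    intro s
    have h1 : (nP F E * xP).map (Polynomial.evalRingHom s) k j = gradL (F k) (qd E s 1) ((![(2 * s) • E 0 + E 1, qd E s 1, qd E' s 1] : Fin 3 → Fin 6 → ℂ) j) := by
      rw [Matrix.map_mul, xe, nP_eval, Matrix.mul_apply, gradL_apply]
      rfl
    have h2 : (nP F E * xP).map (Polynomial.evalRingHom s) k j = ((nP F E * xP) k j).eval s := rfl
    rw [← h2, h1, Matrix.zero_apply, Polynomial.eval_zero]
    fin_cases j
    · exact (ker k s).1
    · exact (ker k s).2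
    · exact z' k s 1
  -- the point at infinity
  let Er : Fin 3 → Fin 6 → ℂ := ![E 2, E 1, E 0]
  have rev : ∀ u, qd Er u 1 = qd E 1 u := by
    intro u; simp [qd, Er]; abel
  have E00 : E 0 ≠ 0 := hE.ne_zero 0
  have q10 : qd E 1 0 = E 0 := by simp [qd]
  obtain ⟨h₀, hh₀⟩ := blk_exists (grad_rows_indep hX (E 0) E00 (fun k => by rw [← q10]; exact z k 1 0))
  have hbig : 2 * d + 2 ≤ (blk (nP F E) (h₀.map Polynomial.C)).det.natDegree := by
    have mapC : ∀ (h : Matrix (Fin 3) (Fin 6) ℂ) (s : ℂ), (h.map Polynomial.C).map (Polynomial.evalRingHom s) = h := by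
      intro h s; ext i j; simp
    have ev : ∀ E s, (blk (nP F E) (h₀.map Polynomial.C)).det.eval s = (blk (Matrix.of fun k i => eval (qd E s 1) (pderiv i (F k))) h₀).det := by
      intro E s
      have := blk_map (Polynomial.evalRingHom s) (nP F E) (h₀.map Polynomial.C)
      rw [mapC, nP_eval] at this
      exact this
    apply natDegree_of_recip _ (blk (nP F Er) (h₀.map Polynomial.C)).det
    · intro u hu
      rw [ev, ev, rev]
      have e1 : qd E 1 u = u ^ 2 • qd E u⁻¹ 1 := by
        rw [← qd_hom, mul_inv_cancel₀ hu, mul_one]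
      have e2 : (Matrix.of fun k i => eval (qd E 1 u) (pderiv i (F k)) : Matrix (Fin 3) (Fin 6) ℂ) =
          Matrix.of fun k i => (u ^ 2) ^ (dg k - 1) * (Matrix.of fun k i => eval (qd E u⁻¹ 1) (pderiv i (F k)) : Matrix (Fin 3) (Fin 6) ℂ) k i := by
        ext k i
        simp only [Matrix.of_apply]
        rw [e1, eval_hom (pderiv_hom (hh k) i)]
      rw [e2, det_blk_scale, Fin.prod_univ_three]
      congr 1
      simp only [hdg, ← pow_mul, ← pow_add, Matrix.cons_val_zero, Matrix.cons_val_one, Matrix.cons_val]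
      congr 1
      omega
    · rw [ev, rev, q10]
      exact hh₀
  have hdeg : (h₀.map Polynomial.C * xP).det.natDegree < (blk (nP F E) (h₀.map Polynomial.C)).det.natDegree := by
    have : (h₀.map Polynomial.C * xP).det.natDegree ≤ 6 := by
      apply natDegree_det3_le
      intro i j
      rw [Matrix.mul_apply]
      apply Polynomial.natDegree_sum_le_of_forall_le
      intro l _
      rw [Matrix.map_apply]
      refine (Polynomial.natDegree_C_mul_le _ _).trans ?_
      fin_cases j
      · change (Polynomial.C (2 * E 0 l) * Polynomial.X + Polynomial.C (E 1 l)).natDegree ≤ 2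
        compute_degree
        norm_num
      · change (qdP E l).natDegree ≤ 2
        unfold qdP
        compute_degree
      · change (qdP E' l).natDegree ≤ 2
        unfold qdP
        compute_degree
    omega
  by_contra hno
  push Not at hno
  have li : LinearIndependent ℂ ![E 1, E 2, E' 2] := by
    apply indep3_of _ hno
    rw [LinearIndependent.pair_iff]
    intro s t hst
    have h1 := Fintype.linearIndependent_iff.1 hE ![0, s, t] (by simpa [Fin.sum_univ_three] using hst)
    exact ⟨h1 1, h1 2⟩
  have fin := fun h => rigid_poly (nP F E) xP hx hn h₀ hdeg h 0
  rw [xe] at fin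
  have hcol : LinearIndependent ℂ (Matrix.of fun i j => (![(2 * (0:ℂ)) • E 0 + E 1, qd E 0 1, qd E' 0 1] : Fin 3 → Fin 6 → ℂ) j i : Matrix (Fin 6) (Fin 3) ℂ).col := by
    convert li using 1
    ext j i
    fin_cases j <;> simp [qd]
  rw [← Matrix.row_transpose] at hcol
  obtain ⟨h', hh'⟩ := blk_exists hcol
  obtain ⟨a, ha⟩ := blk_inv hh'
  have := fin a.transpose
  have e := congrArg Matrix.transpose ha
  rw [Matrix.transpose_mul, Matrix.transpose_transpose, Matrix.transpose_one] at e
  rw [e] at this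
  simp at this

theorem gradL_diff {R : MvPolynomial (Fin 6) ℂ} (hR : R.IsHomogeneous 2) {u v : (Fin 2 → ℂ) → (Fin 6 → ℂ)} {y₀ : Fin 2 → ℂ}
    (hu : DifferentiableAt ℂ u y₀) (hv : DifferentiableAt ℂ v y₀) :
    DifferentiableAt ℂ (fun y => gradL R (u y) (v y)) y₀ := by
  have e : (fun y => gradL R (u y) (v y)) = fun y => eval (u y + v y) R - eval (u y) R - eval (v y) R := by
    funext y
    rw [quad_add hR]; ring
  have ev : ∀ {w : (Fin 2 → ℂ) → (Fin 6 → ℂ)}, DifferentiableAt ℂ w y₀ → DifferentiableAt ℂ (fun y => eval (w y) R) y₀ := by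
    intro w hw
    exact (eval_hasStrict R (w y₀)).hasFDerivAt.differentiableAt.comp y₀ hw
  rw [e]
  have h1 := ev (hu.add hv)
  exact ((h1.sub (ev hu)).sub (ev hv))

/-- coefficients of the parametrization -/
noncomputable def gamE (R : MvPolynomial (Fin 6) ℂ) (u v w : Fin 6 → ℂ) : Fin 3 → Fin 6 → ℂ :=
  ![(-(gradL R u v * gradL R v w)) • v,
    (-(gradL R u v * gradL R v w)) • u + (-(gradL R u v * gradL R u w)) • v + (gradL R u v * gradL R u v) • w,
    (-(gradL R u v * gradL R u w)) • u]

theorem gam_qd (R : MvPolynomial (Fin 6) ℂ) (u v w : Fin 6 → ℂ) (s t : ℂ) : qd (gamE R u v w) s t = gam R u v w s t := by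
  ext i
  simp [qd, gamE, gam]
  ring

open Topology Filter Set in
theorem bad_core {q₁ q₂ g R : MvPolynomial (Fin 6) ℂ} {d : ℕ} (hd : 8 ≤ d)
    (h₁ : q₁.IsHomogeneous 2) (h₂ : q₂.IsHomogeneous 2) (hg : g.IsHomogeneous d) (hX : IsSmoothCI3 q₁ q₂ g)
    (hR : R.IsHomogeneous 2) (φ : RatMapTo (Fin 6) 2) (he : 0 < φ.e)
    (u v w : (Fin 2 → ℂ) → (Fin 6 → ℂ)) (y₀ : Fin 2 → ℂ)
    (hu : DifferentiableAt ℂ u y₀) (hv : DifferentiableAt ℂ v y₀) (hw : DifferentiableAt ℂ w y₀)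
    (hl : LinearIndependent ℂ ![u y₀, v y₀, w y₀])
    (ha : gradL R (u y₀) (v y₀) ≠ 0) (hb : gradL R (u y₀) (w y₀) ≠ 0) (hc : gradL R (v y₀) (w y₀) ≠ 0)
    (hz : ∀ᶠ y in 𝓝 y₀, ∀ k s t, eval (gam R (u y) (v y) (w y) s t) ((![q₁, q₂, g] : Fin 3 → _) k) = 0)
    (hφ : ∀ᶠ y in 𝓝 y₀, eval (u y) (φ.F 0) = 1 ∧ eval (u y) (φ.F 1) = y 0 ∧ eval (u y) (φ.F 2) = y 1) : False := by
  have da := gradL_diff hR hu hv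
  have db := gradL_diff hR hu hw
  have dc := gradL_diff hR hv hw
  have dab : DifferentiableAt ℂ (fun y => -(gradL R (u y) (v y) * gradL R (u y) (w y))) y₀ := (da.mul db :).neg
  have dac : DifferentiableAt ℂ (fun y => -(gradL R (u y) (v y) * gradL R (v y) (w y))) y₀ := (da.mul dc :).neg
  have daa : DifferentiableAt ℂ (fun y => (gradL R (u y) (v y) * gradL R (u y) (v y))) y₀ := (da.mul da :)
  have dE : ∀ i, DifferentiableAt ℂ (fun y => gamE R (u y) (v y) (w y) i) y₀ := by
    intro i
    fin_cases i
    · exact dac.smul hv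
    · exact ((dac.smul hu).add (dab.smul hv)).add (daa.smul hw)
    · exact dab.smul hu
  have hind : LinearIndependent ℂ (gamE R (u y₀) (v y₀) (w y₀)) := by
    rw [Fintype.linearIndependent_iff] at hl ⊢
    intro c hcs
    set a := gradL R (u y₀) (v y₀)
    set b := gradL R (u y₀) (w y₀)
    set e := gradL R (v y₀) (w y₀)
    have := hl ![- c 1 * (a * e) - c 2 * (a * b), - c 0 * (a * e) - c 1 * (a * b), c 1 * (a * a)] (by
      rw [← hcs]
      simp only [Fin.sum_univ_three, gamE]
      ext i
      simp [a, b, e]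
      ring)
    have t2 := this 2
    have t0 := this 0
    have t1 := this 1
    simp at t0 t1 t2
    have c1 : c 1 = 0 := by simpa [ha] using t2
    rw [c1] at t0 t1
    have c0 : c 0 = 0 := by simpa [ha, hc] using t1
    have c2 : c 2 = 0 := by simpa [ha, hb] using t0
    intro i
    fin_cases i <;> assumption
  set E := gamE R (u y₀) (v y₀) (w y₀) with hEdef
  set Ed : Fin 3 → ((Fin 2 → ℂ) →L[ℂ] (Fin 6 → ℂ)) := fun i => fderiv ℂ (fun y => gamE R (u y) (v y) (w y) i) y₀ with hEd
  have hEd' : ∀ i, HasFDerivAt (fun y => gamE R (u y) (v y) (w y) i) (Ed i) y₀ := fun i => (dE i).hasFDerivAt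
  have hrig : ∀ l, ∃ a b : ℂ, Ed 2 l = a • E 1 + b • E 2 := by
    intro l
    refine conic_rigid hd h₁ h₂ hg hX E (fun i => Ed i l) hind ?_ ?_
    · intro k s t
      have := hz.self_of_nhds k s t
      rw [← gam_qd] at this
      exact this
    · intro k s t
      have h1 : HasFDerivAt (fun y => qd (gamE R (u y) (v y) (w y)) s t) (s ^ 2 • Ed 0 + (s * t) • Ed 1 + t ^ 2 • Ed 2) y₀ :=
        (((hEd' 0).const_smul (s ^ 2)).add ((hEd' 1).const_smul (s * t))).add ((hEd' 2).const_smul (t ^ 2))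
      have h2 := (eval_hasStrict ((![q₁, q₂, g] : Fin 3 → _) k) (qd E s t)).hasFDerivAt.comp y₀ h1
      have h3 : HasFDerivAt (fun _ : Fin 2 → ℂ => (0 : ℂ)) ((gradL ((![q₁, q₂, g] : Fin 3 → _) k) (qd E s t)).comp (s ^ 2 • Ed 0 + (s * t) • Ed 1 + t ^ 2 • Ed 2)) y₀ := by
        refine h2.congr_of_eventuallyEq ?_
        filter_upwards [hz] with y hy
        have := hy k s t
        rw [← gam_qd] at this
        exact this.symm
      have h4 := h3.unique (hasFDerivAt_const (0 : ℂ) y₀)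
      have h5 := congrArg (fun A : (Fin 2 → ℂ) →L[ℂ] ℂ => A l) h4
      exact h5
  -- derivative of u
  set S := fderiv ℂ u y₀ with hS
  have hSd : HasFDerivAt u S y₀ := hu.hasFDerivAt
  set L := Submodule.span ℂ {E 1, E 2} with hL
  have kne : -(gradL R (u y₀) (v y₀) * gradL R (u y₀) (w y₀)) ≠ 0 := by simp [ha, hb]
  have E2 : E 2 = (-(gradL R (u y₀) (v y₀) * gradL R (u y₀) (w y₀))) • u y₀ := rfl
  have uL : u y₀ ∈ L := by
    rw [← L.smul_mem_iff kne, ← E2]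
    exact Submodule.subset_span (by simp)
  have SL : ∀ l, S l ∈ L := by
    intro l
    have h1 : HasFDerivAt (fun y => gamE R (u y) (v y) (w y) 2) _ y₀ := dab.hasFDerivAt.smul hSd
    have h2 := (hEd' 2).unique h1
    have h3 := congrArg (fun A : (Fin 2 → ℂ) →L[ℂ] (Fin 6 → ℂ) => A l) h2
    simp only [ContinuousLinearMap.add_apply, ContinuousLinearMap.smul_apply, ContinuousLinearMap.smulRight_apply] at h3
    obtain ⟨a, b, hab⟩ := hrig l
    have h4 : Ed 2 l ∈ L := by rw [hab]; exact Submodule.mem_span_pair.2 ⟨a, b, rfl⟩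
    rw [h3] at h4
    have h5 := (L.add_mem_iff_left (L.smul_mem _ uL)).1 h4
    rwa [L.smul_mem_iff kne] at h5
  have dF : ∀ (j : Fin 3) (A : (Fin 2 → ℂ) →L[ℂ] ℂ) (f : (Fin 2 → ℂ) → ℂ), HasFDerivAt f A y₀ → (∀ᶠ y in 𝓝 y₀, eval (u y) (φ.F j) = f y) → 
      ∀ l, gradL (φ.F j) (u y₀) (S l) = A l := by
    intro j A f hf hev l
    have h1 := (eval_hasStrict (φ.F j) (u y₀)).hasFDerivAt.comp y₀ hSd
    have h2 : HasFDerivAt f ((gradL (φ.F j) (u y₀)).comp S) y₀ := by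
      refine h1.congr_of_eventuallyEq ?_
      filter_upwards [hev] with y hy
      exact hy.symm
    rw [← h2.unique hf]
    rfl
  have d0 := dF 0 0 (fun _ => 1) (hasFDerivAt_const 1 y₀) (hφ.mono fun y h => h.1)
  have d1 := dF 1 (ContinuousLinearMap.proj 0) (fun y => y 0) (ContinuousLinearMap.proj (R := ℂ) (φ := fun _ : Fin 2 => ℂ) 0).hasFDerivAt (hφ.mono fun y h => h.2.1)
  have d2 := dF 2 (ContinuousLinearMap.proj 1) (fun y => y 1) (ContinuousLinearMap.proj (R := ℂ) (φ := fun _ : Fin 2 => ℂ) 1).hasFDerivAt (hφ.mono fun y h => h.2.2)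
  have li : LinearIndependent ℂ ![u y₀, S ![1, 0], S ![0, 1]] := by
    rw [Fintype.linearIndependent_iff]
    intro c hcs
    simp [Fin.sum_univ_three] at hcs
    have g0 := congrArg (gradL (φ.F 0) (u y₀)) hcs
    have g1 := congrArg (gradL (φ.F 1) (u y₀)) hcs
    have g2 := congrArg (gradL (φ.F 2) (u y₀)) hcs
    simp only [map_add, map_smul, smul_eq_mul, map_zero, d0, d1, d2] at g0 g1 g2
    rw [euler_gradL (φ.homog 0), hφ.self_of_nhds.1] at g0
    have c0 : c 0 = 0 := by simpa [he.ne'] using g0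
    have c1 : c 1 = 0 := by simpa [c0] using g1
    have c2 : c 2 = 0 := by simpa [c0] using g2
    intro i
    fin_cases i <;> assumption
  have h3 : Module.finrank ℂ (Submodule.span ℂ (range ![u y₀, S ![1, 0], S ![0, 1]])) = 3 := by
    simpa using finrank_span_eq_card li
  have h4 : Submodule.span ℂ (range ![u y₀, S ![1, 0], S ![0, 1]]) ≤ L := by
    rw [Submodule.span_le]
    rintro _ ⟨i, rfl⟩
    fin_cases i
    exacts [uL, SL _, SL _]
  have h5 := Submodule.finrank_mono h4
  have h6 : Module.finrank ℂ L ≤ 2 := by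
    classical
    have := finrank_span_le_card (R := ℂ) ({E 1, E 2} : Set (Fin 6 → ℂ))
    refine this.trans ?_
    rw [Set.toFinset_insert, Set.toFinset_singleton]
    exact Finset.card_le_two
  omega

theorem gradL_pair {R : MvPolynomial (Fin 6) ℂ} (hR : R.IsHomogeneous 2) {u v : Fin 6 → ℂ}
    (eu : eval u R = 0) (ev : eval v R = 0) (h : gradL R u v ≠ 0) : LinearIndependent ℂ ![u, v] := by
  have self : ∀ x : Fin 6 → ℂ, eval x R = 0 → gradL R x x = 0 := by
    intro x hx
    have h1 := quad_add hR x x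
    have h2 : x + x = (2 : ℂ) • x := (two_smul ℂ x).symm
    rw [h2, eval_hom hR, hx] at h1
    simpa using h1.symm
  rw [LinearIndependent.pair_iff]
  intro s t hst
  have e1 : gradL R u (s • u + t • v) = 0 := by rw [hst, map_zero]
  have e2 : gradL R v (s • u + t • v) = 0 := by rw [hst, map_zero]
  rw [map_add, map_smul, map_smul, self u eu] at e1
  rw [map_add, map_smul, map_smul, self v ev, gradL_symm hR v u] at e2
  simp only [smul_eq_mul, mul_zero, zero_add, add_zero] at e1 e2
  exact ⟨(mul_eq_zero.1 e2).resolve_right h, (mul_eq_zero.1 e1).resolve_right h⟩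

theorem exists_triple {q₁ q₂ g : MvPolynomial (Fin 6) ℂ} {d : ℕ}
    (h₁ : q₁.IsHomogeneous 2) (h₂ : q₂.IsHomogeneous 2) (hg : g.IsHomogeneous d)
    {φ : RatMapTo (Fin 6) 2} (he : 0 < φ.e) {y : Fin 2 → ℂ}
    (hcard : 3 ≤ (φ.fiber (ZeroSet q₁ ∩ ZeroSet q₂ ∩ ZeroSet g) (ptY y)).ncard) :
    ∃ u ∈ Fhat q₁ q₂ g φ y, ∃ v ∈ Fhat q₁ q₂ g φ y, ∃ w ∈ Fhat q₁ q₂ g φ y,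
      LinearIndependent ℂ ![u, v] ∧ LinearIndependent ℂ ![u, w] ∧ LinearIndependent ℂ ![v, w] := by
  have hfin : (φ.fiber (ZeroSet q₁ ∩ ZeroSet q₂ ∩ ZeroSet g) (ptY y)).Finite := Set.finite_of_ncard_pos (by omega)
  obtain ⟨x1, x2, x3, m1, m2, m3, n1, n2, n3⟩ := (Set.two_lt_ncard_iff hfin).1 hcard
  obtain ⟨u, hu, uF, rfl⟩ := Fhat_rep h₁ h₂ hg he _ m1
  obtain ⟨v, hv, vF, rfl⟩ := Fhat_rep h₁ h₂ hg he _ m2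
  obtain ⟨w, hw, wF, rfl⟩ := Fhat_rep h₁ h₂ hg he _ m3
  exact ⟨u, uF, v, vF, w, wF, pair_indep_of_mk_ne hu hv n1, pair_indep_of_mk_ne hu hw n2, pair_indep_of_mk_ne hv hw n3⟩

/-- bad parameters: the surface contains the conic of the fibre -/
def BadY (q₁ q₂ g R : MvPolynomial (Fin 6) ℂ) (φ : RatMapTo (Fin 6) 2) (y : Fin 2 → ℂ) : Prop :=
  ∃ u ∈ Fhat q₁ q₂ g φ y, ∃ v ∈ Fhat q₁ q₂ g φ y, ∃ w ∈ Fhat q₁ q₂ g φ y,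
    gradL R u v ≠ 0 ∧ gradL R u w ≠ 0 ∧ gradL R v w ≠ 0 ∧ ∀ s t, eval (gam R u v w s t) g = 0

/-- conic through the fibre in the quadric -/
def ConY (q₁ q₂ g Q : MvPolynomial (Fin 6) ℂ) (φ : RatMapTo (Fin 6) 2) (y : Fin 2 → ℂ) : Prop :=
  ∃ (W : Submodule ℂ (Fin 6 → ℂ)) (C : Set (PPt (Fin 6))),
        IsConicIn W C ∧ C ⊆ ZeroSet q₁ ∩ ZeroSet q₂ ∧
        φ.fiber (ZeroSet q₁ ∩ ZeroSet q₂ ∩ ZeroSet g) (ptY y) ⊆ C ∧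
        (∀ v ∈ W, eval v Q = 0)

theorem bad_all {q₁ q₂ g Q R : MvPolynomial (Fin 6) ℂ} {d : ℕ} (hd : 0 < d)
    (h₁ : q₁.IsHomogeneous 2) (h₂ : q₂.IsHomogeneous 2) (hg : g.IsHomogeneous d) (hZ : IsSmoothCI2 q₁ q₂) (hR : R.IsHomogeneous 2)
    (hRQ : ∀ v, eval v Q = 0 → (eval v R = 0 ↔ eval v q₁ = 0 ∧ eval v q₂ = 0))
    {φ : RatMapTo (Fin 6) 2} (he : 0 < φ.e) {y : Fin 2 → ℂ} (hc : ConY q₁ q₂ g Q φ y) (hb : BadY q₁ q₂ g R φ y) 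
    {u v w : Fin 6 → ℂ} (hu : u ∈ Fhat q₁ q₂ g φ y) (hv : v ∈ Fhat q₁ q₂ g φ y) (hw : w ∈ Fhat q₁ q₂ g φ y)
    (s t : ℂ) (k : Fin 3) : eval (gam R u v w s t) ((![q₁, q₂, g] : Fin 3 → _) k) = 0 := by
  obtain ⟨W, C, hC, hCZ, hsub, hQ⟩ := hc
  have mW : ∀ {x}, x ∈ Fhat q₁ q₂ g φ y → x ∈ W := by
    intro x hx
    have := hsub (Fhat_mem_fiber h₁ h₂ hg hx (Fhat_ne_zero he hx))
    obtain ⟨-, f, -, rfl, -⟩ := hC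
    have h3 := this.1
    rwa [Projectivization.submodule_mk, Submodule.span_singleton_le_iff_mem] at h3
  have mR : ∀ {x}, x ∈ Fhat q₁ q₂ g φ y → eval x R = 0 := by
    intro x hx
    have := mem_Fhat.1 hx
    exact (hRQ x (hQ x (mW hx))).2 ⟨this.1, this.2.1⟩
  obtain ⟨u', uF, v', vF, w', wF, a1, a2, a3, hbad⟩ := hb
  have hsp := (conic_R h₁ h₂ hZ hR hRQ hC hCZ hQ (Fhat_ne_zero he uF) (Fhat_ne_zero he vF) (Fhat_ne_zero he wF)
    (hsub (Fhat_mem_fiber h₁ h₂ hg uF _)) (hsub (Fhat_mem_fiber h₁ h₂ hg vF _)) (hsub (Fhat_mem_fiber h₁ h₂ hg wF _))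
    (gradL_pair hR (mR uF) (mR vF) a1) (gradL_pair hR (mR uF) (mR wF) a2) (gradL_pair hR (mR vF) (mR wF) a3)).2.2.2.2
  have gW : gam R u v w s t ∈ W := by
    rw [gam]
    exact W.add_mem (W.add_mem (W.smul_mem _ (mW hu)) (W.smul_mem _ (mW hv))) (W.smul_mem _ (mW hw))
  have gR := gam_zero hR (mR hu) (mR hv) (mR hw) s t
  have gq := (hRQ _ (hQ _ gW)).1 gR
  fin_cases k
  · exact gq.1
  · exact gq.2
  · exact bad_span hd hg hR (mR uF) (mR vF) (mR wF) (mem_Fhat.1 vF).2.2.1 a1 a2 a3 hbad _ (hsp ▸ gW) gR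

open Topology Filter Set in
theorem bad_open_false {q₁ q₂ g Q R : MvPolynomial (Fin 6) ℂ} {d N : ℕ} (hd : 8 ≤ d)
    (h₁ : q₁.IsHomogeneous 2) (h₂ : q₂.IsHomogeneous 2) (hg : g.IsHomogeneous d) (hZ : IsSmoothCI2 q₁ q₂) 
    (hX : IsSmoothCI3 q₁ q₂ g) (hR : R.IsHomogeneous 2)
    (hRQ : ∀ v, eval v Q = 0 → (eval v R = 0 ↔ eval v q₁ = 0 ∧ eval v q₂ = 0))
    {φ : RatMapTo (Fin 6) 2} (he : 0 < φ.e) {U : Set (Fin 2 → ℂ)} (hU : IsOpen U)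
    (hF : ∀ y ∈ U, (Fhat q₁ q₂ g φ y).Finite ∧ (Fhat q₁ q₂ g φ y).ncard = N ∧
      ∀ w ∈ Fhat q₁ q₂ g φ y, (Jac (sysPhi q₁ q₂ g φ) w).det ≠ 0) (y₀ : Fin 2 → ℂ) (hy₀ : y₀ ∈ U)
    (hcard : 3 ≤ (φ.fiber (ZeroSet q₁ ∩ ZeroSet q₂ ∩ ZeroSet g) (ptY y₀)).ncard)
    (hc : ∀ y ∈ U, ConY q₁ q₂ g Q φ y) (hb : ∀ y ∈ U, BadY q₁ q₂ g R φ y) : False := by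
  obtain ⟨B, σ, hBo, hyB, hBU, hB⟩ := local_sections hU hF y₀ hy₀
  obtain ⟨u, uF, v, vF, w, wF, i1, i2, i3⟩ := exists_triple h₁ h₂ hg he hcard
  obtain ⟨W, C, hC, hCZ, hsub, hQ⟩ := hc y₀ hy₀
  obtain ⟨a1, a2, a3, hl, -⟩ := conic_R h₁ h₂ hZ hR hRQ hC hCZ hQ (Fhat_ne_zero he uF) (Fhat_ne_zero he vF) (Fhat_ne_zero he wF)
    (hsub (Fhat_mem_fiber h₁ h₂ hg uF _)) (hsub (Fhat_mem_fiber h₁ h₂ hg vF _)) (hsub (Fhat_mem_fiber h₁ h₂ hg wF _)) i1 i2 i3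
  obtain ⟨hr, -, hdiff⟩ := hB y₀ hyB
  rw [hr] at uF vF wF
  obtain ⟨i, rfl⟩ := uF
  obtain ⟨j, rfl⟩ := vF
  obtain ⟨k, rfl⟩ := wF
  have mem : ∀ y ∈ B, ∀ l, σ l y ∈ Fhat q₁ q₂ g φ y := by
    intro y hy l
    rw [(hB y hy).1]
    exact mem_range_self l
  refine bad_core hd h₁ h₂ hg hX hR φ he (σ i) (σ j) (σ k) y₀ (hdiff i) (hdiff j) (hdiff k) hl a1 a2 a3 ?_ ?_
  · filter_upwards [hBo.mem_nhds hyB] with y hy l s t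
    exact bad_all (by omega) h₁ h₂ hg hZ hR hRQ he (hc y (hBU hy)) (hb y (hBU hy)) (mem y hy i) (mem y hy j) (mem y hy k) s t l
  · filter_upwards [hBo.mem_nhds hyB] with y hy
    exact (mem_Fhat.1 (mem y hy i)).2.2.2

/-- coordinates for triples of points -/
noncomputable def e19 : (Fin 6 ⊕ Fin 6 ⊕ Fin 6 ⊕ Unit) ≃ Fin 19 := Fintype.equivFinOfCardEq (by simp)

/-- universal polar form -/
noncomputable def gLP {n : ℕ} (R : MvPolynomial (Fin 6) ℂ) (a b : Fin 6 → Fin n) : MvPolynomial (Fin n) ℂ :=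
  ∑ i, rename a (pderiv i R) * X (b i)

theorem gLP_eval {n : ℕ} (R : MvPolynomial (Fin 6) ℂ) (a b : Fin 6 → Fin n) (x : Fin n → ℂ) :
    eval x (gLP R a b) = gradL R (x ∘ a) (x ∘ b) := by
  rw [gradL_apply, gLP, map_sum]
  refine Finset.sum_congr rfl fun i _ => ?_
  rw [map_mul, eval_rename, eval_X]
  rfl

/-- universal parametrization -/
noncomputable def gamU {n : ℕ} (R : MvPolynomial (Fin 6) ℂ) (a b c : Fin 6 → Fin n) (s t : ℂ) (i : Fin 6) : MvPolynomial (Fin n) ℂ :=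
  (-(gLP R a b * MvPolynomial.C t * (gLP R b c * MvPolynomial.C s + gLP R a c * MvPolynomial.C t))) * X (a i) +
  (-(gLP R a b * MvPolynomial.C s * (gLP R b c * MvPolynomial.C s + gLP R a c * MvPolynomial.C t))) * X (b i) +
  (gLP R a b ^ 2 * MvPolynomial.C s * MvPolynomial.C t) * X (c i)

theorem gamU_eval {n : ℕ} (R : MvPolynomial (Fin 6) ℂ) (a b c : Fin 6 → Fin n) (s t : ℂ) (x : Fin n → ℂ) :
    (fun i => eval x (gamU R a b c s t i)) = gam R (x ∘ a) (x ∘ b) (x ∘ c) s t := by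
  ext i
  simp only [gamU, gam, map_add, map_mul, map_neg, map_pow, gLP_eval, eval_C, eval_X, Pi.add_apply, Pi.smul_apply, smul_eq_mul,
    Function.comp_apply]

theorem bad_elim (q₁ q₂ g R : MvPolynomial (Fin 6) ℂ) (φ : RatMapTo (Fin 6) 2) :
    (∃ D : MvPolynomial (Fin 2) ℂ, D ≠ 0 ∧ ∀ y, BadY q₁ q₂ g R φ y → eval y D = 0) ∨
    (∃ r : MvPolynomial (Fin 2) ℂ, r ≠ 0 ∧ ∀ y, eval y r ≠ 0 → BadY q₁ q₂ g R φ y) := by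
  let a : Fin 6 → Fin 19 := fun i => e19 (Sum.inl i)
  let b : Fin 6 → Fin 19 := fun i => e19 (Sum.inr (Sum.inl i))
  let c : Fin 6 → Fin 19 := fun i => e19 (Sum.inr (Sum.inr (Sum.inl i)))
  let z : Fin 19 := e19 (Sum.inr (Sum.inr (Sum.inr ())))
  let base : (Fin 6 → Fin 19) → Set (MvPolynomial (Fin 19) ℂ) := fun k =>
    {rename k q₁, rename k q₂, rename k g, rename k (φ.F 0) - 1, rename k (φ.F 1) - rename a (φ.F 1), rename k (φ.F 2) - rename a (φ.F 2)}
  let Ps : Set (MvPolynomial (Fin 19) ℂ) := base a ∪ base b ∪ base c ∪ {X z * (gLP R a b * gLP R a c * gLP R b c) - 1} ∪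
    Set.range (fun p : ℂ × ℂ => aeval (gamU R a b c p.1 p.2) g)
  let F : Fin 2 → MvPolynomial (Fin 19) ℂ := ![rename a (φ.F 1), rename a (φ.F 2)]
  have hF : ∀ x : Fin 19 → ℂ, (fun i => eval x (F i)) = ![eval (x ∘ a) (φ.F 1), eval (x ∘ a) (φ.F 2)] := by
    intro x
    ext i
    fin_cases i <;> exact eval_rename ..
  have hbase : ∀ (x : Fin 19 → ℂ) (k : Fin 6 → Fin 19), (∀ p ∈ base k, eval x p = 0) ↔
      x ∘ k ∈ Fhat q₁ q₂ g φ ![eval (x ∘ a) (φ.F 1), eval (x ∘ a) (φ.F 2)] := by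
    intro x k
    rw [mem_Fhat]
    simp [base, eval_rename, sub_eq_zero]
  have hPs : ∀ x : Fin 19 → ℂ, (∀ p ∈ Ps, eval x p = 0) ↔
      (x ∘ a ∈ Fhat q₁ q₂ g φ ![eval (x ∘ a) (φ.F 1), eval (x ∘ a) (φ.F 2)] ∧
      x ∘ b ∈ Fhat q₁ q₂ g φ ![eval (x ∘ a) (φ.F 1), eval (x ∘ a) (φ.F 2)] ∧
      x ∘ c ∈ Fhat q₁ q₂ g φ ![eval (x ∘ a) (φ.F 1), eval (x ∘ a) (φ.F 2)]) ∧ 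
      x z * (gradL R (x ∘ a) (x ∘ b) * gradL R (x ∘ a) (x ∘ c) * gradL R (x ∘ b) (x ∘ c)) = 1 ∧
      ∀ s t, eval (gam R (x ∘ a) (x ∘ b) (x ∘ c) s t) g = 0 := by
    intro x
    rw [← hbase x a, ← hbase x b, ← hbase x c]
    have hlast : eval x (X z * (gLP R a b * gLP R a c * gLP R b c) - 1) = 0 ↔ 
      x z * (gradL R (x ∘ a) (x ∘ b) * gradL R (x ∘ a) (x ∘ c) * gradL R (x ∘ b) (x ∘ c)) = 1 := by
      simp [gLP_eval, sub_eq_zero]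
    have hg : ∀ s t, eval x (aeval (gamU R a b c s t) g) = eval (gam R (x ∘ a) (x ∘ b) (x ∘ c) s t) g := by
      intro s t
      rw [eval_aeval', gamU_eval]
    rw [← hlast]
    simp only [← hg]
    constructor
    · intro h
      refine ⟨⟨fun p hp => h p ?_, fun p hp => h p ?_, fun p hp => h p ?_⟩, h _ ?_, fun s t => h _ ?_⟩
      · exact Or.inl (Or.inl (Or.inl (Or.inl hp)))
      · exact Or.inl (Or.inl (Or.inl (Or.inr hp)))
      · exact Or.inl (Or.inl (Or.inr hp))
      · exact Or.inl (Or.inr rfl)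
      · exact Or.inr ⟨(s, t), rfl⟩
    · rintro ⟨⟨p1, p2, p3⟩, p4, p5⟩ p ((((hp | hp) | hp) | hp) | ⟨⟨s, t⟩, rfl⟩)
      · exact p1 p hp
      · exact p2 p hp
      · exact p3 p hp
      · rw [Set.mem_singleton_iff.1 hp]; exact p4
      · exact p5 s t
  rcases elim_image Ps F with ⟨D, hD, h⟩ | ⟨r, hr, h⟩
  · refine Or.inl ⟨D, hD, ?_⟩
    rintro y ⟨u, uF, v, vF, w, wF, a1, a2, a3, hbad⟩
    let x : Fin 19 → ℂ := (Sum.elim u (Sum.elim v (Sum.elim w fun _ => (gradL R u v * gradL R u w * gradL R v w)⁻¹))) ∘ e19.symm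
    have xa : x ∘ a = u := by ext i; simp [x, a]
    have xb : x ∘ b = v := by ext i; simp [x, b]
    have xc : x ∘ c = w := by ext i; simp [x, c]
    have xz : x z = (gradL R u v * gradL R u w * gradL R v w)⁻¹ := by simp [x, z]
    have hy : ![eval (x ∘ a) (φ.F 1), eval (x ∘ a) (φ.F 2)] = y := by
      rw [xa]
      ext i
      fin_cases i
      · exact (mem_Fhat.1 uF).2.2.2.2.1
      · exact (mem_Fhat.1 uF).2.2.2.2.2
    have := h x ((hPs x).2 (by
      rw [hy, xa, xb, xc, xz]
      exact ⟨⟨uF, vF, wF⟩, inv_mul_cancel₀ (mul_ne_zero (mul_ne_zero a1 a2) a3), hbad⟩))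
    rwa [hF, hy] at this
  · refine Or.inr ⟨r, hr, ?_⟩
    intro y hy
    obtain ⟨x, hx, hxy⟩ := h y hy
    rw [hF] at hxy
    obtain ⟨⟨p1, p2, p3⟩, p4, p5⟩ := (hPs x).1 hx
    rw [hxy] at p1 p2 p3
    have h0 : gradL R (x ∘ a) (x ∘ b) * gradL R (x ∘ a) (x ∘ c) * gradL R (x ∘ b) (x ∘ c) ≠ 0 := by
      intro h0
      rw [h0, mul_zero] at p4
      exact zero_ne_one p4
    exact ⟨_, p1, _, p2, _, p3, left_ne_zero_of_mul (left_ne_zero_of_mul h0), right_ne_zero_of_mul (left_ne_zero_of_mul h0),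
      right_ne_zero_of_mul h0, p5⟩

theorem homog_poly (D : MvPolynomial (Fin 2) ℂ) (hD : D ≠ 0) :
    ∃ (h : MvPolynomial (Fin 3) ℂ) (k : ℕ), h.IsHomogeneous k ∧ h ≠ 0 ∧ ∀ v : Fin 3 → ℂ, eval v h ≠ 0 →
      v 0 ≠ 0 ∧ eval ![v 1 / v 0, v 2 / v 0] D ≠ 0 := by
  set N := D.totalDegree with hN
  let h : MvPolynomial (Fin 3) ℂ := X 0 * ∑ k ∈ Finset.range (N + 1), X 0 ^ (N - k) * rename Fin.succ (homogeneousComponent k D)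
  have hh : h.IsHomogeneous (1 + N) := by
    refine (isHomogeneous_X ℂ 0).mul (IsHomogeneous.sum _ _ _ fun k hk => ?_)
    have h1 : (X 0 ^ (N - k) : MvPolynomial (Fin 3) ℂ).IsHomogeneous (N - k) := by
      simpa using (isHomogeneous_X ℂ (0 : Fin 3)).pow (N - k)
    have h2 := h1.mul ((homogeneousComponent_isHomogeneous k D).rename_isHomogeneous (f := Fin.succ))
    have : N - k + k = N := by have := Finset.mem_range.1 hk; omega
    rwa [this] at h2
  have h1 : ∀ y : Fin 2 → ℂ, eval ![1, y 0, y 1] h = eval y D := by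
    intro y
    have hc : (![1, y 0, y 1] : Fin 3 → ℂ) ∘ Fin.succ = y := by
      ext i; fin_cases i <;> rfl
    conv_rhs => rw [← sum_homogeneousComponent D]
    simp only [h, map_mul, map_sum, eval_X, map_pow, eval_rename, hc]
    simp [hN]
  have h2 : ∀ v : Fin 3 → ℂ, v 0 ≠ 0 → eval v h = v 0 ^ (1 + N) * eval ![v 1 / v 0, v 2 / v 0] D := by
    intro v hv
    have h4 : v = v 0 • ![1, (![v 1 / v 0, v 2 / v 0] : Fin 2 → ℂ) 0, (![v 1 / v 0, v 2 / v 0] : Fin 2 → ℂ) 1] := by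
      ext i
      fin_cases i <;> simp <;> field_simp
    conv_lhs => rw [h4, eval_hom hh, h1]
  refine ⟨h, 1 + N, hh, ?_, ?_⟩
  · intro h0
    obtain ⟨y, hy⟩ := exists_eval_ne hD
    rw [← h1, h0, map_zero] at hy
    exact hy rfl
  · intro v hv
    have hv0 : v 0 ≠ 0 := by
      intro h0
      apply hv
      simp [h, h0]
    refine ⟨hv0, ?_⟩
    rw [h2 v hv0] at hv
    exact right_ne_zero_of_mul hv

theorem inj_core {q₁ q₂ g Q R : MvPolynomial (Fin 6) ℂ} {d δ : ℕ} (hd : 8 ≤ d) (hδ : d + 1 ≤ δ)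
    (h₁ : q₁.IsHomogeneous 2) (h₂ : q₂.IsHomogeneous 2) (hg : g.IsHomogeneous d) (hZ : IsSmoothCI2 q₁ q₂) 
    (hR : R.IsHomogeneous 2)
    (hRQ : ∀ v, eval v Q = 0 → (eval v R = 0 ↔ eval v q₁ = 0 ∧ eval v q₂ = 0))
    {φ : RatMapTo (Fin 6) 2} (he : 0 < φ.e) (y₁ : Fin 2 → ℂ) (y₂ : PPt (Fin 3))
    (hc1 : (φ.fiber (ZeroSet q₁ ∩ ZeroSet q₂ ∩ ZeroSet g) (ptY y₁)).ncard = δ)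
    (hc2 : (φ.fiber (ZeroSet q₁ ∩ ZeroSet q₂ ∩ ZeroSet g) y₂).ncard = δ)
    (hcon : ConY q₁ q₂ g Q φ y₁) (hb : ¬ BadY q₁ q₂ g R φ y₁)
    (W : Submodule ℂ (Fin 6 → ℂ)) (hW : Module.finrank ℂ W = 3)
    (s1 : φ.fiber (ZeroSet q₁ ∩ ZeroSet q₂ ∩ ZeroSet g) (ptY y₁) ⊆ LinSet W)
    (s2 : φ.fiber (ZeroSet q₁ ∩ ZeroSet q₂ ∩ ZeroSet g) y₂ ⊆ LinSet W) : ptY y₁ = y₂ := by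
  classical
  by_contra hne
  apply hb
  set A := φ.fiber (ZeroSet q₁ ∩ ZeroSet q₂ ∩ ZeroSet g) (ptY y₁) with hA
  set B := φ.fiber (ZeroSet q₁ ∩ ZeroSet q₂ ∩ ZeroSet g) y₂ with hB
  have fA : A.Finite := Set.finite_of_ncard_pos (by omega)
  have fB : B.Finite := Set.finite_of_ncard_pos (by omega)
  obtain ⟨u, uF, v, vF, w, wF, i1, i2, i3⟩ := exists_triple h₁ h₂ hg he (y := y₁) (by rw [← hA, hc1]; omega)
  obtain ⟨Wc, C, hC, hCZ, hsub, hQ⟩ := hcon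
  have u0 := Fhat_ne_zero he uF
  have v0 := Fhat_ne_zero he vF
  have w0 := Fhat_ne_zero he wF
  have mu := Fhat_mem_fiber h₁ h₂ hg uF u0
  have mv := Fhat_mem_fiber h₁ h₂ hg vF v0
  have mw := Fhat_mem_fiber h₁ h₂ hg wF w0
  obtain ⟨a1, a2, a3, hl, hsp⟩ := conic_R h₁ h₂ hZ hR hRQ hC hCZ hQ u0 v0 w0 (hsub mu) (hsub mv) (hsub mw) i1 i2 i3
  have mW : ∀ {x : Fin 6 → ℂ} {hx : x ≠ 0}, Projectivization.mk ℂ x hx ∈ LinSet W → x ∈ W := by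
    intro x hx h
    have h3 : (Projectivization.mk ℂ x hx).submodule ≤ W := h
    rwa [Projectivization.submodule_mk, Submodule.span_singleton_le_iff_mem] at h3
  obtain ⟨hsp2, hcomb⟩ := span3_mem hW (mW (s1 mu)) (mW (s1 mv)) (mW (s1 mw)) hl
  have hWW : Wc = W := by rw [← hsp, hsp2]
  subst hWW
  have hAB : ∀ x ∈ A ∪ B, x.rep ∈ Wc ∧ eval x.rep R = 0 ∧ eval x.rep g = 0 := by
    intro x hx
    have hxL : x ∈ LinSet Wc := hx.elim (fun h => s1 h) (fun h => s2 h)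
    have hxZ : x ∈ ZeroSet q₁ ∩ ZeroSet q₂ ∩ ZeroSet g := hx.elim (fun h => h.1) (fun h => h.1)
    have hm := x.mk_rep
    have hxW : x.rep ∈ Wc := by
      apply mW (hx := x.rep_nonzero)
      rwa [hm]
    exact ⟨hxW, (hRQ _ (hQ _ hxW)).2 ⟨hxZ.1.1 _ x.rep_nonzero hm, hxZ.1.2 _ x.rep_nonzero hm⟩, hxZ.2 _ x.rep_nonzero hm⟩
  have hdisj : Disjoint A B := by
    rw [Set.disjoint_left]
    intro x hxA hxB
    obtain ⟨_, e1⟩ := hxA.2 _ x.rep_nonzero x.mk_rep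
    obtain ⟨_, e2⟩ := hxB.2 _ x.rep_nonzero x.mk_rep
    exact hne (e1.symm.trans e2)
  have hcardS : (fA.union fB).toFinset.card = δ + δ := by
    rw [← Set.ncard_eq_toFinset_card _ (fA.union fB), Set.ncard_union_eq hdisj fA fB, hc1, hc2]
  have eR : ∀ {x : Fin 6 → ℂ}, x ∈ Fhat q₁ q₂ g φ y₁ → eval x R = 0 := by
    intro x hx
    have hx0 := Fhat_ne_zero he hx
    have := mem_Fhat.1 hx
    exact (hRQ x (hQ x (mW (s1 (Fhat_mem_fiber h₁ h₂ hg hx hx0))))).2 ⟨this.1, this.2.1⟩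
  refine ⟨u, uF, v, vF, w, wF, a1, a2, a3, fun s t => ?_⟩
  refine bad_of_count hg hR (eR uF) (eR vF) (eR wF) (mem_Fhat.1 vF).2.2.1 a1 a2 a3 v0 (fA.union fB).toFinset (by omega) ?_ ?_ ?_ s t
  · intro x hx
    exact hcomb _ (hAB x ((fA.union fB).mem_toFinset.1 hx)).1
  · intro x hx
    exact (hAB x ((fA.union fB).mem_toFinset.1 hx)).2.1
  · intro x hx
    exact (hAB x ((fA.union fB).mem_toFinset.1 hx)).2.2

theorem main_core
    (d δ : ℕ) (hd : 8 ≤ d) 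
    (q₁ q₂ g Q R : MvPolynomial (Fin 6) ℂ)
    (h₁ : q₁.IsHomogeneous 2) (h₂ : q₂.IsHomogeneous 2)
    (hZ : IsSmoothCI2 q₁ q₂) (hg : g.IsHomogeneous d)
    (hX : IsSmoothCI3 q₁ q₂ g) (hR : R.IsHomogeneous 2)
    (hRQ : ∀ v, eval v Q = 0 → (eval v R = 0 ↔ eval v q₁ = 0 ∧ eval v q₂ = 0))
    (φ : RatMapTo (Fin 6) 2)
    (hφ : φ.DominantOfDegree (ZeroSet q₁ ∩ ZeroSet q₂ ∩ ZeroSet g) δ)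
    (V₀ : Set (PPt (Fin 3))) (hV₀ : ContainsDenseOpenOf Set.univ V₀)
    (hconic : ∀ y ∈ V₀, ∃ (W : Submodule ℂ (Fin 6 → ℂ)) (C : Set (PPt (Fin 6))),
        IsConicIn W C ∧ C ⊆ ZeroSet q₁ ∩ ZeroSet q₂ ∧
        φ.fiber (ZeroSet q₁ ∩ ZeroSet q₂ ∩ ZeroSet g) y ⊆ C ∧
        (∀ v ∈ W, eval v Q = 0)) :
    ∃ V : Set (PPt (Fin 3)), ContainsDenseOpenOf Set.univ V ∧ V ⊆ V₀ ∧
      ∀ y₁ ∈ V, ∀ y₂ ∈ V, ∀ W₁ W₂ : Submodule ℂ (Fin 6 → ℂ),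
        Module.finrank ℂ W₁ = 3 →
        φ.fiber (ZeroSet q₁ ∩ ZeroSet q₂ ∩ ZeroSet g) y₁ ⊆ LinSet W₁ →
        Module.finrank ℂ W₂ = 3 →
        φ.fiber (ZeroSet q₁ ∩ ZeroSet q₂ ∩ ZeroSet g) y₂ ⊆ LinSet W₂ →
        W₁ = W₂ → y₁ = y₂ := by
  obtain ⟨he, D, hD, hpk⟩ := affine_pkg h₁ h₂ hg hX φ hφ V₀ hV₀
  have hF : ∀ y, eval y D ≠ 0 → (Fhat q₁ q₂ g φ y).Finite ∧ (Fhat q₁ q₂ g φ y).ncard = δ * φ.e ∧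
      ∀ w ∈ Fhat q₁ q₂ g φ y, (Jac (sysPhi q₁ q₂ g φ) w).det ≠ 0 := fun y hy => (hpk y hy).2.2.2
  have hcon : ∀ y, eval y D ≠ 0 → ConY q₁ q₂ g Q φ y := fun y hy => hconic _ (hpk y hy).1
  have hge : d + 1 ≤ δ := by
    obtain ⟨y, hy⟩ := exists_eval_ne hD
    obtain ⟨W, C, hC, hCZ, hsub, hQ⟩ := hcon y hy
    exact fiber_ge (by omega) h₁ h₂ hg hX φ he D hF y hy (hpk y hy).2.1 (hpk y hy).2.2.1 hφ.1 hC hsub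
  have hbad : ∃ D₁ : MvPolynomial (Fin 2) ℂ, D₁ ≠ 0 ∧ ∀ y, BadY q₁ q₂ g R φ y → eval y D₁ = 0 := by
    rcases bad_elim q₁ q₂ g R φ with h | ⟨r, hr, h⟩
    · exact h
    · exfalso
      obtain ⟨y₀, hy₀⟩ := exists_eval_ne (mul_ne_zero hr hD)
      have hU : IsOpen {y : Fin 2 → ℂ | eval y (r * D) ≠ 0} := isOpen_ne_fun (eval_continuous _) continuous_const
      have hUr : ∀ y ∈ {y : Fin 2 → ℂ | eval y (r * D) ≠ 0}, eval y r ≠ 0 ∧ eval y D ≠ 0 := by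
        intro y hy
        have hy' : eval y (r * D) ≠ 0 := hy
        rw [map_mul] at hy'
        exact ⟨left_ne_zero_of_mul hy', right_ne_zero_of_mul hy'⟩
      refine bad_open_false hd h₁ h₂ hg hZ hX hR hRQ he hU (fun y hy => hF y (hUr y hy).2) y₀ hy₀ ?_
        (fun y hy => hcon y (hUr y hy).2) (fun y hy => h y (hUr y hy).1)
      rw [(hpk y₀ (hUr y₀ hy₀).2).2.2.1]
      omega
  obtain ⟨D₁, hD₁, hD₁b⟩ := hbad
  obtain ⟨h, k, hh, h0, hv⟩ := homog_poly (D * D₁) (mul_ne_zero hD hD₁)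
  refine ⟨{p | ∃ y, eval y (D * D₁) ≠ 0 ∧ ptY y = p}, dense_open_of_poly h hh 0 h0 ?_, ?_, ?_⟩
  · intro v hv0 hve
    obtain ⟨c0, c1⟩ := hv v hve
    refine ⟨_, c1, ?_⟩
    rw [ptY, Projectivization.mk_eq_mk_iff']
    refine ⟨(v 0)⁻¹, ?_⟩
    ext i
    fin_cases i <;> simp <;> field_simp
  · rintro p ⟨y, hy, rfl⟩
    rw [map_mul] at hy
    exact (hpk y (left_ne_zero_of_mul hy)).1
  · rintro p ⟨y₁, hy₁, rfl⟩ p2 ⟨y₂, hy₂, rfl⟩ W W' hW s1 _ s2 rfl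
    rw [map_mul] at hy₁ hy₂
    exact inj_core hd hge h₁ h₂ hg hZ hR hRQ he y₁ (ptY y₂) (hpk y₁ (left_ne_zero_of_mul hy₁)).2.2.1
      (hpk y₂ (left_ne_zero_of_mul hy₂)).2.2.1 (hcon y₁ (left_ne_zero_of_mul hy₁))
      (fun hb => right_ne_zero_of_mul hy₁ (hD₁b y₁ hb)) W hW s1 s2

/-- **Lemma 4.8.** Let `Z ⊂ ℙ^5` be a smooth `(2,2)` complete
intersection, `X = Z ∩ {g = 0}` a smooth surface with `d ≥ 8`, and
`φ : X ⇢ ℙ^2` dominant of degree `≤ 2d` whose general fibers lie on smooth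
conics whose planes are contained in a fixed quadric `a•q₁ + b•q₂` of the
pencil.  Then the induced rational map `f : ℙ^2 ⇢ B ⊂ ℙ^3`, sending a general
point `y` to the plane spanned by the conic through the fiber over `y`, is
birational onto its image; equivalently, the assignment `y ↦ (plane of the
fiber over y)` is injective on a dense open set. -/
theorem induced_map_to_planes_birational
    (d δ : ℕ) (hd : 8 ≤ d) (hδ : δ ≤ 2 * d)
    (q₁ q₂ g : MvPolynomial (Fin 6) ℂ)
    (h₁ : q₁.IsHomogeneous 2) (h₂ : q₂.IsHomogeneous 2)
    (hZ : IsSmoothCI2 q₁ q₂) (hg : g.IsHomogeneous d)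
    (hX : IsSmoothCI3 q₁ q₂ g)
    (a b : ℂ) (hab : a ≠ 0 ∨ b ≠ 0)
    (φ : RatMapTo (Fin 6) 2)
    (hφ : φ.DominantOfDegree (ZeroSet q₁ ∩ ZeroSet q₂ ∩ ZeroSet g) δ)
    (V₀ : Set (PPt (Fin 3))) (hV₀ : ContainsDenseOpenOf Set.univ V₀)
    (hconic : ∀ y ∈ V₀, ∃ (W : Submodule ℂ (Fin 6 → ℂ)) (C : Set (PPt (Fin 6))),
        IsConicIn W C ∧ C ⊆ ZeroSet q₁ ∩ ZeroSet q₂ ∧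
        φ.fiber (ZeroSet q₁ ∩ ZeroSet q₂ ∩ ZeroSet g) y ⊆ C ∧
        (∀ v ∈ W, eval v (a • q₁ + b • q₂) = 0)) :
    ∃ V : Set (PPt (Fin 3)), ContainsDenseOpenOf Set.univ V ∧ V ⊆ V₀ ∧
      ∀ y₁ ∈ V, ∀ y₂ ∈ V, ∀ W₁ W₂ : Submodule ℂ (Fin 6 → ℂ),
        Module.finrank ℂ W₁ = 3 →
        φ.fiber (ZeroSet q₁ ∩ ZeroSet q₂ ∩ ZeroSet g) y₁ ⊆ LinSet W₁ →
        Module.finrank ℂ W₂ = 3 →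
        φ.fiber (ZeroSet q₁ ∩ ZeroSet q₂ ∩ ZeroSet g) y₂ ⊆ LinSet W₂ →
        W₁ = W₂ → y₁ = y₂ := by
  by_cases ha : a = 0
  · have hb : b ≠ 0 := hab.resolve_left (fun h => h ha)
    refine main_core d δ hd q₁ q₂ g (a • q₁ + b • q₂) q₁ h₁ h₂ hZ hg hX h₁ ?_ φ hφ V₀ hV₀ hconic
    intro v hv
    simp only [map_add, smul_eval, ha, zero_mul, zero_add] at hv
    exact ⟨fun h => ⟨h, (mul_eq_zero.1 hv).resolve_left hb⟩, fun h => h.1⟩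
  · refine main_core d δ hd q₁ q₂ g (a • q₁ + b • q₂) q₂ h₁ h₂ hZ hg hX h₂ ?_ φ hφ V₀ hV₀ hconic
    intro v hv
    simp only [map_add, smul_eval] at hv
    refine ⟨fun h => ⟨?_, h⟩, fun h => h.2⟩
    rw [h, mul_zero, add_zero] at hv
    exact (mul_eq_zero.1 hv).resolve_left ha
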